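/- arXiv:1404.0775 — 5 statements merged into one kernel-verified Lean document; each statement's English description precedes it below -/
import Mathlib

section
/- (Roth's theorem) Let E ⊆ ℕ be a set of positive upper density, i.e. limsup_{N→∞} |E ∩ [1,N]|/N > 0. Then E contains a non-trivial 3-term arithmetic progression: there exist x ∈ E and an integer d ≠ 0 with x + d ∈ E and x + 2d ∈ E. -/
open Filter

/-- The upper density of a set of natural numbers:
`d̄(E) = limsup_{N→∞} |E ∩ [1,N]| / N`. -/
noncomputable def upperDensity (E : Set ℕ) : ℝ :=
  limsup (fun N : ℕ => (Nat.card ↥(E ∩ Set.Icc 1 N) : ℝ) / (N : ℝ)) atTop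

/-- **Roth's theorem**: a set of natural numbers of positive upper density contains
a non-trivial 3-term arithmetic progression. -/
theorem roth_three_term_ap (E : Set ℕ) (hE : 0 < upperDensity E) :
    ∃ x ∈ E, ∃ d : ℤ, d ≠ 0 ∧
      (∃ y ∈ E, (y : ℤ) = (x : ℤ) + d) ∧ (∃ z ∈ E, (z : ℤ) = (x : ℤ) + 2 * d) := by
  classical
  set ε : ℝ := upperDensity E / 4 with hε
  have hε0 : 0 < ε := by positivity
  have hfreq : ∃ᶠ N : ℕ in atTop,
      2 * ε < (Nat.card ↥(E ∩ Set.Icc 1 N) : ℝ) / (N : ℝ) := by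
    apply frequently_lt_of_lt_limsup
    · exact isCoboundedUnder_le_of_le atTop (x := 0) (fun N => by positivity)
    · change 2 * ε < upperDensity E
      rw [hε]; linarith
  obtain ⟨N, hN, hNd⟩ :=
    (frequently_atTop.1 hfreq) (max 1 (cornersTheoremBound (ε / 3)))
  have hN1 : 1 ≤ N := le_trans (le_max_left _ _) hN
  have hN2 : cornersTheoremBound (ε / 3) ≤ N + 1 := (le_trans (le_max_right _ _) hN).trans (by omega)
  have hN1' : (1 : ℝ) ≤ N := by exact_mod_cast hN1
  rw [lt_div_iff₀ (by linarith)] at hNd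
  let A : Finset ℕ := (Finset.Icc 1 N).filter (· ∈ E)
  have hA : (A : Set ℕ) = E ∩ Set.Icc 1 N := by
    ext x; simp [A]; tauto
  have hcard : Nat.card ↥(E ∩ Set.Icc 1 N) = A.card := by
    rw [← hA]; simp
  rw [hcard] at hNd
  have key := roth_3ap_theorem_nat (n := N + 1) ε hε0 hN2 A
    (by intro x hx; simp [A] at hx ⊢; omega)
    (by push_cast; nlinarith)
  unfold ThreeAPFree at key
  push Not at key
  obtain ⟨a, ha, b, hb, c, hc, habc, hne⟩ := key
  rw [hA] at ha hb hc
  exact ⟨a, ha.1, (b : ℤ) - a, by omega, ⟨b, hb.1, by ring⟩, ⟨c, hc.1, by omega⟩⟩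
end

section
/- (Szemerédi's theorem) Let E ⊆ ℕ be a set of positive upper density, i.e. limsup_{N→∞} |E ∩ [1,N]|/N > 0, and let k ≥ 1. Then E contains a non-trivial (k+1)-term arithmetic progression: there exist x ∈ E and an integer d ≠ 0 with x + jd ∈ E for all j = 0,1,…,k. -/
open Filter

namespace SzProof

open Combinatorics

open Classical in
/-- real-valued indicator of a proposition -/
noncomputable def ind (p : Prop) : ℝ := if p then 1 else 0

lemma ind_true {p : Prop} (h : p) : ind p = 1 := by simp [ind, h]
lemma ind_false {p : Prop} (h : ¬ p) : ind p = 0 := by simp [ind, h]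
lemma ind_nonneg (p : Prop) : 0 ≤ ind p := by unfold ind; split_ifs <;> norm_num
lemma ind_le_one (p : Prop) : ind p ≤ 1 := by unfold ind; split_ifs <;> norm_num
lemma ind_mono {p q : Prop} (h : p → q) : ind p ≤ ind q := by
  by_cases hp : p
  · rw [ind_true hp, ind_true (h hp)]
  · rw [ind_false hp]; exact ind_nonneg q

lemma sum_ind_le {X : Type} [Fintype X] (A : X → Prop) :
    ∑ x, ind (A x) ≤ (Fintype.card X : ℝ) := by
  calc ∑ x, ind (A x) ≤ ∑ _x : X, (1 : ℝ) := Finset.sum_le_sum fun x _ => ind_le_one _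
    _ = _ := by simp

section ops
variable {η ζ α ι ι₁ ι₂ : Type}

/-- pull a subspace back along an equivalence of the coordinates -/
def re (V : Subspace η α ι₁) (e : ι ≃ ι₁) : Subspace η α ι where
  idxFun i := V.idxFun (e i)
  proper j := by
    obtain ⟨i, hi⟩ := V.proper j
    exact ⟨e.symm i, by simpa using hi⟩

lemma re_apply (V : Subspace η α ι₁) (e : ι ≃ ι₁) (x : η → α) : re V e x = V x ∘ e := rfl

/-- extend a subspace by constants on the right -/
def exr (V : Subspace η α ι₁) (y : ι₂ → α) : Subspace η α (ι₁ ⊕ ι₂) where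
  idxFun := Sum.elim V.idxFun (fun i => Sum.inl (y i))
  proper j := by
    obtain ⟨i, hi⟩ := V.proper j
    exact ⟨Sum.inl i, by simpa using hi⟩

lemma exr_apply (V : Subspace η α ι₁) (y : ι₂ → α) (x : η → α) :
    exr V y x = Sum.elim (V x) y := by
  funext i; cases i <;> rfl

/-- extend a subspace by constants on the left -/
def exl (y : ι₁ → α) (V : Subspace η α ι₂) : Subspace η α (ι₁ ⊕ ι₂) where
  idxFun := Sum.elim (fun i => Sum.inl (y i)) V.idxFun
  proper j := by
    obtain ⟨i, hi⟩ := V.proper j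
    exact ⟨Sum.inr i, by simpa using hi⟩

lemma exl_apply (V : Subspace η α ι₂) (y : ι₁ → α) (x : η → α) :
    exl y V x = Sum.elim y (V x) := by
  funext i; cases i <;> rfl

/-- composition of subspaces -/
def comp (V : Subspace η α ι) (W : Subspace ζ α η) : Subspace ζ α ι where
  idxFun i := (V.idxFun i).elim Sum.inl W.idxFun
  proper j := by
    obtain ⟨i, hi⟩ := W.proper j
    obtain ⟨i', hi'⟩ := V.proper i
    exact ⟨i', by simp [hi', hi]⟩

lemma comp_apply (V : Subspace η α ι) (W : Subspace ζ α η) (x : ζ → α) :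
    comp V W x = V (W x) := by
  funext i
  simp only [Subspace.coe_apply, comp]
  cases h : V.idxFun i <;> simp [Subspace.coe_apply]

/-- product of subspaces -/
def prd (V : Subspace η α ι₁) (W : Subspace ζ α ι₂) : Subspace (η ⊕ ζ) α (ι₁ ⊕ ι₂) where
  idxFun := Sum.elim (fun i => (V.idxFun i).map id Sum.inl) (fun i => (W.idxFun i).map id Sum.inr)
  proper j := by
    rcases j with j | j
    · obtain ⟨i, hi⟩ := V.proper j
      exact ⟨Sum.inl i, by simp [hi]⟩
    · obtain ⟨i, hi⟩ := W.proper j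
      exact ⟨Sum.inr i, by simp [hi]⟩

lemma prd_apply (V : Subspace η α ι₁) (W : Subspace ζ α ι₂) (x : η ⊕ ζ → α) :
    prd V W x = Sum.elim (V (x ∘ Sum.inl)) (W (x ∘ Sum.inr)) := by
  funext i
  rcases i with i | i
  · simp only [Subspace.coe_apply, prd, Sum.elim_inl]
    cases h : V.idxFun i <;> simp
  · simp only [Subspace.coe_apply, prd, Sum.elim_inr]
    cases h : W.idxFun i <;> simp

/-- rename the parameters -/
def dre (V : Subspace η α ι) (e : η ≃ ζ) : Subspace ζ α ι where
  idxFun i := (V.idxFun i).map id e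
  proper j := by
    obtain ⟨i, hi⟩ := V.proper (e.symm j)
    exact ⟨i, by simp [hi]⟩

lemma dre_apply (V : Subspace η α ι) (e : η ≃ ζ) (x : ζ → α) :
    dre V e x = V (x ∘ e) := by
  funext i
  simp only [Subspace.coe_apply, dre]
  cases h : V.idxFun i <;> simp

/-- view a subspace over `Λ` as one over `Option Λ` -/
def lift (V : Subspace η α ι) : Subspace η (Option α) ι where
  idxFun i := (V.idxFun i).map some id
  proper j := by
    obtain ⟨i, hi⟩ := V.proper j
    exact ⟨i, by simp [hi]⟩

lemma lift_apply (V : Subspace η α ι) (x : η → α) :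
    lift V (fun j => some (x j)) = fun i => some (V x i) := by
  funext i
  simp only [Subspace.coe_apply, lift]
  cases h : V.idxFun i <;> simp

lemma lift_getD (V : Subspace η α ι) (x : η → Option α) (a : α) (i : ι) :
    (lift V x i).getD a = V (fun j => (x j).getD a) i := by
  simp only [Subspace.coe_apply, lift]
  cases h : V.idxFun i <;> simp

lemma sub_injective (V : Subspace η α ι) : Function.Injective (fun x => V x) := by
  intro x y h
  funext j
  obtain ⟨i, hi⟩ := V.proper j
  have := congrFun h i
  simpa [Subspace.apply_inr hi] using this

instance [Finite α] [Finite η] [Finite ι] : Finite (Subspace η α ι) :=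
  Finite.of_injective (fun V : Subspace η α ι => V.idxFun) fun V W h => by
    ext1; exact h

lemma exists_split [Fintype ι] (n n' : ℕ) (h : n + n' ≤ Fintype.card ι) :
    ∃ n'', n' ≤ n'' ∧ Nonempty (ι ≃ Fin n ⊕ Fin n'') := by
  refine ⟨Fintype.card ι - n, by omega, ⟨Fintype.equivOfCardEq ?_⟩⟩
  simp; omega

lemma sum_split [Fintype α] [Fintype ι] [Fintype ι₁] [Fintype ι₂] [DecidableEq ι] [DecidableEq ι₁]
    [DecidableEq ι₂] (e : ι ≃ ι₁ ⊕ ι₂)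
    (f : (ι → α) → ℝ) :
    ∑ w, f w = ∑ y : ι₂ → α, ∑ x : ι₁ → α, f (Sum.elim x y ∘ e) := by
  rw [← Fintype.sum_prod_type']
  symm
  refine Fintype.sum_equiv
    ((Equiv.prodComm _ _).trans ((Equiv.sumArrowEquivProdArrow ι₁ ι₂ α).symm.trans
      (Equiv.arrowCongr e.symm (Equiv.refl α)))) _ _ ?_
  intro x
  rfl

end ops

/-- density theorem for `η`-dimensional subspaces over the alphabet `Λ` -/
def SD (η Λ : Type) [Fintype Λ] : Prop :=
  ∀ δ : ℝ, 0 < δ → ∃ n : ℕ, ∀ (ι : Type) [Fintype ι] [DecidableEq ι], n ≤ Fintype.card ι →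
    ∀ A : (ι → Λ) → Prop, δ * (Fintype.card Λ : ℝ) ^ (Fintype.card ι) ≤ ∑ x, ind (A x) →
      ∃ V : Subspace η Λ ι, ∀ x, A (V x)

lemma markov {Y : Type} [Fintype Y] (g : Y → ℝ) (c δ : ℝ) (hc : 0 < c) (hδ : 0 < δ)
    (hg : ∀ y, g y ≤ c) (h : δ * c * (Fintype.card Y : ℝ) ≤ ∑ y, g y) :
    δ / 2 * (Fintype.card Y : ℝ) ≤ ∑ y, ind (δ / 2 * c ≤ g y) := by
  have h1 : ∑ y, g y ≤ ∑ y, (c * ind (δ / 2 * c ≤ g y) + δ / 2 * c) := by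
    refine Finset.sum_le_sum fun y _ => ?_
    by_cases hy : δ / 2 * c ≤ g y
    · rw [ind_true hy]; have := hg y; have : 0 < δ / 2 * c := by positivity
      linarith [hg y]
    · rw [ind_false hy]; linarith
  rw [Finset.sum_add_distrib, ← Finset.mul_sum] at h1
  simp only [Finset.sum_const, Finset.card_univ, nsmul_eq_mul] at h1
  have : c * (δ / 2 * (Fintype.card Y : ℝ)) ≤ c * ∑ y, ind (δ / 2 * c ≤ g y) := by nlinarith
  exact le_of_mul_le_mul_left this hc

lemma popular {η Λ ι : Type} [Finite η] [Fintype Λ] [Nonempty Λ] [Fintype ι] [DecidableEq ι] (δ : ℝ)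
    (hδ : 0 < δ)
    (h : ∀ A : (ι → Λ) → Prop,
      δ / 2 * (Fintype.card Λ : ℝ) ^ (Fintype.card ι) ≤ ∑ x, ind (A x) →
      ∃ V : Subspace η Λ ι, ∀ x, A (V x))
    {Y : Type} [Fintype Y] [Nonempty Y] (A : Y → (ι → Λ) → Prop)
    (hA : δ * (Fintype.card Λ : ℝ) ^ (Fintype.card ι) * (Fintype.card Y : ℝ) ≤
      ∑ y, ∑ x, ind (A y x)) :
    ∃ V : Subspace η Λ ι,
      (δ / 2) / (Nat.card (Subspace η Λ ι) + 1) * (Fintype.card Y : ℝ) ≤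
        ∑ y, ind (∀ x, A y (V x)) := by
  classical
  have : Fintype (Subspace η Λ ι) := Fintype.ofFinite _
  by_contra hcon
  push Not at hcon
  have hk : (0 : ℝ) < Fintype.card Λ := by exact_mod_cast Fintype.card_pos
  have hY : (0 : ℝ) < Fintype.card Y := by exact_mod_cast Fintype.card_pos
  have h1 := markov (fun y => ∑ x, ind (A y x)) ((Fintype.card Λ : ℝ) ^ (Fintype.card ι)) δ
    (by positivity) hδ (fun y => (sum_ind_le _).trans (by simp)) hA
  have h2 : ∑ y, ind (δ / 2 * (Fintype.card Λ : ℝ) ^ (Fintype.card ι) ≤ ∑ x, ind (A y x)) ≤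
      ∑ y, ∑ V : Subspace η Λ ι, ind (∀ x, A y (V x)) := by
    refine Finset.sum_le_sum fun y _ => ?_
    by_cases hy : δ / 2 * (Fintype.card Λ : ℝ) ^ (Fintype.card ι) ≤ ∑ x, ind (A y x)
    · obtain ⟨V, hV⟩ := h _ hy
      rw [ind_true hy, ← ind_true hV]
      exact Finset.single_le_sum (f := fun V : Subspace η Λ ι => ind (∀ x, A y (V x)))
        (fun _ _ => ind_nonneg _) (Finset.mem_univ V)
    · rw [ind_false hy]; exact Finset.sum_nonneg fun _ _ => ind_nonneg _
  rw [Finset.sum_comm] at h2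
  have h3 : ∑ V : Subspace η Λ ι, ∑ y, ind (∀ x, A y (V x)) ≤
      ∑ _V : Subspace η Λ ι, (δ / 2) / (Nat.card (Subspace η Λ ι) + 1) * (Fintype.card Y : ℝ) :=
    Finset.sum_le_sum fun V _ => (hcon V).le
  simp only [Finset.sum_const, Finset.card_univ, nsmul_eq_mul, Nat.card_eq_fintype_card] at h3
  set q : ℝ := (Fintype.card (Subspace η Λ ι) : ℝ) with hq
  have hq0 : 0 ≤ q := by positivity
  have : q * (δ / 2 / (q + 1) * (Fintype.card Y : ℝ)) < δ / 2 * (Fintype.card Y : ℝ) := by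
    have : q * (δ / 2 / (q + 1) * (Fintype.card Y : ℝ)) =
      (q / (q + 1)) * (δ / 2 * (Fintype.card Y : ℝ)) := by field_simp
    rw [this]
    have h5 : q / (q + 1) < 1 := by rw [div_lt_one (by positivity)]; linarith
    have h6 : 0 < δ / 2 * (Fintype.card Y : ℝ) := by positivity
    nlinarith
  linarith

lemma SD_sum {η ζ Λ : Type} [Finite η] [Fintype Λ] [Nonempty Λ] (h1 : SD η Λ) (h2 : SD ζ Λ) :
    SD (η ⊕ ζ) Λ := by
  intro δ hδ
  obtain ⟨n1, hn1⟩ := h1 (δ / 2) (by positivity)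
  obtain ⟨n2, hn2⟩ := h2 ((δ / 2) / (Nat.card (Subspace η Λ (Fin n1)) + 1)) (by positivity)
  refine ⟨n1 + n2, fun ι _ _ hι A hA => ?_⟩
  obtain ⟨n', hn', ⟨e⟩⟩ := exists_split (ι := ι) n1 n2 hι
  have hcard : Fintype.card ι = n1 + n' := by rw [Fintype.card_congr e]; simp
  obtain ⟨V, hV⟩ := popular (η := η) (ι := Fin n1) δ hδ
    (fun A hA => hn1 (Fin n1) (by simp) A hA) (Y := Fin n' → Λ)
    (fun y x => A (Sum.elim x y ∘ e)) (by
      rw [sum_split e] at hA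
      refine le_trans (le_of_eq ?_) hA
      rw [hcard, pow_add]; simp; ring)
  obtain ⟨W, hW⟩ := hn2 (Fin n') (by simpa using hn') _ (by
      refine le_trans (le_of_eq ?_) hV
      simp)
  refine ⟨re (prd V W) e, fun x => ?_⟩
  rw [re_apply, prd_apply]
  exact hW _ _

lemma SD_congr {η ζ Λ : Type} [Fintype Λ] (e : η ≃ ζ) (h : SD η Λ) : SD ζ Λ := by
  intro δ hδ
  obtain ⟨n, hn⟩ := h δ hδ
  refine ⟨n, fun ι _ _ hι A hA => ?_⟩
  obtain ⟨V, hV⟩ := hn ι hι A hA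
  exact ⟨dre V e, fun x => by rw [dre_apply]; exact hV _⟩

lemma SD_fin {Λ : Type} [Fintype Λ] [Nonempty Λ] (h : SD Unit Λ) (m : ℕ) : SD (Fin m) Λ := by
  induction m with
  | zero =>
    intro δ hδ
    refine ⟨0, fun ι _ _ _ A hA => ?_⟩
    have hk : (0 : ℝ) < Fintype.card Λ := by exact_mod_cast Fintype.card_pos
    have h0 : 0 < ∑ x, ind (A x) := lt_of_lt_of_le (by positivity) hA
    obtain ⟨x, -, hx⟩ := Finset.exists_ne_zero_of_sum_ne_zero h0.ne'
    have hx' : A x := by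
      by_contra hh; exact hx (ind_false hh)
    refine ⟨⟨fun i => Sum.inl (x i), fun j => j.elim0⟩, fun y => ?_⟩
    exact hx'
  | succ m ih =>
    exact SD_congr (Fintype.equivOfCardEq (by simp)) (SD_sum ih h)

/-- Kill the dependence on the letters. -/
lemma gr_step1 (Λ : Type) [Finite Λ] (B : ℕ) : ∀ (κ : Type) [Finite κ],
    ∃ (ι : Type) (_ : Fintype ι), ∀ c : (ι → Option Λ) → κ,
      ∃ V : Subspace (Fin B) Λ ι, ∀ v w : Fin B → Option Λ,
        (∀ j, v j = none ↔ w j = none) → c (lift V v) = c (lift V w) := by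
  induction B with
  | zero =>
    intro κ _
    refine ⟨Empty, inferInstance, fun c => ⟨⟨fun i => i.elim, fun j => j.elim0⟩, ?_⟩⟩
    intro v w _
    congr 1
    funext i; exact i.elim
  | succ B ih =>
    intro κ _
    obtain ⟨ι', _, h'⟩ := ih (Option Λ → κ)
    obtain ⟨ι1, _, h1⟩ := Line.exists_mono_in_high_dimension Λ ((ι' → Option Λ) → κ)
    refine ⟨ι1 ⊕ ι', inferInstance, fun c => ?_⟩
    obtain ⟨u, col, hu⟩ := h1 (fun x w => c (Sum.elim (fun i => some (x i)) w))
    obtain ⟨V', hV'⟩ := h' (fun w a => c (Sum.elim (fun i => (u.idxFun i).elim a some) w))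
    have key : ∀ (a b : Option Λ), (a = none ↔ b = none) → ∀ w : ι' → Option Λ,
        c (Sum.elim (fun i => (u.idxFun i).elim a some) w) =
        c (Sum.elim (fun i => (u.idxFun i).elim b some) w) := by
      intro a b hab w
      rcases a with _ | a
      · rw [hab.1 rfl]
      · rcases b with _ | b
        · simp at hab
        · have e : ∀ a : Λ, (fun i => (u.idxFun i).elim (some a) some) = fun i => some (u a i) := by
            intro a; funext i
            simp only [Line.coe_apply]
            cases u.idxFun i <;> rfl
          rw [e a, e b]
          have ha := congrFun (hu a) w
          have hb := congrFun (hu b) w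
          simp only at ha hb
          rw [ha, hb]
    let V : Subspace (Fin (B + 1)) Λ (ι1 ⊕ ι') :=
      { idxFun := Sum.elim (fun i => (u.idxFun i).elim (Sum.inr 0) Sum.inl)
          (fun i => (V'.idxFun i).map id Fin.succ)
        proper := by
          intro j
          refine Fin.cases ?_ (fun j => ?_) j
          · obtain ⟨i, hi⟩ := u.proper
            exact ⟨Sum.inl i, by simp [hi]⟩
          · obtain ⟨i, hi⟩ := V'.proper j
            exact ⟨Sum.inr i, by simp [hi]⟩ }
    have hV : ∀ v : Fin (B + 1) → Option Λ, lift V v =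
        Sum.elim (fun i => (u.idxFun i).elim (v 0) some) (lift V' (fun j => v j.succ)) := by
      intro v
      funext i
      rcases i with i | i
      · simp only [Subspace.coe_apply, lift, V, Sum.elim_inl]
        cases u.idxFun i <;> simp
      · simp only [Subspace.coe_apply, lift, V, Sum.elim_inr]
        cases V'.idxFun i <;> simp
    refine ⟨V, fun v w hvw => ?_⟩
    rw [hV, hV, key _ _ (hvw 0)]
    exact congrFun (hV' (fun j => v j.succ) (fun j => w j.succ) (fun j => hvw j.succ)) (w 0)

/-- Finite unions, first step: the colour depends only on the minimum. -/
lemma fu_step1 (M : ℕ) : ∃ (ι : Type) (_ : Fintype ι), ∀ c : (ι → Bool) → Prop,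
    ∃ s : ι → Option (Fin M), (∀ j, ∃ i, s i = some j) ∧ ∃ f : Fin M → Prop,
      ∀ v : Fin M → Bool, ∀ j, v j = true → (∀ i < j, v i = false) →
        (c (fun i => (s i).elim false v) ↔ f j) := by
  induction M with
  | zero =>
    exact ⟨Empty, inferInstance, fun c => ⟨fun i => i.elim, fun j => j.elim0, fun j => j.elim0,
      fun _ j => j.elim0⟩⟩
  | succ M ih =>
    obtain ⟨ι', _, h'⟩ := ih
    obtain ⟨ι, _, h⟩ := Subspace.exists_mono_in_high_dimension Bool Prop ι'
    refine ⟨Option ι, inferInstance, fun c => ?_⟩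
    obtain ⟨l, p, hl⟩ := h (fun w => c (fun o => o.elim true w))
    obtain ⟨s', hs', f', hf'⟩ := h' (fun u => c (fun o => o.elim false
      (fun i => (l.idxFun i).elim (fun _ => false) u)))
    let s : Option ι → Option (Fin (M + 1)) := fun o => o.elim (some 0)
      (fun i => (l.idxFun i).elim (fun b => if b then some 0 else none)
        (fun e => (s' e).map Fin.succ))
    refine ⟨s, ?_, Fin.cons p f', ?_⟩
    · intro j
      refine Fin.cases ?_ (fun j => ?_) j
      · exact ⟨none, rfl⟩
      · obtain ⟨e, he⟩ := hs' j
        obtain ⟨i, hi⟩ := l.proper e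
        exact ⟨some i, by simp [s, hi, he]⟩
    · intro v j
      refine Fin.cases ?_ (fun j => ?_) j
      · intro h0 _
        have := hl (fun e => (s' e).elim false (fun j => v j.succ))
        simp only [Fin.cons_zero]
        rw [← this]
        apply iff_of_eq
        congr 1
        funext o
        rcases o with _ | i
        · simp [s, h0]
        · simp only [s, Option.elim_some, Subspace.coe_apply]
          cases l.idxFun i with
          | inl b => cases b <;> simp [h0]
          | inr e => cases h : s' e <;> simp [h]
      · intro hj hlt
        have h0 : v 0 = false := hlt 0 (Fin.succ_pos j)
        have := hf' (fun j => v j.succ) j hj (fun i hi => hlt i.succ (Fin.succ_lt_succ_iff.2 hi))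
        simp only [Fin.cons_succ]
        rw [← this]
        apply iff_of_eq
        congr 1
        funext o
        rcases o with _ | i
        · simp [s, h0]
        · simp only [s, Option.elim_some]
          cases l.idxFun i with
          | inl b => cases b <;> simp [h0]
          | inr e => cases h : s' e <;> simp [h]

lemma fu_extract {ι : Type} {M m : ℕ} (c : (ι → Bool) → Prop) (s : ι → Option (Fin M))
    (hs : ∀ j, ∃ i, s i = some j) (g : Fin m ↪ Fin M) (P : Prop)
    (h : ∀ v : Fin M → Bool, ∀ j, v (g j) = true → (∀ i < g j, v i = false) →
        (c (fun i => (s i).elim false v) ↔ P)) :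
    ∃ s' : ι → Option (Fin m), (∀ j, ∃ i, s' i = some j) ∧
      ∀ v : Fin m → Bool, (∃ j, v j = true) → (c (fun i => (s' i).elim false v) ↔ P) := by
  classical
  let r : Fin M → Option (Fin m) := fun j => if h : ∃ i, g i = j then some h.choose else none
  have hr : ∀ i, r (g i) = some i := by
    intro i
    have hex : ∃ i', g i' = g i := ⟨i, rfl⟩
    simp only [r, hex, dif_pos]
    exact congrArg some (g.injective hex.choose_spec)
  have hr' : ∀ j i, r j = some i → g i = j := by
    intro j i hji
    by_cases hex : ∃ i', g i' = j
    · simp only [r, hex, dif_pos, Option.some.injEq] at hji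
      rw [← hji]; exact hex.choose_spec
    · simp [r, hex] at hji
  refine ⟨fun i => (s i).bind r, ?_, ?_⟩
  · intro j
    obtain ⟨i, hi⟩ := hs (g j)
    exact ⟨i, by simp [hi, hr]⟩
  · rintro v ⟨j0, hj0⟩
    let u : Fin M → Bool := fun j => (r j).elim false v
    have hne : (Finset.univ.filter (fun j => u j = true)).Nonempty :=
      ⟨g j0, by simp [u, hr, hj0]⟩
    have hmem := Finset.min'_mem _ hne
    have hmin := fun i hi => Finset.min'_le (Finset.univ.filter (fun j => u j = true)) i hi
    set j1 := (Finset.univ.filter (fun j => u j = true)).min' hne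
    simp only [Finset.mem_filter, Finset.mem_univ, true_and] at hmem hmin
    cases hrj : r j1 with
    | none => simp [u, hrj] at hmem
    | some i1 =>
      have hg := hr' _ _ hrj
      have := h u i1 (by rw [hg]; exact hmem) (by
        intro i hi
        rw [hg] at hi
        by_contra hc
        have := hmin i (by simpa using hc)
        exact absurd hi (not_lt.2 this))
      rw [← this]
      apply iff_of_eq
      congr 1
      funext i
      cases hsi : s i <;> simp [u, hsi]

lemma fu (m : ℕ) : ∃ (ι : Type) (_ : Fintype ι), ∀ c : (ι → Bool) → Prop,
    ∃ s : ι → Option (Fin m), (∀ j, ∃ i, s i = some j) ∧ ∃ P : Prop,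
      ∀ v : Fin m → Bool, (∃ j, v j = true) → (c (fun i => (s i).elim false v) ↔ P) := by
  classical
  obtain ⟨ι, hι, h⟩ := fu_step1 (2 * m)
  refine ⟨ι, hι, fun c => ?_⟩
  obtain ⟨s, hs, f, hf⟩ := h c
  have hsplit : m ≤ Fintype.card {j : Fin (2 * m) // f j} ∨
      m ≤ Fintype.card {j : Fin (2 * m) // ¬ f j} := by
    have h1 := Fintype.card_subtype_compl (fun j : Fin (2 * m) => f j)
    have h2 := Fintype.card_subtype_le (fun j : Fin (2 * m) => f j)
    simp only [Fintype.card_fin] at h1 h2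
    omega
  rcases hsplit with h1 | h1
  · obtain ⟨g⟩ := Function.Embedding.nonempty_of_card_le
      (α := Fin m) (β := {j : Fin (2 * m) // f j}) (by simpa using h1)
    obtain ⟨s', hs', h'⟩ := fu_extract c s hs (g.trans (Function.Embedding.subtype _)) True
      (fun v j hj hlt => by
        rw [hf v _ hj hlt]
        simpa using (g j).2)
    exact ⟨s', hs', True, h'⟩
  · obtain ⟨g⟩ := Function.Embedding.nonempty_of_card_le
      (α := Fin m) (β := {j : Fin (2 * m) // ¬ f j}) (by simpa using h1)
    obtain ⟨s', hs', h'⟩ := fu_extract c s hs (g.trans (Function.Embedding.subtype _)) False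
      (fun v j hj hlt => by
        rw [hf v _ hj hlt]
        simpa using (g j).2)
    exact ⟨s', hs', False, h'⟩

/-- Graham-Rothschild for lines. -/
lemma gr (Λ : Type) [Finite Λ] [Nonempty Λ] (m : ℕ) :
    ∃ (ι : Type) (_ : Fintype ι), ∀ c : (ι → Option Λ) → Prop,
      ∃ V : Subspace (Fin m) Λ ι, ∃ P : Prop, ∀ v : Fin m → Option Λ,
        (∃ j, v j = none) → (c (lift V v) ↔ P) := by
  classical
  obtain ⟨ι', _, h'⟩ := fu m
  let e := Fintype.equivFin ι'
  obtain ⟨ι, hι, h⟩ := gr_step1 Λ (Fintype.card ι') Prop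
  refine ⟨ι, hι, fun c => ?_⟩
  obtain ⟨V, hV⟩ := h c
  let a0 : Λ := Classical.arbitrary Λ
  obtain ⟨s, hs, P, hP⟩ := h' (fun b => c (lift V (fun j =>
    if b (e.symm j) then none else some a0)))
  let W : Subspace (Fin m) Λ (Fin (Fintype.card ι')) :=
    { idxFun := fun j => (s (e.symm j)).elim (Sum.inl a0) Sum.inr
      proper := by
        intro j
        obtain ⟨i, hi⟩ := hs j
        exact ⟨e i, by simp [hi]⟩ }
  refine ⟨comp V W, P, fun v hv => ?_⟩
  obtain ⟨j, hj⟩ := hv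
  rw [← hP (fun j => (v j).isNone) ⟨j, by simp [hj]⟩]
  have hl : lift (comp V W) v = lift V (lift W v) := by
    funext i
    simp only [Subspace.coe_apply, lift, comp]
    cases V.idxFun i <;> simp [Subspace.coe_apply]
  rw [hl]
  apply iff_of_eq
  apply hV
  intro j
  simp only [Subspace.coe_apply, lift, W]
  obtain hsj | ⟨i, hsj⟩ : s (e.symm j) = none ∨ ∃ i, s (e.symm j) = some i := by
    cases s (e.symm j) <;> simp
  · simp [hsj]
  · cases h : v i <;> simp [hsj, h]

/-- invariance under exchanging `a` and `none` -/
def Ins {Λ ι : Type} (a : Λ) (D : (ι → Option Λ) → Prop) : Prop :=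
  ∀ x y : ι → Option Λ, (∀ i, (x i).getD a = (y i).getD a) → D x → D y

lemma Ins.not {Λ ι : Type} {a : Λ} {D : (ι → Option Λ) → Prop} (h : Ins a D) :
    Ins a (fun x => ¬ D x) := fun x y hxy hx hy => hx (h y x (fun i => (hxy i).symm) hy)

lemma Ins.sub {Λ ι η : Type} {a : Λ} {D : (ι → Option Λ) → Prop} (h : Ins a D)
    (V : Subspace η (Option Λ) ι) : Ins a (fun x => D (V x)) := by
  intro x y hxy hx
  refine h _ _ (fun i => ?_) hx
  simp only [Subspace.coe_apply]
  cases V.idxFun i with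
  | inl b => rfl
  | inr e => exact hxy e

/-- words with few non-`none` letters are rare -/
lemma few_some (Λ : Type) [Fintype Λ] [Nonempty Λ] (m : ℕ) (ε : ℝ) (hε : 0 < ε) :
    ∃ N : ℕ, ∀ n ≥ N,
      ∑ x : Fin n → Option Λ, ind (Fintype.card {i // x i ≠ none} < m) ≤
        ε * (Fintype.card (Option Λ) : ℝ) ^ n := by
  classical
  set k : ℝ := (Fintype.card Λ : ℝ) with hk
  have hk0 : 0 < k := by rw [hk]; exact_mod_cast Fintype.card_pos
  have hlim := tendsto_pow_atTop_nhds_zero_of_lt_one (r := (1 + k / 2) / (1 + k))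
    (by positivity) (by rw [div_lt_one (by positivity)]; linarith)
  have hev := hlim.eventually (gt_mem_nhds (show (0 : ℝ) < ε / 2 ^ m by positivity))
  obtain ⟨N, hN⟩ := hev.exists_forall_of_atTop
  refine ⟨N, fun n hn => ?_⟩
  have h1 := hN n hn
  have h2 : ∀ x : Fin n → Option Λ, ind (Fintype.card {i // x i ≠ none} < m) ≤
      2 ^ m * ∏ i, (if x i = none then (1 : ℝ) else 1 / 2) := by
    intro x
    have hprod : ∏ i, (if x i = none then (1 : ℝ) else 1 / 2) =
        (1 / 2) ^ (Fintype.card {i // x i ≠ none}) := by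
      rw [Finset.prod_ite]
      simp [Fintype.card_subtype]
    rw [hprod]
    by_cases hx : Fintype.card {i // x i ≠ none} < m
    · rw [ind_true hx]
      calc (1 : ℝ) = 2 ^ m * (1 / 2) ^ m := by rw [← mul_pow]; norm_num
        _ ≤ _ := by
          gcongr 2 ^ m * ?_
          exact pow_le_pow_of_le_one (by norm_num) (by norm_num) hx.le
    · rw [ind_false hx]; positivity
  refine (Finset.sum_le_sum fun x _ => h2 x).trans ?_
  rw [← Finset.mul_sum]
  have h3 : ∑ x : Fin n → Option Λ, ∏ i, (if x i = none then (1 : ℝ) else 1 / 2) =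
      (1 + k / 2) ^ n := by
    have := Finset.prod_univ_sum (fun _ : Fin n => (Finset.univ : Finset (Option Λ)))
      (fun _ o => if o = none then (1 : ℝ) else 1 / 2)
    rw [Fintype.piFinset_univ] at this
    rw [← this]
    simp [Fintype.sum_option, hk]
    ring
  rw [h3]
  rw [div_pow] at h1
  have hc : (Fintype.card (Option Λ) : ℝ) = 1 + k := by simp [hk]; ring
  rw [hc]
  rw [div_lt_div_iff₀ (by positivity) (by positivity)] at h1
  nlinarith

/-- A dense insensitive set contains subspaces. -/
lemma ins_dense {Λ : Type} [Fintype Λ] [Nonempty Λ] (h : SD Unit Λ) (a : Λ) (m : ℕ) (η : ℝ)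
    (hη : 0 < η) :
    ∃ N : ℕ, ∀ D : (Fin N → Option Λ) → Prop, Ins a D →
      η * (Fintype.card (Option Λ) : ℝ) ^ N ≤ ∑ x, ind (D x) →
      ∃ V : Subspace (Fin m) (Option Λ) (Fin N), ∀ x, D (V x) := by
  classical
  obtain ⟨m1, hm1⟩ := SD_fin h m (η / 2) (by positivity)
  obtain ⟨N, hN⟩ := few_some Λ m1 (η / 4) (by positivity)
  refine ⟨N, fun D hD hdense => ?_⟩
  have hN' := hN N le_rfl
  -- fibre over the set of nones
  have hK : (0 : ℝ) < (Fintype.card (Option Λ) : ℝ) ^ N := by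
    have : (0 : ℝ) < Fintype.card (Option Λ) := by exact_mod_cast Fintype.card_pos
    positivity
  let ext : (S : Finset (Fin N)) → ({i // i ∉ S} → Λ) → (Fin N → Option Λ) :=
    fun S u i => if h : i ∉ S then some (u ⟨i, h⟩) else none
  let ns : (Fin N → Option Λ) → Finset (Fin N) := fun x => Finset.univ.filter (fun i => x i = none)
  have hfib : ∀ (f : (Fin N → Option Λ) → ℝ), ∑ x, f x = ∑ S : Finset (Fin N),
      ∑ u : {i // i ∉ S} → Λ, f (ext S u) := by
    intro f
    rw [← Finset.sum_fiberwise (s := Finset.univ) (g := ns)]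
    refine Finset.sum_congr rfl fun S _ => ?_
    symm
    refine Finset.sum_bij (fun u _ => ext S u) ?_ ?_ ?_ ?_
    · intro u _
      simp only [Finset.mem_filter, Finset.mem_univ, true_and]
      ext i
      by_cases hi : i ∈ S <;> simp [ns, ext, hi]
    · intro u _ u' _ huu
      funext i
      have := congrFun huu i.1
      simpa [ext, i.2] using this
    · intro x hx
      simp only [Finset.mem_filter, Finset.mem_univ, true_and] at hx
      have hx' : ∀ i, i ∉ S → (x i).isSome := by
        intro i hi
        rw [← hx] at hi
        simpa [ns, ← Option.isSome_iff_ne_none] using hi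
      refine ⟨fun i => (x i.1).get (hx' i.1 i.2), Finset.mem_univ _, ?_⟩
      funext i
      by_cases hi : i ∈ S
      · have : x i = none := by rw [← hx] at hi; simpa [ns] using hi
        simp [ext, hi, this]
      · simp [ext, hi]
    · intro u _; rfl
  have hex : ∃ S : Finset (Fin N), m1 ≤ Fintype.card {i // i ∉ S} ∧
      η / 2 * (Fintype.card Λ : ℝ) ^ (Fintype.card {i // i ∉ S}) ≤
        ∑ u : {i // i ∉ S} → Λ, ind (D (ext S u)) := by
    by_contra hcon
    push Not at hcon
    have hb : ∑ x, ind (D x) ≤ ∑ x : Fin N → Option Λ,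
        (ind (Fintype.card {i // x i ≠ none} < m1) + η / 2) := by
      rw [hfib, hfib]
      refine Finset.sum_le_sum fun S _ => ?_
      have hcardS : ∀ u : {i // i ∉ S} → Λ,
          Fintype.card {i // ext S u i ≠ none} = Fintype.card {i // i ∉ S} := by
        intro u
        refine Fintype.card_congr (Equiv.subtypeEquivRight fun i => ?_)
        by_cases hi : i ∈ S <;> simp [ext, hi]
      by_cases hS : m1 ≤ Fintype.card {i // i ∉ S}
      · refine (hcon S hS).le.trans ?_
        calc η / 2 * (Fintype.card Λ : ℝ) ^ (Fintype.card {i // i ∉ S})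
            = ∑ u : {i // i ∉ S} → Λ, η / 2 := by simp; ring
          _ ≤ _ := Finset.sum_le_sum fun u _ => by
            have := ind_nonneg (Fintype.card {i // ext S u i ≠ none} < m1)
            linarith
      · refine Finset.sum_le_sum fun u _ => ?_
        rw [hcardS u, ind_true (not_le.1 hS)]
        have := ind_le_one (D (ext S u))
        linarith
    rw [Finset.sum_add_distrib] at hb
    have : ∑ _x : Fin N → Option Λ, η / 2 = η / 2 * (Fintype.card (Option Λ) : ℝ) ^ N := by
      simp; ring
    rw [this] at hb
    nlinarith
  obtain ⟨S, hS1, hS2⟩ := hex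
  obtain ⟨U, hU⟩ := hm1 _ hS1 _ hS2
  let V : Subspace (Fin m) (Option Λ) (Fin N) :=
    { idxFun := fun i => if h : i ∉ S then (U.idxFun ⟨i, h⟩).map some id else Sum.inl none
      proper := by
        intro j
        obtain ⟨i, hi⟩ := U.proper j
        exact ⟨i.1, by simp [i.2, hi]⟩ }
  refine ⟨V, fun x => ?_⟩
  refine hD _ _ (fun i => ?_) (hU (fun j => (x j).getD a))
  simp only [Subspace.coe_apply, V, ext]
  by_cases hi : i ∈ S
  · simp [hi]
  · simp only [hi, not_false_eq_true, dif_pos]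
    cases U.idxFun ⟨i, hi⟩ <;> simp

lemma sum_range_sub {η α ι : Type} [Fintype α] [Fintype η] [Fintype ι] [DecidableEq η]
    [DecidableEq ι] (W : Subspace η α ι) (f : (ι → α) → ℝ) :
    ∑ x, ind (∃ t, x = W t) * f x = ∑ t, f (W t) := by
  classical
  have h1 : ∀ x, ind (∃ t, x = W t) * f x = ∑ t, if x = W t then f x else 0 := by
    intro x
    by_cases hx : ∃ t, x = W t
    · obtain ⟨t, ht⟩ := hx
      rw [ind_true ⟨t, ht⟩, one_mul, Finset.sum_eq_single t]
      · simp [ht]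
      · intro t' _ htt
        rw [if_neg]
        intro hxt
        exact htt (sub_injective W (hxt.symm.trans ht))
      · simp
    · rw [ind_false hx, zero_mul]
      symm
      refine Finset.sum_eq_zero fun t _ => ?_
      rw [if_neg]; exact fun h => hx ⟨t, h⟩
  simp only [h1]
  rw [Finset.sum_comm]
  refine Finset.sum_congr rfl fun t _ => ?_
  simp

lemma single_aux {Λ : Type} [Fintype Λ] [Nonempty Λ] (a : Λ) (m : ℕ) (η : ℝ)
    (hη : 0 < η) (N : ℕ)
    (hN : ∀ D : (Fin N → Option Λ) → Prop, Ins a D →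
      η / 2 * (Fintype.card (Option Λ) : ℝ) ^ N ≤ ∑ x, ind (D x) →
      ∃ V : Subspace (Fin m) (Option Λ) (Fin N), ∀ x, D (V x)) (r : ℕ) :
    ∀ (Z : Type) [Fintype Z] (ι : Type) [Fintype ι] [DecidableEq ι], r * N ≤ Fintype.card ι →
      ∀ (D : Z → (ι → Option Λ) → Prop) (f : Z → (ι → Option Λ) → ℝ), (∀ z x, f z x ≤ 1) →
      (∀ z, Ins a (D z)) →
      (∀ z (V : Subspace (Fin m) (Option Λ) ι), ∑ x, f z (V x) ≤ 0) →
      ∑ z, ∑ x, ind (D z x) ≤ (η + r * (η / 2 / (Fintype.card (Option Λ) : ℝ) ^ N)) *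
        ((Fintype.card Z : ℝ) * (Fintype.card (Option Λ) : ℝ) ^ (Fintype.card ι)) →
      ∑ z, ∑ x, ind (D z x) * f z x ≤ η *
        ((Fintype.card Z : ℝ) * (Fintype.card (Option Λ) : ℝ) ^ (Fintype.card ι)) := by
  classical
  have hK : (0 : ℝ) < (Fintype.card (Option Λ) : ℝ) := by exact_mod_cast Fintype.card_pos
  set K : ℝ := (Fintype.card (Option Λ) : ℝ) with hKdef
  have easy : ∀ (Z : Type) [Fintype Z] (ι : Type) [Fintype ι] [DecidableEq ι]
      (D : Z → (ι → Option Λ) → Prop) (f : Z → (ι → Option Λ) → ℝ), (∀ z x, f z x ≤ 1) →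
      ∑ z, ∑ x, ind (D z x) * f z x ≤ ∑ z, ∑ x, ind (D z x) := by
    intro Z _ ι _ _ D f hf
    refine Finset.sum_le_sum fun z _ => Finset.sum_le_sum fun x _ => ?_
    have := mul_le_mul_of_nonneg_left (hf z x) (ind_nonneg (D z x))
    linarith
  induction r with
  | zero =>
    intro Z _ ι _ _ _ D f hf _ _ hD
    refine (easy Z ι D f hf).trans (hD.trans (le_of_eq ?_))
    simp
  | succ r ih =>
    intro Z _ ι _ _ hι D f hf hins hV hD
    by_cases hsmall : ∑ z, ∑ x, ind (D z x) ≤ η * ((Fintype.card Z : ℝ) * K ^ (Fintype.card ι))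
    · exact (easy Z ι D f hf).trans hsmall
    push Not at hsmall
    obtain ⟨n', hn', ⟨e⟩⟩ := exists_split (ι := ι) N (r * N) (by rw [add_comm]; linarith)
    have hcard : Fintype.card ι = N + n' := by rw [Fintype.card_congr e]; simp
    rw [hcard] at hsmall hD ⊢
    let Sec : Z → (Fin n' → Option Λ) → (Fin N → Option Λ) → Prop :=
      fun z y x => D z (Sum.elim x y ∘ e)
    let Good : ((Fin N → Option Λ) → Prop) → Prop := fun E =>
      Ins a E ∧ η / 2 * K ^ N ≤ ∑ x, ind (E x)
    have hch : ∀ E : (Fin N → Option Λ) → Prop,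
        ∃ R : (Fin N → Option Λ) → Prop, (∀ x, R x → E x) ∧ (ind (Good E) ≤ ∑ x, ind (R x)) ∧
          ((∃ W : Subspace (Fin m) (Option Λ) (Fin N), R = fun x => ∃ t, x = W t) ∨
            R = fun _ => False) := by
      intro E
      by_cases hE : Good E
      · obtain ⟨W, hW⟩ := hN E hE.1 hE.2
        refine ⟨fun x => ∃ t, x = W t, ?_, ?_, Or.inl ⟨W, rfl⟩⟩
        · rintro x ⟨t, rfl⟩; exact hW t
        · rw [ind_true hE]
          have h0 : ∃ t, W (fun _ => none) = W t := ⟨_, rfl⟩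
          rw [← ind_true h0]
          exact Finset.single_le_sum (f := fun x => ind (∃ t, x = W t))
            (fun _ _ => ind_nonneg _) (Finset.mem_univ _)
      · refine ⟨fun _ => False, fun _ h => h.elim, ?_, Or.inr rfl⟩
        rw [ind_false hE]; exact Finset.sum_nonneg fun _ _ => ind_nonneg _
    choose R hR1 hR2 hR3 using hch
    have hinsSec : ∀ z y, Ins a (Sec z y) := by
      intro z y x x' hxx hx
      refine hins z _ _ (fun i => ?_) hx
      simp only [Function.comp]
      cases e i with
      | inl j => exact hxx j
      | inr j => rfl
    let D' : Z × (Fin N → Option Λ) → (Fin n' → Option Λ) → Prop := fun p y =>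
      Sec p.1 y p.2 ∧ ¬ R (Sec p.1 y) p.2
    let f' : Z × (Fin N → Option Λ) → (Fin n' → Option Λ) → ℝ := fun p y =>
      f p.1 (Sum.elim p.2 y ∘ e)
    have hrew : ∀ F : Z → (ι → Option Λ) → ℝ, ∑ z, ∑ x, F z x =
        ∑ z, ∑ y : Fin n' → Option Λ, ∑ x : Fin N → Option Λ, F z (Sum.elim x y ∘ e) := by
      intro F
      exact Finset.sum_congr rfl fun z _ => sum_split e _
    have hrew' : ∀ F : Z × (Fin N → Option Λ) → (Fin n' → Option Λ) → ℝ, ∑ p, ∑ y, F p y =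
        ∑ z, ∑ y : Fin n' → Option Λ, ∑ x : Fin N → Option Λ, F (z, x) y := by
      intro F
      rw [Fintype.sum_prod_type]
      exact Finset.sum_congr rfl fun z _ => Finset.sum_comm
    have hind : ∀ z y x, ind (Sec z y x) = ind (D' (z, x) y) + ind (R (Sec z y) x) := by
      intro z y x
      by_cases h1 : R (Sec z y) x
      · rw [ind_true h1, ind_true (hR1 _ _ h1), ind_false (fun h => h.2 h1)]; ring
      · rw [ind_false h1]
        by_cases h2 : Sec z y x
        · rw [ind_true h2, ind_true (p := D' (z, x) y) ⟨h2, h1⟩]; ring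
        · rw [ind_false h2, ind_false (fun h => h2 h.1)]; ring
    have hcardp : (Fintype.card (Z × (Fin N → Option Λ)) : ℝ) * K ^ (Fintype.card (Fin n')) =
        (Fintype.card Z : ℝ) * K ^ (N + n') := by
      rw [pow_add, hKdef]; simp; ring
    have key := ih (Z × (Fin N → Option Λ)) (Fin n') (by simpa using hn') D' f'
      (fun p y => hf _ _) ?_ ?_ ?_
    · rw [hcardp] at key
      refine le_trans ?_ key
      rw [hrew, hrew']
      refine Finset.sum_le_sum fun z _ => Finset.sum_le_sum fun y _ => ?_
      have h1 : ∀ x, ind (D z (Sum.elim x y ∘ e)) * f z (Sum.elim x y ∘ e) =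
          ind (D' (z, x) y) * f' (z, x) y + ind (R (Sec z y) x) * f z (Sum.elim x y ∘ e) := by
        intro x
        have := hind z y x
        simp only [Sec] at this ⊢
        rw [this]; simp only [f']; ring
      simp only [h1]
      rw [Finset.sum_add_distrib]
      have h2 : ∑ x, ind (R (Sec z y) x) * f z (Sum.elim x y ∘ e) ≤ 0 := by
        rcases hR3 (Sec z y) with ⟨W, hW⟩ | hW
        · rw [hW]
          rw [sum_range_sub W (fun x => f z (Sum.elim x y ∘ e))]
          have := hV z (re (exr W y) e)
          simpa only [re_apply, exr_apply] using this
        · rw [hW]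
          simp [ind]
      linarith
    · rintro ⟨z, x⟩ y y' hyy ⟨h1, h2⟩
      have hSec : Sec z y = Sec z y' := by
        have aux : ∀ y y' : Fin n' → Option Λ, (∀ i, (y i).getD a = (y' i).getD a) →
            ∀ x, Sec z y x → Sec z y' x := by
          intro y y' hyy x hx
          refine hins z _ _ (fun i => ?_) hx
          simp only [Function.comp]
          cases e i with
          | inl j => rfl
          | inr j => exact hyy j
        funext x
        exact propext ⟨aux y y' hyy x, aux y' y (fun i => (hyy i).symm) x⟩
      simp only at h1 h2
      rw [hSec] at h1 h2
      exact ⟨h1, h2⟩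
    · rintro ⟨z, x⟩ V
      have := hV z (re (exl x V) e)
      simpa only [re_apply, exl_apply] using this
    · rw [hcardp, hrew']
      have hDeq : ∑ z, ∑ x, ind (D z x) = ∑ z, ∑ y, ∑ x, ind (D' (z, x) y) +
          ∑ z, ∑ y, ∑ x, ind (R (Sec z y) x) := by
        rw [hrew]
        simp only [← Finset.sum_add_distrib]
        exact Finset.sum_congr rfl fun z _ => Finset.sum_congr rfl fun y _ =>
          Finset.sum_congr rfl fun x _ => hind z y x
      have hmk := markov (Y := Z × (Fin n' → Option Λ)) (fun p => ∑ x, ind (Sec p.1 p.2 x)) (K ^ N)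
        η (by positivity) hη (fun p => (sum_ind_le _).trans (by simp [hKdef])) (by
          rw [hrew] at hsmall
          rw [Fintype.sum_prod_type]
          refine le_trans (le_of_eq ?_) hsmall.le
          rw [pow_add]; simp [hKdef]; ring)
      have hRbig : ∑ p : Z × (Fin n' → Option Λ), ind (η / 2 * K ^ N ≤ ∑ x, ind (Sec p.1 p.2 x)) ≤
          ∑ z, ∑ y, ∑ x, ind (R (Sec z y) x) := by
        rw [Fintype.sum_prod_type]
        refine Finset.sum_le_sum fun z _ => Finset.sum_le_sum fun y _ => ?_
        exact (ind_mono fun h => ⟨hinsSec z y, h⟩).trans (hR2 (Sec z y))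
      have hc2 : (Fintype.card (Z × (Fin n' → Option Λ)) : ℝ) = (Fintype.card Z : ℝ) * K ^ n' := by
        simp [hKdef]
      rw [hc2] at hmk
      have hfin : η / 2 / K ^ N * ((Fintype.card Z : ℝ) * K ^ (N + n')) =
          η / 2 * ((Fintype.card Z : ℝ) * K ^ n') := by
        rw [pow_add]; field_simp
      push_cast at hD
      have hexp : (η + ((r : ℝ) + 1) * (η / 2 / K ^ N)) * ((Fintype.card Z : ℝ) * K ^ (N + n')) =
          (η + (r : ℝ) * (η / 2 / K ^ N)) * ((Fintype.card Z : ℝ) * K ^ (N + n')) +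
          η / 2 / K ^ N * ((Fintype.card Z : ℝ) * K ^ (N + n')) := by ring
      rw [hexp, hfin] at hD
      linarith

lemma single {Λ : Type} [Fintype Λ] [Nonempty Λ] (h : SD Unit Λ) (a : Λ) (m : ℕ) (η : ℝ)
    (hη : 0 < η) : ∃ n0 : ℕ, ∀ (ι : Type) [Fintype ι] [DecidableEq ι], n0 ≤ Fintype.card ι →
      ∀ (D : (ι → Option Λ) → Prop) (f : (ι → Option Λ) → ℝ), (∀ x, f x ≤ 1) → Ins a D →
      (∀ (V : Subspace (Fin m) (Option Λ) ι), ∑ x, f (V x) ≤ 0) →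
      ∑ x, ind (D x) * f x ≤ η * (Fintype.card (Option Λ) : ℝ) ^ (Fintype.card ι) := by
  obtain ⟨N, hN⟩ := ins_dense h a m (η / 2) (by positivity)
  have hK : (0 : ℝ) < (Fintype.card (Option Λ) : ℝ) := by exact_mod_cast Fintype.card_pos
  obtain ⟨r, hr⟩ := exists_nat_ge (1 / (η / 2 / (Fintype.card (Option Λ) : ℝ) ^ N))
  refine ⟨r * N, fun ι _ _ hι D f hf hD hV => ?_⟩
  have := single_aux a m η hη N hN r Unit ι hι (fun _ => D) (fun _ => f) (fun _ => hf)
    (fun _ => hD) (fun _ => hV) (by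
      rw [div_le_iff₀ (by positivity)] at hr
      simp only [Finset.univ_unique, Finset.sum_const, Finset.card_singleton, one_smul,
        Fintype.card_unit, Nat.cast_one, one_mul]
      refine (sum_ind_le _).trans ?_
      have hp : (0 : ℝ) < (Fintype.card (Option Λ) : ℝ) ^ (Fintype.card ι) := by positivity
      have hc : (Fintype.card (ι → Option Λ) : ℝ) =
        (Fintype.card (Option Λ) : ℝ) ^ (Fintype.card ι) := by simp
      rw [hc]
      nlinarith)
  simpa using this

lemma multi {Λ : Type} [Fintype Λ] [Nonempty Λ] (h : SD Unit Λ) (S : Finset Λ) :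
    ∀ (m : ℕ) (η : ℝ), 0 < η →
    ∃ n0 : ℕ, ∀ (ι : Type) [Fintype ι] [DecidableEq ι], n0 ≤ Fintype.card ι →
      ∀ (C : Λ → (ι → Option Λ) → Prop) (f : (ι → Option Λ) → ℝ), (∀ x, f x ≤ 1) →
      (∀ a, Ins a (C a)) →
      (∀ (V : Subspace (Fin m) (Option Λ) ι), ∑ x, f (V x) ≤ 0) →
      ∑ x, ind (∃ a ∈ S, ¬ C a x) * f x ≤
        η * (Fintype.card (Option Λ) : ℝ) ^ (Fintype.card ι) := by
  classical
  induction S using Finset.induction_on with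
  | empty =>
    intro m η hη
    refine ⟨0, fun ι _ _ _ C f _ _ _ => ?_⟩
    simp [ind]
    positivity
  | insert a S ha ih =>
    intro m η hη
    obtain ⟨m1, hm1⟩ := ih m (η / 3) (by positivity)
    obtain ⟨n1, hn1⟩ := single h a m (η / 3) (by positivity)
    obtain ⟨n2, hn2⟩ := single h a m1 (η / 3) (by positivity)
    refine ⟨max n1 n2, fun ι _ _ hι C f hf hC hV => ?_⟩
    have h1 := hn1 ι (le_trans (le_max_left _ _) hι) (fun x => ¬ C a x) f hf (hC a).not hV
    have h2 := hn2 ι (le_trans (le_max_right _ _) hι) (C a)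
      (fun x => ind (∃ a ∈ S, ¬ C a x) * f x - η / 3) ?_ (hC a) ?_
    · have h3 : ∀ x, ind (∃ b ∈ insert a S, ¬ C b x) * f x = ind (¬ C a x) * f x +
          (ind (C a x) * (ind (∃ a ∈ S, ¬ C a x) * f x - η / 3) + η / 3 * ind (C a x)) := by
        intro x
        by_cases hx : C a x
        · have e : (∃ b ∈ insert a S, ¬ C b x) = (∃ b ∈ S, ¬ C b x) := by
            simp [hx]
          rw [e, ind_true hx, ind_false (not_not.2 hx)]; ring
        · rw [ind_true ⟨a, Finset.mem_insert_self _ _, hx⟩, ind_true hx, ind_false hx]; ring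
      simp only [h3]
      rw [Finset.sum_add_distrib, Finset.sum_add_distrib, ← Finset.mul_sum]
      have h4 := sum_ind_le (C a)
      have hc : (Fintype.card (ι → Option Λ) : ℝ) =
        (Fintype.card (Option Λ) : ℝ) ^ (Fintype.card ι) := by simp
      rw [hc] at h4
      nlinarith
    · intro x
      have := mul_le_mul_of_nonneg_left (hf x) (ind_nonneg (∃ a ∈ S, ¬ C a x))
      have := ind_le_one (∃ a ∈ S, ¬ C a x)
      linarith
    · intro V
      have := hm1 (Fin m1) (by simp) (fun b x => C b (V x)) (fun x => f (V x)) (fun x => hf _)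
        (fun b => (hC b).sub V) (fun W => by
          have := hV (comp V W)
          simpa only [comp_apply] using this)
      rw [Finset.sum_sub_distrib]
      have hc : ∑ _x : Fin m1 → Option Λ, η / 3 =
        η / 3 * (Fintype.card (Option Λ) : ℝ) ^ (Fintype.card (Fin m1)) := by simp; ring
      rw [hc]
      linarith

/-- `A` contains no combinatorial line -/
def LF {α ι : Type} (A : (ι → α) → Prop) : Prop := ¬ ∃ V : Subspace Unit α ι, ∀ x, A (V x)

lemma LF.sub {α ι η : Type} {A : (ι → α) → Prop} (h : LF A) (V : Subspace η α ι) :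
    LF (fun x => A (V x)) := by
  rintro ⟨W, hW⟩
  exact h ⟨comp V W, fun x => by rw [comp_apply]; exact hW x⟩

lemma exists_split' {ι ι₁ : Type} [Fintype ι] [Fintype ι₁] (n' : ℕ)
    (h : Fintype.card ι₁ + n' ≤ Fintype.card ι) :
    ∃ n'', n' ≤ n'' ∧ Nonempty (ι ≃ ι₁ ⊕ Fin n'') := by
  refine ⟨Fintype.card ι - Fintype.card ι₁, by omega, ⟨Fintype.equivOfCardEq ?_⟩⟩
  simp; omega

/-- words without `none` are rare -/
lemma no_none (Λ : Type) [Fintype Λ] (ε : ℝ) (hε : 0 < ε) :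
    ∃ N : ℕ, ∀ n ≥ N,
      ∑ x : Fin n → Option Λ, ind (∀ j, x j ≠ none) ≤
        ε * (Fintype.card (Option Λ) : ℝ) ^ n := by
  classical
  set k : ℝ := (Fintype.card Λ : ℝ) with hk
  have hk0 : 0 ≤ k := by positivity
  have hlim := tendsto_pow_atTop_nhds_zero_of_lt_one (r := k / (1 + k))
    (by positivity) (by rw [div_lt_one (by positivity)]; linarith)
  have hev := hlim.eventually (gt_mem_nhds hε)
  obtain ⟨N, hN⟩ := hev.exists_forall_of_atTop
  refine ⟨N, fun n hn => ?_⟩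
  have h1 := hN n hn
  have h2 : ∀ x : Fin n → Option Λ, ind (∀ j, x j ≠ none) =
      ∏ i, (if x i = none then (0 : ℝ) else 1) := by
    intro x
    by_cases hx : ∀ j, x j ≠ none
    · rw [ind_true hx]; simp [hx]
    · rw [ind_false hx]
      push Not at hx
      obtain ⟨j, hj⟩ := hx
      exact (Finset.prod_eq_zero (Finset.mem_univ j) (by simp [hj])).symm
  simp only [h2]
  have h3 : ∑ x : Fin n → Option Λ, ∏ i, (if x i = none then (0 : ℝ) else 1) = k ^ n := by
    have := Finset.prod_univ_sum (fun _ : Fin n => (Finset.univ : Finset (Option Λ)))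
      (fun _ o => if o = none then (0 : ℝ) else 1)
    rw [Fintype.piFinset_univ] at this
    rw [← this]
    simp [Fintype.sum_option, hk]
  rw [h3]
  rw [div_pow, div_lt_iff₀ (by positivity)] at h1
  have hc : (Fintype.card (Option Λ) : ℝ) = 1 + k := by simp [hk]; ring
  rw [hc]
  exact h1.le

/-- The extremal density. -/
lemma extremal {α : Type} [Fintype α] [Nonempty α] (h : ¬ SD Unit α) :
    ∃ δ : ℝ, 0 < δ ∧
      (∀ ε : ℝ, 0 < ε → ∃ n : ℕ, ∀ (ι : Type) [Fintype ι] [DecidableEq ι], n ≤ Fintype.card ι →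
        ∀ A : (ι → α) → Prop, LF A →
          ∑ x, ind (A x) ≤ (δ + ε) * (Fintype.card α : ℝ) ^ (Fintype.card ι)) ∧
      (∀ ε : ℝ, 0 < ε → ∀ n : ℕ, ∃ (ι : Type) (_ : Fintype ι) (_ : DecidableEq ι)
        (A : (ι → α) → Prop), n ≤ Fintype.card ι ∧ LF A ∧
          (δ - ε) * (Fintype.card α : ℝ) ^ (Fintype.card ι) ≤ ∑ x, ind (A x)) := by
  have hK : (0 : ℝ) < (Fintype.card α : ℝ) := by exact_mod_cast Fintype.card_pos
  let Δ : Set ℝ := {δ | ∀ n : ℕ, ∃ (ι : Type) (_ : Fintype ι) (_ : DecidableEq ι)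
        (A : (ι → α) → Prop), n ≤ Fintype.card ι ∧ LF A ∧
          δ * (Fintype.card α : ℝ) ^ (Fintype.card ι) ≤ ∑ x, ind (A x)}
  have hbdd : BddAbove Δ := by
    refine ⟨1, fun δ hδ => ?_⟩
    obtain ⟨ι, _, _, A, -, -, hA⟩ := hδ 0
    have h1 := sum_ind_le A
    have hc : (Fintype.card (ι → α) : ℝ) =
        (Fintype.card α : ℝ) ^ (Fintype.card ι) := by simp
    rw [hc] at h1
    have hp : (0 : ℝ) < (Fintype.card α : ℝ) ^ (Fintype.card ι) := by positivity
    by_contra hlt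
    push Not at hlt
    nlinarith
  unfold SD at h
  push Not at h
  obtain ⟨δ0, hδ0, h0⟩ := h
  have hmem : δ0 ∈ Δ := by
    intro n
    obtain ⟨ι, i1, i2, hn, A, hA, hl⟩ := h0 n
    refine ⟨ι, i1, i2, A, hn, ?_, hA⟩
    rintro ⟨V, hV⟩
    obtain ⟨x, hx⟩ := hl V
    exact hx (hV x)
  refine ⟨sSup Δ, lt_of_lt_of_le hδ0 (le_csSup hbdd hmem), ?_, ?_⟩
  · intro ε hε
    have hnot : sSup Δ + ε ∉ Δ := fun hh => by
      have := le_csSup hbdd hh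
      linarith
    simp only [Δ, Set.mem_ofPred_eq, not_forall] at hnot
    obtain ⟨n, hn⟩ := hnot
    refine ⟨n, fun ι i1 i2 hι A hA => ?_⟩
    by_contra hcon
    exact hn ⟨ι, i1, i2, A, hι, hA, (not_le.1 hcon).le⟩
  · intro ε hε n
    obtain ⟨δ', hδ', hlt⟩ := exists_lt_of_lt_csSup ⟨δ0, hmem⟩ (show sSup Δ - ε < sSup Δ by linarith)
    obtain ⟨ι, i1, i2, A, hn, hA, hd⟩ := hδ' n
    refine ⟨ι, i1, i2, A, hn, hA, le_trans ?_ hd⟩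
    gcongr

lemma step {Λ : Type} [Fintype Λ] [Nonempty Λ] (h : SD Unit Λ) : SD Unit (Option Λ) := by
  classical
  by_contra hcon
  obtain ⟨δ, hδ, hup, hlow⟩ := extremal hcon
  have hK : (1 : ℝ) ≤ (Fintype.card (Option Λ) : ℝ) := by exact_mod_cast Fintype.card_pos
  set K : ℝ := (Fintype.card (Option Λ) : ℝ) with hKdef
  have hK0 : 0 < K := by linarith
  obtain ⟨m0, hm0⟩ := h (δ / 2 / 2) (by positivity)
  let q : ℕ := Nat.card (Subspace Unit Λ (Fin (m0 + 1)))
  obtain ⟨θ, hθ⟩ : ∃ θ : ℝ, θ = δ / 2 / 2 / (q + 1) := ⟨_, rfl⟩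
  have hθ0 : 0 < θ := by rw [hθ]; positivity
  have hθδ : θ ≤ δ / 4 := by
    rw [hθ, div_le_iff₀ (by positivity)]
    have : (0 : ℝ) ≤ q := by positivity
    nlinarith
  have hδθ : 0 < δ * θ := by positivity
  obtain ⟨γ, hγ⟩ : ∃ γ : ℝ, γ = δ * θ / 4 := ⟨_, rfl⟩
  have hγ0 : 0 < γ := by rw [hγ]; positivity
  obtain ⟨m, hm⟩ := hup γ hγ0
  obtain ⟨M0, hM0⟩ := multi h Finset.univ m (δ * θ / 8) (by positivity)
  obtain ⟨M1, hM1⟩ := no_none Λ (δ * θ / 8) (by positivity)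
  obtain ⟨M, hMM0, hMM1, hMm⟩ : ∃ M, M0 ≤ M ∧ M1 ≤ M ∧ m0 + 1 ≤ M :=
    ⟨max M0 (max M1 (m0 + 1)), by simp, by simp, by simp⟩
  obtain ⟨ι1, _, hgr⟩ := gr Λ M
  set K1 : ℝ := K ^ (Fintype.card ι1) with hK1
  have hK10 : 0 < K1 := by positivity
  obtain ⟨ε, hε⟩ : ∃ ε : ℝ, ε = min (δ * θ / 16) (δ / 8) / K1 := ⟨_, rfl⟩
  have hε0 : 0 < ε := by rw [hε]; positivity
  have hεK : ε * K1 ≤ δ * θ / 16 := by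
    rw [hε, div_mul_cancel₀ _ hK10.ne']; exact min_le_left _ _
  have hεK' : ε * K1 ≤ δ / 8 := by
    rw [hε, div_mul_cancel₀ _ hK10.ne']; exact min_le_right _ _
  obtain ⟨n2, hn2⟩ := hup ε hε0
  obtain ⟨ι, _, _, A, hι, hLF, hA⟩ := hlow ε hε0 (Fintype.card ι1 + n2)
  obtain ⟨n', hn', ⟨e⟩⟩ := exists_split' (ι := ι) (ι₁ := ι1) n2 hι
  have hcard : Fintype.card ι = Fintype.card ι1 + n' := by rw [Fintype.card_congr e]; simp
  have hT0 : 0 < K ^ n' := by positivity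
  have hcY : (Fintype.card (Fin n' → Option Λ) : ℝ) = K ^ n' := by simp [hKdef]
  -- all sections are dense
  have hsec : ∀ w : ι1 → Option Λ, (δ - 2 * (ε * K1)) * K ^ n' ≤
      ∑ y : Fin n' → Option Λ, ind (A (Sum.elim w y ∘ e)) := by
    intro w
    rw [sum_split e, Finset.sum_comm, ← Finset.add_sum_erase _ _ (Finset.mem_univ w)] at hA
    have hle : ∀ w' : ι1 → Option Λ, ∑ y : Fin n' → Option Λ, ind (A (Sum.elim w' y ∘ e)) ≤
        (δ + ε) * K ^ n' := by
      intro w'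
      have hid : LF (fun y : Fin n' → Option Λ => A (Sum.elim w' y ∘ e)) := by
        rintro ⟨W, hW⟩
        refine hLF ⟨re (exl w' W) e, fun x => ?_⟩
        rw [re_apply, exl_apply]; exact hW x
      have := hn2 (Fin n') (by simpa using hn') _ hid
      simpa using this
    have hsum : ∑ w' ∈ Finset.univ.erase w, ∑ y : Fin n' → Option Λ,
        ind (A (Sum.elim w' y ∘ e)) ≤ (K1 - 1) * ((δ + ε) * K ^ n') := by
      refine (Finset.sum_le_sum fun w' _ => hle w').trans (le_of_eq ?_)
      rw [Finset.sum_const, Finset.card_erase_of_mem (Finset.mem_univ w), nsmul_eq_mul,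
        Nat.cast_sub (by rw [Finset.card_univ]; exact Fintype.card_pos)]
      simp [hK1, hKdef]
    rw [hcard, pow_add, ← hK1] at hA
    have : 0 < ε * K ^ n' := by positivity
    nlinarith
  -- Graham-Rothschild
  obtain ⟨V, P, hVP⟩ := hgr (fun w => θ * K ^ n' ≤ ∑ y : Fin n' → Option Λ,
    ind (∀ a : Λ, A (Sum.elim (fun i => some ((w i).getD a)) y ∘ e)))
  have hlift : ∀ (v : Fin M → Option Λ) (a : Λ),
      (fun i => some ((lift V v i).getD a)) = lift V (fun j => some ((v j).getD a)) := by
    intro v a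
    rw [lift_apply]
    funext i
    rw [lift_getD]
  simp only [hlift] at hVP
  let g : Fin M → Fin (m0 + 1) := fun j => ⟨min j.1 m0, by omega⟩
  have hg : ∀ i, ∃ j, g j = i := by
    intro i
    refine ⟨⟨i.1, by omega⟩, ?_⟩
    ext; simp [g]; omega
  have hP : P := by
    obtain ⟨U, hU⟩ := popular (η := Unit) (ι := Fin (m0 + 1)) (δ / 2) (by positivity)
      (fun A hA => hm0 (Fin (m0 + 1)) (by simp) A hA) (Y := Fin n' → Option Λ)
      (fun y u => A (Sum.elim (lift V (fun j => some (u (g j)))) y ∘ e)) (by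
        rw [Finset.sum_comm]
        have : ∑ _u : Fin (m0 + 1) → Λ, δ / 2 * K ^ n' ≤ ∑ u : Fin (m0 + 1) → Λ,
            ∑ y : Fin n' → Option Λ, ind (A (Sum.elim (lift V (fun j => some (u (g j)))) y ∘ e)) := by
          refine Finset.sum_le_sum fun u _ => le_trans ?_ (hsec _)
          gcongr
          linarith
        refine le_trans (le_of_eq ?_) this
        rw [hcY]; simp; ring)
    obtain ⟨i, hi⟩ := U.proper ()
    obtain ⟨j, hj⟩ := hg i
    rw [← hVP (fun j => (U.idxFun (g j)).elim some (fun _ => none)) ⟨j, by simp [hj, hi]⟩]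
    rw [hcY] at hU
    rw [hθ]
    refine hU.trans (Finset.sum_le_sum fun y _ => ind_mono fun hx a => ?_)
    have := hx (fun _ => a)
    convert this using 4
    funext j
    simp only [Subspace.coe_apply]
    cases U.idxFun (g j) <;> simp
  -- the sets
  let Ay : (Fin n' → Option Λ) → (Fin M → Option Λ) → Prop := fun y v =>
    A (Sum.elim (lift V v) y ∘ e)
  let C : (Fin n' → Option Λ) → Λ → (Fin M → Option Λ) → Prop := fun y a v =>
    Ay y (fun j => some ((v j).getD a))
  have hCins : ∀ y a, Ins a (C y a) := by
    intro y a v v' hvv hv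
    simp only [C] at hv ⊢
    simpa only [hvv] using hv
  have hLFy : ∀ y, LF (Ay y) := by
    intro y
    have := hLF.sub (re (exr (lift V) y) e)
    simpa only [re_apply, exr_apply] using this
  have hCbig : ∀ v : Fin M → Option Λ, θ * K ^ n' ≤
      ∑ y : Fin n' → Option Λ, ind (∀ a, C y a v) := by
    intro v
    by_cases hv : ∃ j, v j = none
    · exact (hVP v hv).2 hP
    · push Not at hv
      have hvv : ∀ a, (fun j => some ((v j).getD a)) = v := by
        intro a; funext j
        obtain ⟨b, hb⟩ := Option.ne_none_iff_exists'.1 (hv j)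
        simp [hb]
      refine le_trans ?_ ((hsec (lift V v)).trans
        (Finset.sum_le_sum fun y _ => ind_mono fun hh a => ?_))
      · gcongr; linarith
      · simp only [C, hvv]; exact hh
  have hdisj : ∀ y v, Ay y v → (∀ a, C y a v) → ∀ j, v j ≠ none := by
    intro y v hAv hCv j hj
    refine hLFy y ⟨⟨fun j => (v j).elim (Sum.inr ()) (fun b => Sum.inl (some b)),
      fun _ => ⟨j, by simp [hj]⟩⟩, fun x => ?_⟩
    cases hx : x () with
    | none =>
      convert hAv using 1
      funext j
      simp only [Subspace.coe_apply]
      cases v j <;> simp [hx]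
    | some a =>
      have := hCv a
      simp only [C] at this
      convert this using 1
      funext j
      simp only [Subspace.coe_apply]
      cases v j <;> simp [hx]
  -- upper bound
  have hupper : ∀ y, ∑ v, ind (∃ a ∈ Finset.univ, ¬ C y a v) * (ind (Ay y v) - (δ + γ)) ≤
      δ * θ / 8 * K ^ M := by
    intro y
    have := hM0 (Fin M) (by simpa using hMM0) (C y) (fun v => ind (Ay y v) - (δ + γ))
      (fun v => by have := ind_le_one (Ay y v); linarith) (hCins y) (fun W => by
        have := hm (Fin m) (by simp) _ ((hLFy y).sub W)
        rw [Finset.sum_sub_distrib]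
        simp only [Finset.sum_const, Finset.card_univ, nsmul_eq_mul]
        simp only [Fintype.card_fin] at this
        have hc : (Fintype.card (Fin m → Option Λ) : ℝ) = K ^ m := by simp [hKdef]
        rw [hc]; linarith)
    simpa only [Fintype.card_fin, ← hKdef] using this
  have hpt : ∀ y v, ind (Ay y v) - (δ + γ) ≤
      ind (∃ a ∈ Finset.univ, ¬ C y a v) * (ind (Ay y v) - (δ + γ)) +
        (ind (∀ j, v j ≠ none) - (δ + γ) * ind (∀ a, C y a v)) := by
    intro y v
    by_cases hc : ∀ a, C y a v
    · rw [ind_true hc, ind_false (p := ∃ a ∈ Finset.univ, ¬ C y a v)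
        (by rintro ⟨a, -, ha⟩; exact ha (hc a))]
      by_cases hAv : Ay y v
      · rw [ind_true hAv, ind_true (hdisj y v hAv hc)]; linarith
      · rw [ind_false hAv]; have := ind_nonneg (∀ j, v j ≠ none); linarith
    · have hc' : ∃ a ∈ Finset.univ, ¬ C y a v := by
        push Not at hc
        obtain ⟨a, ha⟩ := hc
        exact ⟨a, Finset.mem_univ a, ha⟩
      rw [ind_false hc, ind_true hc']
      have := ind_nonneg (∀ j, v j ≠ none); linarith
  have hcV : (Fintype.card (Fin M → Option Λ) : ℝ) = K ^ M := by simp [hKdef]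
  have htot : ∑ y, ∑ v, (ind (Ay y v) - (δ + γ)) ≤
      ∑ y, ∑ v, (ind (∃ a ∈ Finset.univ, ¬ C y a v) * (ind (Ay y v) - (δ + γ)) +
        (ind (∀ j, v j ≠ none) - (δ + γ) * ind (∀ a, C y a v))) :=
    Finset.sum_le_sum fun y _ => Finset.sum_le_sum fun v _ => hpt y v
  have htot2 : ∑ y, ∑ v, (ind (∃ a ∈ Finset.univ, ¬ C y a v) * (ind (Ay y v) - (δ + γ)) +
        (ind (∀ j, v j ≠ none) - (δ + γ) * ind (∀ a, C y a v))) =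
      ∑ y, ∑ v, ind (∃ a ∈ Finset.univ, ¬ C y a v) * (ind (Ay y v) - (δ + γ)) +
      (∑ _y : Fin n' → Option Λ, ∑ v : Fin M → Option Λ, ind (∀ j, v j ≠ none) -
        (δ + γ) * ∑ y, ∑ v, ind (∀ a, C y a v)) := by
    simp only [Finset.mul_sum, ← Finset.sum_sub_distrib, ← Finset.sum_add_distrib]
  rw [htot2] at htot
  have b1 : (δ - 2 * (ε * K1)) * K ^ n' * K ^ M ≤ ∑ y, ∑ v, ind (Ay y v) := by
    rw [Finset.sum_comm]
    refine le_trans (le_of_eq ?_) (Finset.sum_le_sum fun v _ => hsec (lift V v))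
    rw [Finset.sum_const, Finset.card_univ, nsmul_eq_mul, hcV]; ring
  have b2 : ∑ y, ∑ v, ind (∃ a ∈ Finset.univ, ¬ C y a v) * (ind (Ay y v) - (δ + γ)) ≤
      δ * θ / 8 * K ^ M * K ^ n' := by
    refine (Finset.sum_le_sum fun y _ => hupper y).trans (le_of_eq ?_)
    rw [Finset.sum_const, Finset.card_univ, nsmul_eq_mul, hcY]; ring
  have b3 : ∑ _y : Fin n' → Option Λ, ∑ v : Fin M → Option Λ, ind (∀ j, v j ≠ none) ≤
      δ * θ / 8 * K ^ M * K ^ n' := by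
    refine (Finset.sum_le_sum fun y _ => hM1 M hMM1).trans (le_of_eq ?_)
    rw [Finset.sum_const, Finset.card_univ, nsmul_eq_mul, hcY]; ring
  have b4 : θ * K ^ n' * K ^ M ≤ ∑ y, ∑ v, ind (∀ a, C y a v) := by
    rw [Finset.sum_comm]
    refine le_trans (le_of_eq ?_) (Finset.sum_le_sum fun v _ => hCbig v)
    rw [Finset.sum_const, Finset.card_univ, nsmul_eq_mul, hcV]; ring
  have b5' : ∑ _y : Fin n' → Option Λ, ∑ _v : Fin M → Option Λ, (δ + γ) =
      (δ + γ) * (K ^ n' * K ^ M) := by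
    simp only [Finset.sum_const, Finset.card_univ, nsmul_eq_mul, hcY, hcV]; ring
  have hTpos : 0 < K ^ n' * K ^ M := by positivity
  set T := K ^ n' * K ^ M with hT
  have b1' : (δ - 2 * (ε * K1)) * T ≤ ∑ y, ∑ v, ind (Ay y v) := by rw [hT, ← mul_assoc]; exact b1
  have c1 : 2 * (ε * K1) * T ≤ δ * θ / 8 * T := by gcongr; linarith
  have c2 : (δ + γ) * (θ * T) ≤ (δ + γ) * ∑ y, ∑ v, ind (∀ a, C y a v) := by
    refine mul_le_mul_of_nonneg_left ?_ (by positivity)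
    rw [hT, ← mul_assoc]; exact b4
  have c3 : δ * θ / 8 * K ^ M * K ^ n' = δ * θ / 8 * T := by rw [hT]; ring
  rw [c3] at b2 b3
  have c4 : 0 < γ * (θ * T) := by positivity
  have c5 : 0 < δ * θ * T := by positivity
  have c6 : γ * T = δ * θ * T / 4 := by rw [hγ]; ring
  have c7 : ∑ y, ∑ v, (ind (Ay y v) - (δ + γ)) =
      ∑ y, ∑ v, ind (Ay y v) - (δ + γ) * T := by
    rw [← b5']; simp only [Finset.sum_sub_distrib]
  rw [c7] at htot
  nlinarith

lemma SD_base : SD Unit (Fin 1) := by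
  classical
  intro δ hδ
  refine ⟨1, fun ι _ _ hn A hA => ?_⟩
  have hne : Nonempty ι := Fintype.card_pos_iff.1 hn
  refine ⟨⟨fun _ => Sum.inr (), fun _ => ⟨hne.some, rfl⟩⟩, fun x => ?_⟩
  by_contra hx
  have : ∑ x, ind (A x) = 0 := Finset.sum_eq_zero fun y _ => by
    rw [Subsingleton.elim y]; exact ind_false hx
  rw [this] at hA
  simp at hA
  linarith

lemma SD_equiv {Λ Λ' : Type} [Fintype Λ] [Fintype Λ'] (f : Λ ≃ Λ') (h : SD Unit Λ) :
    SD Unit Λ' := by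
  classical
  intro δ hδ
  obtain ⟨n, hn⟩ := h δ hδ
  refine ⟨n, fun ι _ _ hι A hA => ?_⟩
  obtain ⟨V, hV⟩ := hn ι hι (fun x => A (f ∘ x)) (by
    rw [Fintype.card_congr f]
    refine hA.trans (le_of_eq ?_)
    exact (Equiv.sum_comp (Equiv.arrowCongr (Equiv.refl ι) f) (fun x => ind (A x))).symm)
  refine ⟨⟨fun i => (V.idxFun i).map f id, fun e => ?_⟩, fun x => ?_⟩
  · obtain ⟨i, hi⟩ := V.proper e
    exact ⟨i, by simp [hi]⟩
  · convert hV (f.symm ∘ x) using 1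
    funext i
    simp only [Subspace.coe_apply, Function.comp]
    cases V.idxFun i <;> simp

lemma dhj (k : ℕ) : SD Unit (Fin (k + 1)) := by
  induction k with
  | zero => exact SD_base
  | succ k ih => exact SD_equiv (finSuccEquiv (k + 1)).symm (step ih)

lemma ind_eq (p : Prop) [Decidable p] : ind p = if p then 1 else 0 := by
  split_ifs with h
  · exact ind_true h
  · exact ind_false h

/-- finite form -/
lemma finite_form (k : ℕ) (δ : ℝ) (hδ : 0 < δ) : ∃ N0 : ℕ, ∀ N, N0 ≤ N → ∀ E : ℕ → Prop,
    δ * N ≤ ∑ i ∈ Finset.Icc 1 N, ind (E i) →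
    ∃ x d : ℕ, 0 < d ∧ ∀ j, j ≤ k → E (x + j * d) := by
  classical
  obtain ⟨n, hn⟩ := dhj k (δ / 4) (by positivity)
  obtain ⟨N1, hN1⟩ := exists_nat_ge (4 * (k * n + 1) / δ)
  refine ⟨N1 + k * n + 1, fun N hN E hE => ?_⟩
  have hNr : 4 * ((k : ℝ) * n + 1) ≤ δ * N := by
    rw [div_le_iff₀ hδ] at hN1
    have : (N1 : ℝ) ≤ N := by exact_mod_cast (by omega)
    nlinarith
  have hkn : k * n + 1 ≤ N := by omega
  have hknr : (k : ℝ) * n + 1 ≤ N := by exact_mod_cast hkn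
  let s : (Fin n → Fin (k + 1)) → ℕ := fun w => ∑ i, (w i : ℕ)
  have hs : ∀ w, s w ≤ k * n := by
    intro w
    refine (Finset.sum_le_card_nsmul _ _ k fun i _ => by omega).trans ?_
    simp [mul_comm]
  have hw : ∀ w, δ / 2 * N ≤ ∑ x ∈ Finset.range (N + 1), ind (E (x + s w)) := by
    intro w
    have h1 : ∑ i ∈ Finset.Icc 1 N, ind (E i) ≤
        ∑ i ∈ Finset.range (s w), ind (E i) +
          ∑ x ∈ Finset.range (N + 1), ind (E (s w + x)) := by
      rw [← Finset.sum_range_add]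
      refine Finset.sum_le_sum_of_subset_of_nonneg ?_ (fun _ _ _ => ind_nonneg _)
      intro i hi
      simp at hi ⊢
      omega
    have h2 : ∑ i ∈ Finset.range (s w), ind (E i) ≤ k * n := by
      refine (Finset.sum_le_sum fun i _ => ind_le_one (E i)).trans ?_
      simp
      exact_mod_cast hs w
    simp only [add_comm (s w)] at h1
    have h3 : (0 : ℝ) ≤ k * n := by positivity
    linarith
  obtain ⟨x, hx⟩ : ∃ x, δ / 4 * ((k : ℝ) + 1) ^ n ≤ ∑ w, ind (E (x + s w)) := by
    by_contra hcon
    push Not at hcon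
    have h1 : ∑ x ∈ Finset.range (N + 1), ∑ w, ind (E (x + s w)) ≤
        ∑ x ∈ Finset.range (N + 1), δ / 4 * ((k : ℝ) + 1) ^ n :=
      Finset.sum_le_sum fun x _ => (hcon x).le
    rw [Finset.sum_comm] at h1
    have h2 := (Finset.sum_le_sum fun w (_ : w ∈ Finset.univ) => hw w).trans h1
    simp at h2
    have hp : 0 < ((k : ℝ) + 1) ^ n := by positivity
    have hN1' : (1 : ℝ) ≤ N := by
      have : (0 : ℝ) ≤ k * n := by positivity
      linarith
    have h4 : 4 ≤ δ * N := by
      have : (0 : ℝ) ≤ k * n := by positivity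
      linarith
    have h0 := hcon 0
    have h3 : δ / 2 * N ≤ ((N : ℝ) + 1) * (δ / 4) := by
      by_contra h5
      push Not at h5
      have := mul_lt_mul_of_pos_left h5 hp
      linarith
    have hd : δ * N ≤ δ := by linarith
    have hw0 := hw (fun _ => 0)
    have hN1'' : (N : ℝ) ≤ 1 := by
      by_contra h6
      push Not at h6
      nlinarith
    have hsum : ∑ i ∈ Finset.Icc 1 N, ind (E i) ≤ N := by
      refine (Finset.sum_le_sum fun i _ => ind_le_one (E i)).trans ?_
      simp
    linarith
  obtain ⟨V, hV⟩ := hn (Fin n) (by simp) (fun w => E (x + s w)) (by simpa using hx)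
  let d := (Finset.univ.filter fun i => V.idxFun i = Sum.inr ()).card
  refine ⟨x + s (V fun _ => 0), d, ?_, fun j hj => ?_⟩
  · obtain ⟨i, hi⟩ := V.proper ()
    exact Finset.card_pos.2 ⟨i, by simp [hi]⟩
  · have := hV (fun _ => ⟨j, by omega⟩)
    convert this using 1
    rw [add_assoc]
    congr 1
    simp only [s, d, Finset.card_filter]
    rw [mul_comm, Finset.sum_mul, ← Finset.sum_add_distrib]
    refine Finset.sum_congr rfl fun i _ => ?_
    simp only [Subspace.coe_apply]
    cases V.idxFun i <;> simp


lemma card_eq (E : Set ℕ) (N : ℕ) : (Nat.card ↥(E ∩ Set.Icc 1 N) : ℝ) =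
    ∑ i ∈ Finset.Icc 1 N, ind (i ∈ E) := by
  classical
  have : E ∩ Set.Icc 1 N = ((Finset.Icc 1 N).filter (· ∈ E) : Finset ℕ) := by
    ext i; simp; tauto
  rw [this, Nat.card_coe_set_eq, Set.ncard_coe_finset, Finset.card_filter]
  push_cast
  exact Finset.sum_congr rfl fun i _ => (ind_eq _).symm

end SzProof

/-- **Szemerédi's theorem**: a set of natural numbers of positive upper density contains,
for every `k ≥ 1`, a non-trivial `(k+1)`-term arithmetic progression
`x, x + d, …, x + k·d`. -/
theorem szemeredi (E : Set ℕ) (hE : 0 < upperDensity E) (k : ℕ) (hk : 1 ≤ k) :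
    ∃ x ∈ E, ∃ d : ℤ, d ≠ 0 ∧
      ∀ j : ℕ, j ≤ k → ∃ e ∈ E, (e : ℤ) = (x : ℤ) + (j : ℤ) * d := by
  obtain ⟨δ, hδ, hδE⟩ := exists_between hE
  obtain ⟨N0, hN0⟩ := SzProof.finite_form k δ hδ
  have hco : IsCoboundedUnder (· ≤ ·) atTop
      (fun N : ℕ => (Nat.card ↥(E ∩ Set.Icc 1 N) : ℝ) / (N : ℝ)) :=
    IsCoboundedUnder.of_frequently_ge (a := 0)
      (Frequently.of_forall fun N => by positivity)
  have hfr := frequently_lt_of_lt_limsup hco hδE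
  obtain ⟨N, hN, hlt⟩ := (frequently_atTop.1 hfr) (N0 + 1)
  have hNpos : (0 : ℝ) < N := by exact_mod_cast (by omega)
  rw [lt_div_iff₀ hNpos, SzProof.card_eq] at hlt
  obtain ⟨x, d, hd, h⟩ := hN0 N (by omega) (· ∈ E) hlt.le
  refine ⟨x, by simpa using h 0 (by omega), d, by exact_mod_cast hd.ne', fun j hj =>
    ⟨x + j * d, h j hj, by push_cast; ring⟩⟩
end

section
/- (Furstenberg correspondence principle) Let E ⊆ ℕ be a set of positive upper density. Then there exists a probability measure-preserving system (X, ℬ, μ, T) and a measurable set A ∈ ℬ with μ(A) > 0 such that for all positive integers n₁, …, n_k: if μ(A ∩ T^{−n₁}A ∩ … ∩ T^{−n_k}A) > 0, then the set E ∩ (E − n₁) ∩ … ∩ (E − n_k) has positive upper density; in particular there exists an integer x with x, x+n₁, …, x+n_k all in E. -/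
open Filter MeasureTheory

open scoped Topology BoundedContinuousFunction

namespace Furst

/-- The density quotient lies in `[0,1]`. -/
lemma quot_le_one (E : Set ℕ) (N : ℕ) :
    (Nat.card ↥(E ∩ Set.Icc 1 N) : ℝ) / (N : ℝ) ≤ 1 := by
  apply div_le_one_of_le₀ _ (Nat.cast_nonneg _)
  have h : (E ∩ Set.Icc 1 N).ncard ≤ (Set.Icc 1 N).ncard :=
    Set.ncard_le_ncard Set.inter_subset_right (Set.finite_Icc _ _)
  rw [← Finset.coe_Icc, Set.ncard_coe_finset, Nat.card_Icc] at h
  rw [Nat.card_coe_set_eq]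
  simp only [Finset.coe_Icc] at h
  exact_mod_cast h

lemma quot_nonneg (E : Set ℕ) (N : ℕ) :
    0 ≤ (Nat.card ↥(E ∩ Set.Icc 1 N) : ℝ) / (N : ℝ) := by positivity

lemma bdd (E : Set ℕ) : IsBoundedUnder (· ≤ ·) atTop
    (fun N : ℕ => (Nat.card ↥(E ∩ Set.Icc 1 N) : ℝ) / (N : ℝ)) :=
  isBoundedUnder_of ⟨1, quot_le_one E⟩

lemma cobdd (E : Set ℕ) : IsCoboundedUnder (· ≤ ·) atTop
    (fun N : ℕ => (Nat.card ↥(E ∩ Set.Icc 1 N) : ℝ) / (N : ℝ)) :=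
  IsBoundedUnder.isCoboundedUnder_le (isBoundedUnder_of ⟨0, quot_nonneg E⟩)

/-- The shift on `ℤ → Bool`. -/
def shift : (ℤ → Bool) ≃ᵐ (ℤ → Bool) where
  toFun x n := x (n + 1)
  invFun x n := x (n - 1)
  left_inv x := by ext n; simp
  right_inv x := by ext n; simp
  measurable_toFun := by
    show Measurable (fun (x : ℤ → Bool) n => x (n + 1))
    fun_prop
  measurable_invFun := by
    show Measurable (fun (x : ℤ → Bool) n => x (n - 1))
    fun_prop

lemma shift_apply (x : ℤ → Bool) (n : ℤ) : shift x n = x (n + 1) := rfl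

lemma shift_cont : Continuous shift := by
  show Continuous (fun (x : ℤ → Bool) n => x (n + 1))
  fun_prop

lemma shift_iter (m : ℕ) (x : ℤ → Bool) (n : ℤ) : (shift^[m]) x n = x (n + m) := by
  induction m generalizing x with
  | zero => simp
  | succ k ih =>
    rw [Function.iterate_succ_apply, ih, shift_apply]
    congr 1
    push_cast
    ring

/-- Empirical measures. -/
noncomputable def emp {X : Type} [MeasurableSpace X] (y : ℕ → X) (N : ℕ) : Measure X :=
  (N : ENNReal)⁻¹ • ∑ n ∈ Finset.Icc 1 N, Measure.dirac (y n)

lemma emp_prob {X : Type} [MeasurableSpace X] (y : ℕ → X) (N : ℕ) (hN : 1 ≤ N) :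
    IsProbabilityMeasure (emp y N) := by
  constructor
  simp only [emp, Measure.smul_apply, Measure.coe_finset_sum, Finset.sum_apply, measure_univ,
    Finset.sum_const, Nat.card_Icc, smul_eq_mul]
  simp only [Nat.add_sub_cancel, nsmul_eq_mul, mul_one]
  apply ENNReal.inv_mul_cancel
  · simp; omega
  · simp

lemma emp_integral {X : Type} [MeasurableSpace X] [TopologicalSpace X] [BorelSpace X]
    (y : ℕ → X) (N : ℕ) (f : X →ᵇ ℝ) :
    ∫ x, f x ∂(emp y N) = (N : ℝ)⁻¹ * ∑ n ∈ Finset.Icc 1 N, f (y n) := by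
  have hm : StronglyMeasurable (f : X → ℝ) := f.continuous.measurable.stronglyMeasurable
  rw [emp, integral_smul_measure, integral_finset_sum_measure]
  · simp [integral_dirac' _ _ hm]
  · intro i _
    exact f.integrable _

open Classical in
lemma sum_indicator (y : ℕ → ℤ → Bool) (C : Set (ℤ → Bool)) (F : Set ℕ)
    (hF : ∀ m, y m ∈ C ↔ m ∈ F) (N : ℕ) :
    (∑ n ∈ Finset.Icc 1 N, C.indicator (fun _ => (1 : ℝ)) (y n))
      = (Nat.card ↥(F ∩ Set.Icc 1 N) : ℝ) := by
  simp only [Set.indicator_apply, hF]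
  rw [Finset.sum_boole]
  have : F ∩ Set.Icc 1 N = ↑((Finset.Icc 1 N).filter (· ∈ F)) := by
    ext m; simp; tauto
  rw [this, Nat.card_coe_set_eq, Set.ncard_coe_finset]

/-- Generic construction of an invariant limit measure along an ultrafilter. -/
lemma exists_limit (x₀ : ℤ → Bool) (U : Ultrafilter ℕ) (hU : (U : Filter ℕ) ≤ atTop) :
    ∃ μ : Measure (ℤ → Bool), IsProbabilityMeasure μ ∧ MeasurePreserving shift μ μ ∧
      ∀ (C : Set (ℤ → Bool)) (F : Set ℕ), IsClopen C → (∀ m, (shift^[m]) x₀ ∈ C ↔ m ∈ F) →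
        Tendsto (fun N : ℕ => (Nat.card ↥(F ∩ Set.Icc 1 N) : ℝ) / (N : ℝ)) U
          (𝓝 (μ.real C)) := by
  set y : ℕ → ℤ → Bool := fun m => (shift^[m]) x₀ with hy
  let μs : ℕ → ProbabilityMeasure (ℤ → Bool) := fun N =>
    ⟨emp y (max N 1), emp_prob y _ (le_max_right _ _)⟩
  obtain ⟨ν, -, hν⟩ := isCompact_univ.ultrafilter_le_nhds (U.map μs) (by simp)
  have hν' : Tendsto μs U (𝓝 ν) := hν
  rw [ProbabilityMeasure.tendsto_iff_forall_integral_tendsto] at hν'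
  have key : ∀ f : (ℤ → Bool) →ᵇ ℝ,
      Tendsto (fun N : ℕ => (N : ℝ)⁻¹ * ∑ n ∈ Finset.Icc 1 N, f (y n)) U
        (𝓝 (∫ x, f x ∂(ν : Measure (ℤ → Bool)))) := by
    intro f
    refine (hν' f).congr' ?_
    have : ∀ᶠ N in (U : Filter ℕ), 1 ≤ N := hU (eventually_ge_atTop 1)
    filter_upwards [this] with N hN
    rw [← emp_integral]
    show ∫ x, f x ∂(emp y (max N 1)) = _
    rw [max_eq_left hN]
  refine ⟨ν, inferInstance, ⟨shift.measurable, ?_⟩, ?_⟩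
  · haveI : IsProbabilityMeasure (Measure.map shift (ν : Measure (ℤ → Bool))) :=
      Measure.isProbabilityMeasure_map shift.measurable.aemeasurable
    apply ext_of_forall_integral_eq_of_IsFiniteMeasure
    intro f
    rw [integral_map shift.measurable.aemeasurable
      f.continuous.measurable.aestronglyMeasurable]
    let g : (ℤ → Bool) →ᵇ ℝ := f.compContinuous ⟨shift, shift_cont⟩
    have h1 := key g
    have h2 := key f
    have h3 : Tendsto (fun N : ℕ => (N : ℝ)⁻¹ * ∑ n ∈ Finset.Icc 1 N, g (y n)
        - (N : ℝ)⁻¹ * ∑ n ∈ Finset.Icc 1 N, f (y n)) U (𝓝 0) := by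
      have e : ∀ N : ℕ, (N : ℝ)⁻¹ * ∑ n ∈ Finset.Icc 1 N, g (y n)
        - (N : ℝ)⁻¹ * ∑ n ∈ Finset.Icc 1 N, f (y n) = (N : ℝ)⁻¹ * (f (y (N + 1)) - f (y 1)) := by
        intro N
        rw [← mul_sub, ← Finset.sum_sub_distrib]
        congr 1
        have hg : ∀ n, g (y n) = f (y (n + 1)) := by
          intro n
          show f (shift (y n)) = _
          simp only [hy, Function.iterate_succ_apply']
        simp only [hg]
        induction N with
        | zero => simp
        | succ k ih =>
          rw [Finset.sum_Icc_succ_top (by omega), ih]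
          ring
      simp only [e]
      have hz : Tendsto (fun N : ℕ => (N : ℝ)⁻¹) U (𝓝 0) :=
        (tendsto_inv_atTop_nhds_zero_nat (𝕜 := ℝ)).mono_left hU
      refine hz.zero_mul_isBoundedUnder_le ?_
      refine isBoundedUnder_of ⟨‖f‖ + ‖f‖, fun N => ?_⟩
      exact (norm_sub_le _ _).trans (add_le_add (f.norm_coe_le_norm _) (f.norm_coe_le_norm _))
    have h4 := tendsto_nhds_unique h3 (h1.sub h2)
    show ∫ x, g x ∂(ν : Measure (ℤ → Bool)) = _
    linarith
  · intro C F hC hF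
    have h := key (BoundedContinuousFunction.indicator C hC)
    have e1 : ∫ x, (BoundedContinuousFunction.indicator C hC) x ∂(ν : Measure (ℤ → Bool))
        = (ν : Measure (ℤ → Bool)).real C := by
      simp only [BoundedContinuousFunction.indicator_apply]
      exact integral_indicator_one hC.isClosed.measurableSet
    rw [e1] at h
    refine h.congr fun N => ?_
    rw [div_eq_inv_mul, ← sum_indicator y C F hF N]
    rfl

end Furst


/-- **Furstenberg's correspondence principle**: given a set `E ⊆ ℕ` of positive upper
density, there is an invertible probability measure-preserving system `(X, μ, T)` and a
measurable set `A` of positive measure such that positivity of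
`μ(A ∩ T^{-n₁}A ∩ … ∩ T^{-n_k}A)` implies that `E ∩ (E - n₁) ∩ … ∩ (E - n_k)` has positive
upper density; in particular some `x` has `x, x+n₁, …, x+n_k ∈ E`. -/
theorem furstenberg_correspondence (E : Set ℕ) (hE : 0 < upperDensity E) :
    ∃ (X : Type) (_ : MeasurableSpace X) (μ : Measure X) (T : X ≃ᵐ X) (A : Set X),
      IsProbabilityMeasure μ ∧ MeasurePreserving (⇑T) μ μ ∧ MeasurableSet A ∧ 0 < μ A ∧
        ∀ (k : ℕ) (n : Fin k → ℕ), (∀ i, 0 < n i) →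
          0 < μ (A ∩ ⋂ i, (⇑T)^[n i] ⁻¹' A) →
            (0 < upperDensity (E ∩ ⋂ i, {m : ℕ | m + n i ∈ E}) ∧
              ∃ x : ℕ, x ∈ E ∧ ∀ i, x + n i ∈ E) := by
  classical
  obtain ⟨c, hc0, hcE⟩ := exists_between hE
  have hfreq : ∃ᶠ N : ℕ in atTop, c < (Nat.card ↥(E ∩ Set.Icc 1 N) : ℝ) / (N : ℝ) :=
    frequently_lt_of_lt_limsup (Furst.cobdd E) hcE
  haveI : NeBot (atTop ⊓ 𝓟 {N : ℕ | c < (Nat.card ↥(E ∩ Set.Icc 1 N) : ℝ) / (N : ℝ)}) :=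
    frequently_mem_iff_neBot.1 hfreq
  set U : Ultrafilter ℕ := Ultrafilter.of
    (atTop ⊓ 𝓟 {N : ℕ | c < (Nat.card ↥(E ∩ Set.Icc 1 N) : ℝ) / (N : ℝ)})
  have hUle : (U : Filter ℕ) ≤
    atTop ⊓ 𝓟 {N : ℕ | c < (Nat.card ↥(E ∩ Set.Icc 1 N) : ℝ) / (N : ℝ)} := Ultrafilter.of_le _
  have hU : (U : Filter ℕ) ≤ atTop := hUle.trans inf_le_left
  have hUc : ∀ᶠ N in (U : Filter ℕ), c < (Nat.card ↥(E ∩ Set.Icc 1 N) : ℝ) / (N : ℝ) :=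
    (hUle.trans inf_le_right) (mem_principal_self _)
  let x₀ : ℤ → Bool := fun n => decide (n.toNat ∈ E)
  obtain ⟨μ, hμ, hT, hlim⟩ := Furst.exists_limit x₀ U hU
  have hA : IsClopen {x : ℤ → Bool | x 0 = true} :=
    (isClopen_discrete {true}).preimage (continuous_apply 0)
  have hxA : ∀ m : ℕ, (Furst.shift^[m]) x₀ ∈ {x : ℤ → Bool | x 0 = true} ↔ m ∈ E := by
    intro m
    simp [Furst.shift_iter, x₀]
  refine ⟨ℤ → Bool, inferInstance, μ, Furst.shift, {x | x 0 = true}, hμ, hT,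
    hA.isClosed.measurableSet, ?_, ?_⟩
  · have h := ge_of_tendsto (hlim _ E hA hxA) (hUc.mono fun _ h => h.le)
    have h' : 0 < μ.real {x : ℤ → Bool | x 0 = true} := hc0.trans_le h
    exact (ENNReal.toReal_pos_iff.1 h').1
  · intro k n _ hpos
    set F : Set ℕ := E ∩ ⋂ i, {m : ℕ | m + n i ∈ E} with hFdef
    have hC : IsClopen ({x : ℤ → Bool | x 0 = true} ∩
        ⋂ i, (⇑Furst.shift)^[n i] ⁻¹' {x : ℤ → Bool | x 0 = true}) :=
      hA.inter (isClopen_iInter_of_finite fun i => hA.preimage (Furst.shift_cont.iterate _))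
    have hCF : ∀ m : ℕ, (Furst.shift^[m]) x₀ ∈ ({x : ℤ → Bool | x 0 = true} ∩
        ⋂ i, (⇑Furst.shift)^[n i] ⁻¹' {x : ℤ → Bool | x 0 = true}) ↔ m ∈ F := by
      intro m
      rw [Set.mem_inter_iff, hxA, hFdef, Set.mem_inter_iff, Set.mem_iInter, Set.mem_iInter]
      refine and_congr_right fun _ => forall_congr' fun i => ?_
      rw [Set.mem_preimage, ← Function.iterate_add_apply, hxA, Set.mem_setOf_eq, add_comm]
    have hl := hlim _ F hC hCF
    have hreal : 0 < μ.real ({x : ℤ → Bool | x 0 = true} ∩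
        ⋂ i, (⇑Furst.shift)^[n i] ⁻¹' {x : ℤ → Bool | x 0 = true}) :=
      ENNReal.toReal_pos hpos.ne' (measure_ne_top _ _)
    obtain ⟨d, hd0, hd⟩ := exists_between hreal
    have hev := hl.eventually (lt_mem_nhds hd)
    have hfr : ∃ᶠ N : ℕ in atTop, d ≤ (Nat.card ↥(F ∩ Set.Icc 1 N) : ℝ) / (N : ℝ) :=
      (hev.frequently.filter_mono hU).mono fun _ h => h.le
    refine ⟨hd0.trans_le (le_limsup_of_frequently_le hfr (Furst.bdd F)), ?_⟩
    obtain ⟨N, hN⟩ := hev.exists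
    have hne : (F ∩ Set.Icc 1 N).Nonempty := by
      by_contra hcon
      rw [Set.not_nonempty_iff_eq_empty] at hcon
      rw [hcon] at hN
      simp at hN
      linarith
    obtain ⟨x, hx, -⟩ := hne
    refine ⟨x, hx.1, fun i => ?_⟩
    have := Set.mem_iInter.1 hx.2 i
    exact this
end

section
/- (Furstenberg multiple recurrence theorem) Let (X, ℬ, μ, T) be a probability measure-preserving system and let A ∈ ℬ with μ(A) > 0. Then for every integer k ≥ 1, liminf_{N→∞} (1/N) Σ_{n=1}^{N} μ(A ∩ T^{−n}A ∩ T^{−2n}A ∩ … ∩ T^{−kn}A) > 0. -/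
open Filter MeasureTheory

noncomputable section DHJ

/-- average of a real function over a finite type -/
def avg {Ω : Type} [Finite Ω] (f : Ω → ℝ) : ℝ :=
  (∑ᶠ x, f x) / (Nat.card Ω : ℝ)

open Classical in
/-- indicator of a proposition -/
def ind (P : Prop) : ℝ := if P then 1 else 0

theorem ind_true {P : Prop} (h : P) : ind P = 1 := by simp [ind, h]
theorem ind_false {P : Prop} (h : ¬ P) : ind P = 0 := by simp [ind, h]
theorem ind_nonneg (P : Prop) : 0 ≤ ind P := by unfold ind; split_ifs <;> norm_num
theorem ind_le_one (P : Prop) : ind P ≤ 1 := by unfold ind; split_ifs <;> norm_num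
theorem ind_mono {P Q : Prop} (h : P → Q) : ind P ≤ ind Q := by
  by_cases hP : P
  · rw [ind_true hP, ind_true (h hP)]
  · rw [ind_false hP]; exact ind_nonneg _

theorem avg_eq {Ω : Type} [Fintype Ω] (f : Ω → ℝ) :
    avg f = (∑ x, f x) / (Fintype.card Ω : ℝ) := by
  unfold avg
  rw [finsum_eq_sum_of_fintype, Nat.card_eq_fintype_card]

theorem avg_sum_eq {Ω : Type} [Fintype Ω] [Nonempty Ω] (f : Ω → ℝ) :
    ∑ x, f x = (Fintype.card Ω : ℝ) * avg f := by
  rw [avg_eq]; field_simp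

section
variable {Ω Ω' : Type} [Finite Ω] [Finite Ω']

theorem avg_const [Nonempty Ω] (c : ℝ) : avg (fun _ : Ω => c) = c := by
  cases nonempty_fintype Ω
  rw [avg_eq]; simp

theorem avg_mono {f g : Ω → ℝ} (h : ∀ x, f x ≤ g x) : avg f ≤ avg g := by
  cases nonempty_fintype Ω
  rw [avg_eq, avg_eq]
  gcongr with x
  exact h x

theorem avg_nonneg {f : Ω → ℝ} (h : ∀ x, 0 ≤ f x) : 0 ≤ avg f := by
  cases nonempty_fintype Ω
  rw [avg_eq]
  exact div_nonneg (Finset.sum_nonneg fun x _ => h x) (by positivity)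

theorem avg_le_const [Nonempty Ω] {f : Ω → ℝ} {c : ℝ} (h : ∀ x, f x ≤ c) : avg f ≤ c := by
  rw [← avg_const (Ω := Ω) c]; exact avg_mono h

theorem const_le_avg [Nonempty Ω] {f : Ω → ℝ} {c : ℝ} (h : ∀ x, c ≤ f x) : c ≤ avg f := by
  rw [← avg_const (Ω := Ω) c]; exact avg_mono h

theorem avg_add (f g : Ω → ℝ) : avg (fun x => f x + g x) = avg f + avg g := by
  cases nonempty_fintype Ω
  rw [avg_eq, avg_eq, avg_eq, Finset.sum_add_distrib, add_div]

theorem avg_sub (f g : Ω → ℝ) : avg (fun x => f x - g x) = avg f - avg g := by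
  cases nonempty_fintype Ω
  rw [avg_eq, avg_eq, avg_eq, Finset.sum_sub_distrib, sub_div]

theorem avg_mul (c : ℝ) (f : Ω → ℝ) : avg (fun x => c * f x) = c * avg f := by
  cases nonempty_fintype Ω
  rw [avg_eq, avg_eq, ← Finset.mul_sum, mul_div_assoc]

theorem avg_comm (f : Ω → Ω' → ℝ) :
    avg (fun x => avg (fun y => f x y)) = avg (fun y => avg (fun x => f x y)) := by
  cases nonempty_fintype Ω
  cases nonempty_fintype Ω'
  simp only [avg_eq]
  rw [← Finset.sum_div, ← Finset.sum_div, Finset.sum_comm, div_right_comm]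

theorem avg_sum {K : Type} (s : Finset K) (f : K → Ω → ℝ) :
    avg (fun x => ∑ k ∈ s, f k x) = ∑ k ∈ s, avg (f k) := by
  cases nonempty_fintype Ω
  simp only [avg_eq]
  rw [Finset.sum_comm, Finset.sum_div]

theorem avg_equiv (e : Ω ≃ Ω') (f : Ω' → ℝ) : avg (fun x => f (e x)) = avg f := by
  cases nonempty_fintype Ω
  cases nonempty_fintype Ω'
  simp only [avg_eq]
  rw [Equiv.sum_comp e, Fintype.card_congr e]

theorem avg_prod (f : Ω × Ω' → ℝ) : avg f = avg (fun x => avg (fun y => f (x, y))) := by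
  cases nonempty_fintype Ω
  cases nonempty_fintype Ω'
  simp only [avg_eq]
  rw [← Finset.sum_div, Fintype.sum_prod_type, Fintype.card_prod, div_div, mul_comm]
  push_cast; rfl

theorem exists_ge_avg [Nonempty Ω] {f : Ω → ℝ} {c : ℝ} (h : c ≤ avg f) : ∃ x, c ≤ f x := by
  by_contra! hc
  cases nonempty_fintype Ω
  have : avg f < c := by
    rw [avg_eq, div_lt_iff₀ (by positivity)]
    calc ∑ x, f x < ∑ x : Ω, c := Finset.sum_lt_sum_of_nonempty Finset.univ_nonempty (fun x _ => hc x)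
      _ = c * Fintype.card Ω := by simp [mul_comm]
  linarith

/-- one value is bounded below if all are bounded above and the average is large -/
theorem value_ge_of_avg {f : Ω → ℝ} {a b : ℝ} (hf : ∀ x, f x ≤ a + b) (hb : 0 ≤ b)
    (h : a - b ≤ avg f) (x : Ω) : a - 2 * Nat.card Ω * b ≤ f x := by
  classical
  cases nonempty_fintype Ω
  have : Nonempty Ω := ⟨x⟩
  rw [avg_eq, le_div_iff₀ (by positivity)] at h
  rw [Nat.card_eq_fintype_card]
  have h1 : ∑ y, f y ≤ f x + (Fintype.card Ω - 1) * (a + b) := by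
    rw [← Finset.add_sum_erase _ _ (Finset.mem_univ x)]
    gcongr
    calc ∑ y ∈ Finset.univ.erase x, f y ≤ ∑ y ∈ Finset.univ.erase x, (a + b) :=
          Finset.sum_le_sum fun y _ => hf y
      _ = (Fintype.card Ω - 1) * (a + b) := by
        rw [Finset.sum_const, Finset.card_erase_of_mem (Finset.mem_univ x), nsmul_eq_mul,
          Nat.cast_sub (by rw [Finset.card_univ]; exact Fintype.card_pos)]
        simp
  nlinarith

/-- Popularity: if the density of a set in a product is at least `δ` and every section of density
at least `δ/2` has some property indexed by a finite type, then some index is popular. -/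
theorem exists_popular [Nonempty Ω] {K : Type} [Finite K] {δ : ℝ} (hδ : 0 < δ)
    (g : Ω → ℝ) (hg : ∀ t, g t ≤ 1) (P : K → Ω → Prop)
    (h : δ ≤ avg g) (hP : ∀ t, δ / 2 ≤ g t → ∃ w, P w t) :
    ∃ w, δ / (2 * Nat.card K) ≤ avg (fun t => ind (P w t)) := by
  cases nonempty_fintype K
  have h0 : ∃ t, δ ≤ g t := exists_ge_avg h
  obtain ⟨t0, ht0⟩ := h0
  obtain ⟨w0, -⟩ := hP t0 (by linarith)
  have : Nonempty K := ⟨w0⟩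
  by_contra! hc
  have h1 : ∀ t, g t - δ / 2 ≤ ∑ w, ind (P w t) := by
    intro t
    have hnn : ∀ w ∈ (Finset.univ : Finset K), 0 ≤ ind (P w t) := fun w _ => ind_nonneg _
    by_cases ht : δ / 2 ≤ g t
    · obtain ⟨w, hw⟩ := hP t ht
      have := Finset.single_le_sum hnn (Finset.mem_univ w)
      rw [ind_true hw] at this
      have := hg t
      linarith
    · have := Finset.sum_nonneg hnn
      linarith
  have h2 := avg_mono h1
  rw [avg_sub, avg_const, avg_sum] at h2
  have h3 : ∑ w, avg (fun t => ind (P w t)) < ∑ w : K, δ / (2 * Nat.card K) :=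
    Finset.sum_lt_sum_of_nonempty Finset.univ_nonempty fun w _ => hc w
  rw [Finset.sum_const, Nat.card_eq_fintype_card, nsmul_eq_mul, Finset.card_univ] at h3
  have h4 : (Fintype.card K : ℝ) * (δ / (2 * Fintype.card K)) = δ / 2 := by
    have : (Fintype.card K : ℝ) ≠ 0 := by positivity
    field_simp
  linarith

end

section words
variable {ι κ η α β : Type}

/-- substitute values for the variables of a word -/
def app (W : ι → α ⊕ η) (x : η → α) : ι → α := fun j => Sum.elim id x (W j)

def Proper (W : ι → α ⊕ η) : Prop := ∀ e, ∃ j, W j = Sum.inr e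

def wcomp (W : ι → α ⊕ η) (V : η → α ⊕ κ) : ι → α ⊕ κ := fun j => Sum.elim Sum.inl V (W j)

theorem app_comp (W : ι → α ⊕ η) (V : η → α ⊕ κ) (x : κ → α) :
    app (wcomp W V) x = app W (app V x) := by
  funext j
  unfold app wcomp
  cases W j <;> rfl

theorem Proper.comp {W : ι → α ⊕ η} {V : η → α ⊕ κ} (hW : Proper W) (hV : Proper V) :
    Proper (wcomp W V) := by
  intro e
  obtain ⟨j, hj⟩ := hV e
  obtain ⟨i, hi⟩ := hW j
  exact ⟨i, by simp [wcomp, hi, hj]⟩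

/-- glue functions on two pieces of the index set -/
def glue (e : ι ⊕ κ ≃ η) (x : ι → α) (t : κ → α) : η → α := fun j => Sum.elim x t (e.symm j)

theorem avg_glue [Finite ι] [Finite κ] [Finite η] [Finite α] (e : ι ⊕ κ ≃ η) (f : (η → α) → ℝ) :
    avg f = avg (fun x : ι → α => avg (fun t : κ → α => f (glue e x t))) := by
  rw [← avg_prod (f := fun p : (ι → α) × (κ → α) => f (glue e p.1 p.2))]
  rw [← avg_equiv ((Equiv.sumArrowEquivProdArrow ι κ α).symm.trans (Equiv.arrowCongr e (Equiv.refl α)))]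
  congr 1

theorem exists_split [Finite η] {a b : ℕ} (h : a + b ≤ Nat.card η) :
    ∃ (κ : Type) (_ : Finite κ) (_ : Fin a ⊕ κ ≃ η), b ≤ Nat.card κ := by
  refine ⟨Fin (Nat.card η - a), inferInstance, ?_, ?_⟩
  · refine (finSumFinEquiv.trans (finCongr (by omega))).trans (Finite.equivFin η).symm
  · simp; omega

end words

section mix
variable {S β : Type} [Finite S] [Finite β]

theorem avg_prod_pow {ι : Type} [Finite ι] (g : S → ℝ) :
    avg (fun s : ι → S => ∏ᶠ j, g (s j)) = (avg g) ^ Nat.card ι := by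
  classical
  cases nonempty_fintype ι
  cases nonempty_fintype S
  simp only [avg_eq, finprod_eq_prod_of_fintype]
  rw [div_pow, Nat.card_eq_fintype_card, ← Finset.card_univ (α := ι), ← Finset.prod_const,
    Finset.prod_univ_sum]
  simp

/-- few coordinates satisfying `P` is unlikely -/
theorem tail (P : S → Prop) (hP : ∃ s, P s) (L : ℕ) {c : ℝ} (hc : 0 < c) :
    ∃ N : ℕ, ∀ (ι : Type) [Finite ι], N ≤ Nat.card ι →
      avg (fun s : ι → S => ind (Nat.card {j // P (s j)} < L)) ≤ c := by
  classical
  cases nonempty_fintype S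
  obtain ⟨s0, hs0⟩ := hP
  have : Nonempty S := ⟨s0⟩
  set g : S → ℝ := fun s => if P s then 1 / 2 else 1 with hg
  have hg0 : ∀ s, 0 ≤ g s := fun s => by simp only [hg]; split_ifs <;> norm_num
  have hg1 : ∀ s, g s ≤ 1 := fun s => by simp only [hg]; split_ifs <;> norm_num
  have hρ0 : 0 ≤ avg g := avg_nonneg hg0
  have hρ1 : avg g < 1 := by
    rw [avg_eq, div_lt_one (by positivity)]
    calc ∑ x, g x < ∑ x : S, (1 : ℝ) := by
          apply Finset.sum_lt_sum (fun s _ => hg1 s)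
          exact ⟨s0, Finset.mem_univ _, by simp only [hg, hs0]; norm_num⟩
      _ = _ := by simp
  have hlim := (tendsto_pow_atTop_nhds_zero_of_lt_one hρ0 hρ1).const_mul ((2 : ℝ) ^ L)
  rw [mul_zero] at hlim
  obtain ⟨N, hN⟩ := (hlim.eventually (gt_mem_nhds hc)).exists_forall_of_atTop
  refine ⟨N, fun ι _ hι => ?_⟩
  cases nonempty_fintype ι
  refine le_trans ?_ (hN _ hι).le
  rw [← avg_prod_pow (ι := ι) g, ← avg_mul]
  apply avg_mono
  intro s
  rw [finprod_eq_prod_of_fintype]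
  have hprod : ∏ j, g (s j) = (1 / 2 : ℝ) ^ Nat.card {j // P (s j)} := by
    simp only [hg]
    rw [Finset.prod_ite]
    simp [Fintype.card_subtype]
  rw [hprod]
  by_cases hlt : Nat.card {j // P (s j)} < L
  · rw [ind_true hlt]
    obtain ⟨r, hr⟩ := Nat.exists_eq_add_of_lt hlt
    rw [hr, add_assoc, pow_add]
    rw [show ∀ n : ℕ, (2:ℝ)^n * (2:ℝ)^(r+1) * (1/2:ℝ)^n = 2^(r+1) from fun n => by
      rw [mul_right_comm, ← mul_pow]; norm_num]
    exact one_le_pow₀ (by norm_num)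
  · rw [ind_false hlt]; positivity

/-- the averaging over shifts of live coordinates -/
theorem avg_shift [Nonempty β] {π : S → β} {σ : β → S} (hσ : ∀ b, π (σ b) = b)
    {ι : Type} [Finite ι] (F : (ι → S) → ℝ) :
    avg F = avg (fun s : ι → S => avg (fun x : ι → β => F (fun j =>
      open Classical in if s j = σ (π (s j)) then σ (x j) else s j))) := by
  classical
  -- replace β by Fin n to get a group structure
  obtain ⟨n, ⟨e⟩⟩ := Finite.exists_equiv_fin β
  have hn : n ≠ 0 := by
    rintro rfl
    exact (e (Classical.arbitrary β)).elim0
  have : NeZero n := ⟨hn⟩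
  let _ : AddCommGroup β := e.addCommGroup
  have hσi : ∀ a b, σ a = σ b → a = b := fun a b h => by rw [← hσ a, ← hσ b, h]
  let τ : β → S ≃ S := fun b =>
    { toFun := fun s => if s = σ (π s) then σ (b + π s) else s
      invFun := fun s => if s = σ (π s) then σ (-b + π s) else s
      left_inv := by
        intro s
        by_cases h : s = σ (π s)
        · simp only [if_pos h, hσ, neg_add_cancel_left, ↓reduceIte]; exact h.symm
        · simp only [if_neg h]
      right_inv := by
        intro s
        by_cases h : s = σ (π s)
        · simp only [if_pos h, hσ, add_neg_cancel_left, ↓reduceIte]; exact h.symm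
        · simp only [if_neg h] }
  have h1 : ∀ x : ι → β, avg F = avg (fun s : ι → S => F (fun j => τ (x j) (s j))) := fun x =>
    (avg_equiv (Equiv.piCongrRight fun j => τ (x j)) F).symm
  have h2 : avg F = avg (fun x : ι → β => avg (fun s : ι → S => F (fun j => τ (x j) (s j)))) := by
    simp only [← h1]
    rw [avg_const]
  rw [h2, avg_comm]
  congr 1
  funext s
  rw [← avg_equiv (Equiv.addRight (fun j => π (s j)))
    (fun x : ι → β => F (fun j => if s j = σ (π (s j)) then σ (x j) else s j))]
  congr 1

/-- Mixing lemma -/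
theorem mix [Nonempty β] (π : S → β) (hπ : Function.Surjective π) (L : ℕ) {c : ℝ} (hc : 0 < c) :
    ∃ N : ℕ, ∀ (ι : Type) [Finite ι], N ≤ Nat.card ι → ∀ F : (ι → β) → ℝ, (∀ x, F x ≤ 2) →
      c ≤ avg (fun s : ι → S => F (fun j => π (s j))) →
      ∃ (κ : Type) (_ : Finite κ) (V : ι → β ⊕ κ), L ≤ Nat.card κ ∧ Proper V ∧
        c / 2 ≤ avg (fun x : κ → β => F (app V x)) := by
  classical
  obtain ⟨σ, hσ⟩ := hπ.hasRightInverse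
  have b0 : β := Classical.arbitrary β
  obtain ⟨N, hN⟩ := tail (fun s : S => s = σ (π s)) ⟨σ b0, by rw [hσ]⟩ L (c := c / 8) (by linarith)
  refine ⟨N, fun ι _ hι F hF hcF => ?_⟩
  have ht := hN ι hι
  have : Nonempty S := ⟨σ b0⟩
  rw [avg_shift hσ] at hcF
  have key : ∃ s : ι → S, L ≤ Nat.card {j // s j = σ (π (s j))} ∧ c / 2 ≤ avg (fun x : ι → β =>
      F (fun j => if s j = σ (π (s j)) then x j else π (s j))) := by
    by_contra! hcon
    have : avg (fun s : ι → S => avg (fun x : ι → β =>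
      F (fun j => π (if s j = σ (π (s j)) then σ (x j) else s j)))) < c := by
      have h1 : ∀ s : ι → S, avg (fun x : ι → β =>
        F (fun j => π (if s j = σ (π (s j)) then σ (x j) else s j))) ≤
        c / 2 + 2 * ind (Nat.card {j // s j = σ (π (s j))} < L) := by
        intro s
        by_cases hs : Nat.card {j // s j = σ (π (s j))} < L
        · rw [ind_true hs]
          have : avg (fun x : ι → β =>
            F (fun j => π (if s j = σ (π (s j)) then σ (x j) else s j))) ≤ 2 :=
            avg_le_const fun x => hF _
          linarith
        · rw [ind_false hs]
          have := hcon s (not_lt.mp hs)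
          have h2 : ∀ x : ι → β, (fun j => π (if s j = σ (π (s j)) then σ (x j) else s j)) =
              (fun j => if s j = σ (π (s j)) then x j else π (s j)) := by
            intro x; funext j
            rw [apply_ite π, hσ]
          simp only [h2]
          linarith
      have h3 := avg_mono h1
      rw [avg_add, avg_const, avg_mul] at h3
      linarith
    linarith
  obtain ⟨s, hs, hsF⟩ := key
  refine ⟨{j // s j = σ (π (s j))}, inferInstance,
    fun j => if h : s j = σ (π (s j)) then Sum.inr ⟨j, h⟩ else Sum.inl (π (s j)), hs, ?_, ?_⟩
  · rintro ⟨j, hj⟩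
    exact ⟨j, dif_pos hj⟩
  · rw [avg_glue (Equiv.sumCompl (fun j => s j = σ (π (s j))))] at hsF
    refine hsF.trans (le_of_eq ?_)
    congr 1
    funext x
    rw [← avg_const (Ω := ({j // ¬ s j = σ (π (s j))} → β)) (F _)]
    congr 1
    funext t
    congr 1
    funext j
    by_cases h : s j = σ (π (s j))
    · have h' : (Equiv.sumCompl fun j => s j = σ (π (s j))).symm j = Sum.inl ⟨j, h⟩ :=
        Equiv.sumCompl_symm_apply_of_pos (p := fun j => s j = σ (π (s j))) h
      simp only [app, dif_pos h, if_pos h, glue, h']; rfl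
    · simp only [app, dif_neg h, if_neg h]; rfl

end mix

section dhj

/-- the density Hales-Jewett property of an alphabet -/
def DHJ (α : Type) [Finite α] : Prop :=
  ∀ δ : ℝ, 0 < δ → ∃ N : ℕ, ∀ (ι : Type) [Finite ι], N ≤ Nat.card ι → ∀ A : Set (ι → α),
    δ ≤ avg (fun x => ind (x ∈ A)) → ∃ W : ι → α ⊕ Unit, Proper W ∧ ∀ x, app W x ∈ A

/-- multidimensional version -/
def MDHJ (α : Type) [Finite α] (m : ℕ) : Prop :=
  ∀ δ : ℝ, 0 < δ → ∃ N : ℕ, ∀ (ι : Type) [Finite ι], N ≤ Nat.card ι → ∀ A : Set (ι → α),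
    δ ≤ avg (fun x => ind (x ∈ A)) → ∃ W : ι → α ⊕ Fin m, Proper W ∧ ∀ x, app W x ∈ A

variable {ι κ η ζ α β : Type}

def cw (t : ι → α) : ι → α ⊕ η := fun j => Sum.inl (t j)

theorem app_cw (t : ι → α) (x : η → α) : app (cw t) x = t := rfl

theorem app_glue (e : ι ⊕ κ ≃ ζ) (V : ι → α ⊕ η) (W : κ → α ⊕ η) (x : η → α) :
    app (glue e V W) x = glue e (app V x) (app W x) := by
  funext j
  simp only [app, glue]
  cases e.symm j <;> rfl

theorem Proper.glue_left (e : ι ⊕ κ ≃ ζ) {V : ι → α ⊕ η} (W : κ → α ⊕ η) (hV : Proper V) :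
    Proper (glue e V W) := by
  intro a
  obtain ⟨j, hj⟩ := hV a
  exact ⟨e (Sum.inl j), by simp [glue, hj]⟩

theorem Proper.glue_right (e : ι ⊕ κ ≃ ζ) (V : ι → α ⊕ η) {W : κ → α ⊕ η} (hW : Proper W) :
    Proper (glue e V W) := by
  intro a
  obtain ⟨j, hj⟩ := hW a
  exact ⟨e (Sum.inr j), by simp [glue, hj]⟩

theorem Proper.app_injective {W : ι → α ⊕ η} (hW : Proper W) : Function.Injective (app W) := by
  intro x y h
  funext a
  obtain ⟨j, hj⟩ := hW a
  have := congrFun h j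
  simpa [app, hj] using this

/-- rename the variables -/
theorem renameVars (e : η ≃ κ) {W : ι → α ⊕ η} (hW : Proper W) :
    ∃ W' : ι → α ⊕ κ, Proper W' ∧ ∀ x, app W' x = app W (fun a => x (e a)) := by
  refine ⟨fun j => Sum.map id e (W j), ?_, ?_⟩
  · intro a
    obtain ⟨j, hj⟩ := hW (e.symm a)
    exact ⟨j, by simp [hj]⟩
  · intro x
    funext j
    simp only [app]
    cases W j <;> rfl

theorem mdhj_of_dhj [Finite α] [Nonempty α] (h : DHJ α) (m : ℕ) : MDHJ α m := by
  induction m with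
  | zero =>
    intro δ hδ
    refine ⟨0, fun ι _ _ A hA => ?_⟩
    obtain ⟨x, hx⟩ := exists_ge_avg hA
    refine ⟨cw x, fun e => e.elim0, fun _ => ?_⟩
    rw [app_cw]
    by_contra hn
    rw [ind_false hn] at hx
    linarith
  | succ m ih =>
    intro δ hδ
    obtain ⟨N1, h1⟩ := h (δ / 2) (by linarith)
    have hK : 0 < (Nat.card (Fin N1 → α ⊕ Unit) : ℝ) := by
      exact_mod_cast Nat.card_pos
    obtain ⟨N2, h2⟩ := ih (δ / (2 * Nat.card (Fin N1 → α ⊕ Unit))) (by positivity)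
    refine ⟨N1 + N2, fun ι _ hι A hA => ?_⟩
    obtain ⟨κ, _, e, hκ⟩ := exists_split hι
    rw [avg_glue e, avg_comm] at hA
    obtain ⟨W, hW⟩ := exists_popular (K := Fin N1 → α ⊕ Unit) hδ
      (fun t : κ → α => avg (fun x : Fin N1 → α => ind (glue e x t ∈ A)))
      (fun t => avg_le_const fun x => ind_le_one _)
      (fun W t => Proper W ∧ ∀ x, glue e (app W x) t ∈ A) hA
      (fun t ht => h1 (Fin N1) (by simp) {x | glue e x t ∈ A} ht)
    obtain ⟨V, hV, hVA⟩ := h2 κ hκ {t | Proper W ∧ ∀ x, glue e (app W x) t ∈ A} hW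
    have hWp : Proper W := (hVA (fun _ => Classical.arbitrary α)).1
    let W' : Fin N1 → α ⊕ (Unit ⊕ Fin m) := fun j => Sum.map id Sum.inl (W j)
    let V' : κ → α ⊕ (Unit ⊕ Fin m) := fun j => Sum.map id Sum.inr (V j)
    have hW' : ∀ z, app W' z = app W (fun a => z (Sum.inl a)) := by
      intro z; funext j; simp only [app, W']; cases W j <;> rfl
    have hV' : ∀ z, app V' z = app V (fun a => z (Sum.inr a)) := by
      intro z; funext j; simp only [app, V']; cases V j <;> rfl
    have hp : Proper (glue e W' V') := by
      rintro (a | a)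
      · obtain ⟨j, hj⟩ := hWp a
        exact ⟨e (Sum.inl j), by simp [glue, W', hj]⟩
      · obtain ⟨j, hj⟩ := hV a
        exact ⟨e (Sum.inr j), by simp [glue, V', hj]⟩
    have eq : Unit ⊕ Fin m ≃ Fin (m + 1) :=
      Fintype.equivFinOfCardEq (by simp [add_comm])
    obtain ⟨U, hU, hUa⟩ := renameVars eq hp
    refine ⟨U, hU, fun x => ?_⟩
    rw [hUa, app_glue, hW', hV']
    exact (hVA _).2 _

/-- insensitivity under switching `none` and `some i` -/
def Ins (i : α) (D : Set (ι → Option α)) : Prop :=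
  ∀ x y : ι → Option α, (∀ j, (x j).getD i = (y j).getD i) → (x ∈ D ↔ y ∈ D)

theorem Ins.app {i : α} {D : Set (ι → Option α)} (h : Ins i D) (W : ι → Option α ⊕ κ) :
    Ins i {x | app W x ∈ D} := by
  intro x y hxy
  apply h
  intro j
  simp only [_root_.app]
  cases W j with
  | inl a => rfl
  | inr a => exact hxy a

theorem Ins.glue_left {i : α} {D : Set (ζ → Option α)} (h : Ins i D) (e : ι ⊕ κ ≃ ζ)
    (t : κ → Option α) : Ins i {x | glue e x t ∈ D} := by
  intro x y hxy
  apply h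
  intro j
  simp only [glue]
  cases e.symm j with
  | inl a => exact hxy a
  | inr a => rfl

theorem Ins.glue_right {i : α} {D : Set (ζ → Option α)} (h : Ins i D) (e : ι ⊕ κ ≃ ζ)
    (x : ι → Option α) : Ins i {t | glue e x t ∈ D} := by
  intro t s hts
  apply h
  intro j
  simp only [glue]
  cases e.symm j with
  | inl a => rfl
  | inr a => exact hts a

theorem ins_subspace [Finite α] (hM : ∀ m, MDHJ α m) (i : α) (m : ℕ) {δ : ℝ}
    (hδ : 0 < δ) : ∃ N : ℕ, ∀ (ι : Type) [Finite ι], N ≤ Nat.card ι →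
      ∀ D : Set (ι → Option α), Ins i D → δ ≤ avg (fun x => ind (x ∈ D)) →
      ∃ W : ι → Option α ⊕ Fin m, Proper W ∧ ∀ x, app W x ∈ D := by
  have : Nonempty α := ⟨i⟩
  obtain ⟨L, hL⟩ := hM m (δ / 2) (by linarith)
  obtain ⟨N, hN⟩ := mix (fun o : Option α => o.getD i) (fun a => ⟨some a, rfl⟩) L hδ
  refine ⟨N, fun ι _ hι D hD hDδ => ?_⟩
  obtain ⟨κ, _, V, hκ, hV, hVa⟩ := hN ι hι (fun x => ind ((fun j => some (x j)) ∈ D))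
    (fun x => (ind_le_one _).trans (by norm_num)) (by
      refine hDδ.trans (avg_mono fun x => ind_mono fun hx => ?_)
      exact (hD x _ (fun j => by simp)).1 hx)
  obtain ⟨U, hU, hUa⟩ := hL κ hκ {x | (fun j => some (app V x j)) ∈ D} hVa
  refine ⟨fun j => Sum.map some id (wcomp V U j), ?_, fun x => ?_⟩
  · intro a
    obtain ⟨j, hj⟩ := hV.comp hU a
    exact ⟨j, by simp [hj]⟩
  · refine (hD _ _ fun j => ?_).1 (hUa (fun a => (x a).getD i))
    rw [← app_comp]
    simp only [app]
    cases wcomp V U j <;> rfl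

theorem avg_range {Ω Z : Type} [Finite Ω] [Finite Z] [Nonempty Z] {φ : Z → Ω}
    (hφ : Function.Injective φ)
    (f : Ω → ℝ) : avg (fun x => f x * ind (x ∈ Set.range φ)) =
      (Nat.card Z / Nat.card Ω : ℝ) * avg (fun z => f (φ z)) := by
  classical
  cases nonempty_fintype Ω
  cases nonempty_fintype Z
  rw [avg_eq, avg_eq, Nat.card_eq_fintype_card, Nat.card_eq_fintype_card]
  have : ∑ x, f x * ind (x ∈ Set.range φ) = ∑ z, f (φ z) := by
    rw [← Finset.sum_image (s := Finset.univ) (g := φ) (f := f) (fun a _ b _ h => hφ h)]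
    rw [← Finset.sum_filter_add_sum_filter_not Finset.univ (fun x => x ∈ Set.range φ)]
    rw [Finset.sum_eq_zero (s := Finset.filter (fun x => ¬ x ∈ Set.range φ) Finset.univ), add_zero]
    · apply Finset.sum_congr
      · ext x; simp
      · intro x hx
        rw [ind_true (by simpa using hx), mul_one]
    · intro x hx
      rw [ind_false (by simpa using hx), mul_zero]
  rw [this]
  have : (Fintype.card Z : ℝ) ≠ 0 := by positivity
  field_simp

/-- nonpositive average on all `m`-dimensional subspaces -/
def NP (m : ℕ) [Finite β] (F : (ι → β) → ℝ) : Prop :=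
  ∀ W : ι → β ⊕ Fin m, Proper W → avg (fun x => F (app W x)) ≤ 0

theorem NP.app {m : ℕ} [Finite β] {F : (ι → β) → ℝ} (h : NP m F) {V : ι → β ⊕ κ}
    (hV : Proper V) : NP m (fun x => F (app V x)) := by
  intro W hW
  simpa only [app_comp] using h (wcomp V W) (hV.comp hW)

theorem ins_bound_rec [Finite α] (i : α) (m : ℕ) {ε : ℝ} (hε : 0 < ε) (n0 : ℕ)
    (hn0 : ∀ D : Set (Fin n0 → Option α), Ins i D → ε / 4 ≤ avg (fun x => ind (x ∈ D)) →
      ∃ W : Fin n0 → Option α ⊕ Fin m, Proper W ∧ ∀ x, app W x ∈ D) :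
    ∃ c : ℝ, 0 < c ∧ c ≤ 1 ∧ ∀ (r : ℕ) (ι : Type) [Finite ι], r * n0 ≤ Nat.card ι →
      ∀ D : Set (ι → Option α), Ins i D → ∀ F : (ι → Option α) → ℝ, (∀ x, F x ≤ 1) → NP m F →
        avg (fun x => F x * ind (x ∈ D)) ≤ ε / 2 + (1 - c) ^ r * avg (fun x => ind (x ∈ D)) := by
  set c1 : ℝ := ε / 2 / (2 * Nat.card (Fin n0 → Option α ⊕ Fin m)) with hc1
  set c2 : ℝ := 1 / Nat.card (Fin n0 → Option α) with hc2
  have hKpos : 0 < (Nat.card (Fin n0 → Option α ⊕ Fin m) : ℝ) := by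
    exact_mod_cast Nat.card_pos
  have hK2pos : 0 < (Nat.card (Fin n0 → Option α) : ℝ) := by
    exact_mod_cast Nat.card_pos
  have hc1p : 0 < c1 := by positivity
  have hc2p : 0 < c2 := by positivity
  refine ⟨min 1 (c2 * c1), by positivity, min_le_left _ _, ?_⟩
  set c := min 1 (c2 * c1) with hc
  have hcc : c ≤ c2 * c1 := min_le_right _ _
  have hcp : 0 < c := by positivity
  have hc1' : 0 ≤ 1 - c := by have := min_le_left 1 (c2 * c1); linarith
  intro r
  induction r with
  | zero =>
    intro ι _ _ D hD F hF hNP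
    have : avg (fun x => F x * ind (x ∈ D)) ≤ avg (fun x => ind (x ∈ D)) :=
      avg_mono fun x => mul_le_of_le_one_left (ind_nonneg _) (hF x)
    simp only [pow_zero, one_mul]
    linarith
  | succ r ih =>
    intro ι _ hι D hD F hF hNP
    by_cases hsmall : avg (fun x => ind (x ∈ D)) < ε / 2
    · have h1 : avg (fun x => F x * ind (x ∈ D)) ≤ avg (fun x => ind (x ∈ D)) :=
        avg_mono fun x => mul_le_of_le_one_left (ind_nonneg _) (hF x)
      have h2 : 0 ≤ (1 - c) ^ (r + 1) * avg (fun x => ind (x ∈ D)) :=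
        mul_nonneg (pow_nonneg hc1' _) (avg_nonneg fun x => ind_nonneg _)
      linarith
    push Not at hsmall
    obtain ⟨κ, _, e, hκ⟩ := exists_split (a := n0) (b := r * n0) (η := ι) (by
      rw [add_mul, one_mul] at hι; omega)
    have hpop := hsmall
    rw [avg_glue e, avg_comm] at hpop
    obtain ⟨V, hV⟩ := exists_popular (K := Fin n0 → Option α ⊕ Fin m) (by linarith)
      (fun t : κ → Option α => avg (fun x : Fin n0 → Option α => ind (glue e x t ∈ D)))
      (fun t => avg_le_const fun x => ind_le_one _)
      (fun W t => Proper W ∧ ∀ x, glue e (app W x) t ∈ D) hpop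
      (fun t ht => hn0 {x | glue e x t ∈ D} (hD.glue_left e t) (by
        refine le_trans (le_of_eq ?_) ht; ring))
    rw [← hc1] at hV
    have hVp : Proper V := by
      obtain ⟨t, ht⟩ := exists_ge_avg hV
      by_contra hn
      rw [ind_false (fun h => hn h.1)] at ht
      linarith
    set D' : Set (κ → Option α) := {t | Proper V ∧ ∀ x, glue e (app V x) t ∈ D} with hD'
    set D2 : (Fin n0 → Option α) → Set (κ → Option α) := fun x =>
      {t | glue e x t ∈ D ∧ ¬ (x ∈ Set.range (app V) ∧ t ∈ D')} with hD2
    have hD'ins : Ins i D' := by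
      intro t s hts
      simp only [hD', Set.mem_ofPred_eq]
      refine and_congr_right fun _ => forall_congr' fun x => ?_
      exact hD.glue_right e (app V x) t s hts
    have hD2ins : ∀ x, Ins i (D2 x) := by
      intro x t s hts
      have h1 := hD'ins t s hts
      have h2 := hD.glue_right e x t s hts
      simp only [Set.mem_ofPred_eq] at h2
      simp only [hD2, Set.mem_ofPred_eq, h1, h2]
    have hsplit : ∀ x t, ind (glue e x t ∈ D) =
        ind (t ∈ D2 x) + ind (x ∈ Set.range (app V)) * ind (t ∈ D') := by
      intro x t
      by_cases hx : x ∈ Set.range (app V)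
      · by_cases ht : t ∈ D'
        · have h1 : glue e x t ∈ D := by
            obtain ⟨z, rfl⟩ := hx
            exact ht.2 z
          rw [ind_true hx, ind_true ht, ind_true h1, ind_false (fun h => h.2 ⟨hx, ht⟩)]
          norm_num
        · rw [ind_false ht, mul_zero, add_zero]
          congr 1
          simp [hD2, ht]
      · rw [ind_false hx, zero_mul, add_zero]
        congr 1
        simp only [hD2, Set.mem_ofPred_eq, hx, false_and, not_false_eq_true, and_true]
    -- density drop
    have hdens : avg (fun x => avg (fun t => ind (t ∈ D2 x))) ≤
        (1 - c) * avg (fun x => ind (x ∈ D)) := by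
      have h1 : avg (fun x => ind (x ∈ D)) = avg (fun x => avg (fun t => ind (t ∈ D2 x))) +
          avg (fun x => 1 * ind (x ∈ Set.range (app V))) * avg (fun t => ind (t ∈ D')) := by
        rw [avg_glue e]
        simp only [hsplit, avg_add, avg_mul]
        congr 1
        simp only [one_mul]
        rw [mul_comm, ← avg_mul]
        congr 1
        funext x
        ring
      rw [avg_range hVp.app_injective, avg_const, mul_one] at h1
      have h2 : c2 ≤ (Nat.card (Fin m → Option α) : ℝ) / Nat.card (Fin n0 → Option α) := by
        rw [hc2]
        gcongr
        exact_mod_cast (Nat.card_pos : 0 < Nat.card (Fin m → Option α))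
      have h3 : c2 * c1 ≤ (Nat.card (Fin m → Option α) : ℝ) / Nat.card (Fin n0 → Option α) *
          avg (fun t => ind (t ∈ D')) := by
        gcongr
        exact hV
      have h4 : avg (fun x => ind (x ∈ D)) ≤ 1 := avg_le_const fun x => ind_le_one _
      nlinarith
    have hFd : avg (fun x => F x * ind (x ∈ D)) =
        avg (fun x => avg (fun t => F (glue e x t) * ind (t ∈ D2 x))) +
        avg (fun t => ind (t ∈ D') * avg (fun x => F (glue e x t) * ind (x ∈ Set.range (app V)))) := by
      rw [avg_glue e]
      simp only [hsplit, mul_add, avg_add]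
      congr 1
      rw [avg_comm]
      congr 1
      funext t
      rw [← avg_mul]
      congr 1
      funext x
      ring
    have hsecond : avg (fun t => ind (t ∈ D') *
        avg (fun x => F (glue e x t) * ind (x ∈ Set.range (app V)))) ≤ 0 := by
      apply avg_le_const
      intro t
      apply mul_nonpos_of_nonneg_of_nonpos (ind_nonneg _)
      rw [avg_range hVp.app_injective (fun x => F (glue e x t))]
      apply mul_nonpos_of_nonneg_of_nonpos (by positivity)
      have := hNP (glue e V (cw t)) (hVp.glue_left e _)
      simpa only [app_glue, app_cw] using this
    have hfirst : avg (fun x => avg (fun t => F (glue e x t) * ind (t ∈ D2 x))) ≤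
        avg (fun x => ε / 2 + (1 - c) ^ r * avg (fun t => ind (t ∈ D2 x))) := by
      apply avg_mono
      intro x
      refine ih κ hκ (D2 x) (hD2ins x) (fun t => F (glue e x t)) (fun t => hF _) ?_
      intro W hW
      have := hNP (glue e (cw x) W) (hW.glue_right e _)
      simpa only [app_glue, app_cw] using this
    rw [avg_add, avg_const, avg_mul] at hfirst
    have h5 : (1 - c) ^ r * avg (fun x => avg (fun t => ind (t ∈ D2 x))) ≤
        (1 - c) ^ r * ((1 - c) * avg (fun x => ind (x ∈ D))) :=
      mul_le_mul_of_nonneg_left hdens (pow_nonneg hc1' _)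
    rw [pow_succ, mul_assoc]
    linarith

theorem ins_bound [Finite α] (hM : ∀ m, MDHJ α m) (i : α) (m : ℕ) {ε : ℝ} (hε : 0 < ε) :
    ∃ N : ℕ, ∀ (ι : Type) [Finite ι], N ≤ Nat.card ι →
      ∀ D : Set (ι → Option α), Ins i D → ∀ F : (ι → Option α) → ℝ, (∀ x, F x ≤ 1) → NP m F →
        avg (fun x => F x * ind (x ∈ D)) ≤ ε := by
  obtain ⟨n0, hn0⟩ := ins_subspace hM i m (δ := ε / 4) (by linarith)
  obtain ⟨c, hc0, hc1, hc⟩ := ins_bound_rec i m hε n0 (hn0 (Fin n0) (by simp))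
  obtain ⟨r, hr⟩ := exists_pow_lt_of_lt_one (y := 1 - c) (half_pos hε) (by linarith)
  refine ⟨r * n0, fun ι _ hι D hD F hF hNP => (hc r ι hι D hD F hF hNP).trans ?_⟩
  have : (1 - c) ^ r * avg (fun x => ind (x ∈ D)) ≤ (1 - c) ^ r :=
    mul_le_of_le_one_right (pow_nonneg (by linarith) _) (avg_le_const fun x => ind_le_one _)
  linarith

theorem inter_bound [Finite α] [Nonempty α] (hM : ∀ m, MDHJ α m) (I : Finset α) :
    ∀ (m : ℕ) (ε : ℝ), 0 < ε →
    ∃ N : ℕ, ∀ (ι : Type) [Finite ι], N ≤ Nat.card ι →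
      ∀ D : α → Set (ι → Option α), (∀ i, Ins i (D i)) →
      ∀ F : (ι → Option α) → ℝ, (∀ x, F x ≤ 1) → NP m F →
        avg (fun x => F x * ind (∀ i ∈ I, x ∈ D i)) ≤ ε := by
  classical
  induction I using Finset.induction_on with
  | empty =>
    intro m ε hε
    obtain ⟨N, hN⟩ := ins_bound hM (Classical.arbitrary α) m hε
    refine ⟨N, fun ι _ hι D hD F hF hNP => ?_⟩
    have := hN ι hι Set.univ (fun x y _ => by simp) F hF hNP
    simpa using this
  | insert a I ha ih =>
    intro m ε hε
    obtain ⟨m', hm'⟩ := ih m (ε / 2) (by linarith)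
    obtain ⟨N, hN⟩ := ins_bound hM a m' (half_pos hε)
    refine ⟨N, fun ι _ hι D hD F hF hNP => ?_⟩
    have h := hN ι hι (D a) (hD a) (fun x => F x * ind (∀ i ∈ I, x ∈ D i) - ε / 2) (fun x => by
      have h1 := hF x
      have h2 := ind_nonneg (∀ i ∈ I, x ∈ D i)
      have h3 := ind_le_one (∀ i ∈ I, x ∈ D i)
      nlinarith) (by
        intro W hW
        have := hm' (Fin m') (by simp) (fun i => {x | app W x ∈ D i}) (fun i => (hD i).app W)
          (fun x => F (app W x)) (fun x => hF _) (hNP.app hW)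
        rw [avg_sub, avg_const]
        simp only [Set.mem_ofPred_eq] at this
        linarith)
    have h2 : avg (fun x => F x * ind (∀ i ∈ insert a I, x ∈ D i)) ≤
        avg (fun x => (F x * ind (∀ i ∈ I, x ∈ D i) - ε / 2) * ind (x ∈ D a) + ε / 2) := by
      apply avg_mono
      intro x
      by_cases hx : x ∈ D a
      · rw [ind_true hx]
        simp only [Finset.forall_mem_insert, hx, true_and]
        linarith
      · rw [ind_false hx, ind_false (fun h => hx (h a (Finset.mem_insert_self _ _)))]
        linarith
    rw [avg_add, avg_const] at h2
    linarith

end dhj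

section step
variable {α : Type} [Finite α]

/-- every set of density at least `δ` in high dimension contains a line -/
def Good (β : Type) [Finite β] (δ : ℝ) : Prop :=
  ∃ N : ℕ, ∀ (ι : Type) [Finite ι], N ≤ Nat.card ι → ∀ A : Set (ι → β),
    δ ≤ avg (fun x => ind (x ∈ A)) → ∃ W : ι → β ⊕ Unit, Proper W ∧ ∀ x, app W x ∈ A

theorem Good.mono {β : Type} [Finite β] {δ δ' : ℝ} (h : Good β δ) (hd : δ ≤ δ') : Good β δ' := by
  obtain ⟨N, hN⟩ := h
  exact ⟨N, fun ι _ hι A hA => hN ι hι A (hd.trans hA)⟩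

theorem cell_sum {α ι : Type} (D : α → Set ι) (w : ι) [Fintype (Set α)] [DecidableEq (Set α)] :
    ind (¬ ∀ a, w ∈ D a) =
      ∑ J ∈ (Finset.univ : Finset (Set α)).erase Set.univ, ind (∀ a, (w ∈ D a ↔ a ∈ J)) := by
  by_cases h : ∀ a, w ∈ D a
  · rw [ind_false (not_not.mpr h), Finset.sum_eq_zero]
    intro J hJ
    apply ind_false
    intro hc
    apply (Finset.mem_erase.1 hJ).1
    ext a
    simp [← hc a, h a]
  · rw [ind_true h]
    rw [Finset.sum_eq_single {a | w ∈ D a}]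
    · rw [ind_true]; intro a; rfl
    · intro J _ hJ
      apply ind_false
      intro hc
      apply hJ
      ext a
      exact (hc a).symm
    · intro hn
      exfalso
      apply hn
      rw [Finset.mem_erase]
      refine ⟨fun hu => h fun a => ?_, Finset.mem_univ _⟩
      have : a ∈ {a | w ∈ D a} := by rw [hu]; trivial
      exact this

theorem core [Nonempty α] (h : DHJ α) {d : ℝ} (hd : 0 < d)
    (hgood : ∀ γ : ℝ, 0 < γ → Good (Option α) (d + γ)) :
    ∃ ε : ℝ, 0 < ε ∧ Good (Option α) (d - ε) := by
  classical
  cases nonempty_fintype α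
  have hM : ∀ m, MDHJ α m := mdhj_of_dhj h
  obtain ⟨M, hMl⟩ := h (d / 2 / 2) (by linarith)
  have hMl := hMl (Fin M) (by simp)
  set K : ℝ := ((Nat.card (Fin M → α ⊕ Unit) : ℕ) : ℝ) with hK
  have hKpos : 0 < K := by
    rw [hK]; exact_mod_cast Nat.card_pos
  set θ : ℝ := d / 2 / (2 * K) with hθ
  have hθp : 0 < θ := by positivity
  have hdθ : 0 < d * θ := by positivity
  set γ : ℝ := d * θ / 8 with hγ
  have hγp : 0 < γ := by positivity
  set ε3 : ℝ := min (d * θ / 8) (d / 2) with hε3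
  have hε3p : 0 < ε3 := by positivity
  have hε3a : ε3 ≤ d * θ / 8 := min_le_left _ _
  have hε3b : ε3 ≤ d / 2 := min_le_right _ _
  set c : ℝ := d * θ / 2 with hc
  have hcp : 0 < c := by positivity
  obtain ⟨m, hm⟩ := hgood γ hγp
  set nC : ℝ := ((Fintype.card (Set α) : ℕ) : ℝ) with hnC
  have hnCp : 0 < nC := by rw [hnC]; exact_mod_cast Fintype.card_pos
  obtain ⟨L', hL'⟩ := inter_bound hM Finset.univ m (c / (4 * nC)) (by positivity)
  let π : (Fin M → α ⊕ Unit) → α ⊕ Fin M → Option α := fun l =>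
    Sum.elim some (fun a => Sum.elim some (fun _ => none) (l a))
  have hπs : ∀ l, Proper l → Function.Surjective (π l) := by
    intro l hl o
    cases o with
    | some a => exact ⟨Sum.inl a, rfl⟩
    | none =>
      obtain ⟨j, hj⟩ := hl ()
      exact ⟨Sum.inr j, by simp [π, hj]⟩
  have hmix : ∀ l, ∃ N : ℕ, Proper l → ∀ (ι : Type) [Finite ι], N ≤ Nat.card ι →
      ∀ F : (ι → Option α) → ℝ, (∀ x, F x ≤ 2) →
      c ≤ avg (fun s : ι → α ⊕ Fin M => F (fun j => π l (s j))) →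
      ∃ (κ : Type) (_ : Finite κ) (V : ι → Option α ⊕ κ), L' ≤ Nat.card κ ∧ Proper V ∧
        c / 2 ≤ avg (fun x : κ → Option α => F (app V x)) := by
    intro l
    by_cases hl : Proper l
    · obtain ⟨N, hN⟩ := mix (π l) (hπs l hl) L' hcp
      exact ⟨N, fun _ => hN⟩
    · exact ⟨0, fun h => absurd h hl⟩
  have htail : ∀ l, ∃ N : ℕ, Proper l → ∀ (ι : Type) [Finite ι], N ≤ Nat.card ι →
      avg (fun s : ι → α ⊕ Fin M => ind (Nat.card {j // π l (s j) = none} < 1)) ≤ d * θ / 8 := by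
    intro l
    by_cases hl : Proper l
    · obtain ⟨N, hN⟩ := tail (fun s => π l s = none) (hπs l hl none) 1 (c := d * θ / 8) (by positivity)
      exact ⟨N, fun _ => hN⟩
    · exact ⟨0, fun h => absurd h hl⟩
  choose N1 hN1 using hmix
  choose N3 hN3 using htail
  obtain ⟨L1, hL1⟩ := Finite.exists_le N1
  obtain ⟨L3, hL3⟩ := Finite.exists_le N3
  set L := max L1 L3 with hL
  set K' : ℝ := ((Nat.card (Fin L → Option α) : ℕ) : ℝ) with hK'
  have hK'pos : 0 < K' := by
    rw [hK']; exact_mod_cast Nat.card_pos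
  obtain ⟨N2, hN2⟩ := hgood (ε3 / (2 * K')) (by positivity)
  refine ⟨ε3 / (2 * K'), by positivity, L + N2, fun ι _ hι A hA => ?_⟩
  by_contra! lf
  obtain ⟨κ, _, e, hκ⟩ := exists_split hι
  have hsec : ∀ w : Fin L → Option α,
      avg (fun t : κ → Option α => ind (glue e w t ∈ A)) ≤ d + ε3 / (2 * K') := by
    intro w
    by_contra! hlt
    obtain ⟨W, hW, hWA⟩ := hN2 κ hκ {t | glue e w t ∈ A} hlt.le
    obtain ⟨x, hx⟩ := lf (glue e (cw w) W) (hW.glue_right e _)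
    apply hx
    rw [app_glue, app_cw]
    exact hWA x
  have hsec2 : ∀ w : Fin L → Option α,
      d - ε3 ≤ avg (fun t : κ → Option α => ind (glue e w t ∈ A)) := by
    intro w
    rw [avg_glue e] at hA
    have := value_ge_of_avg hsec (by positivity) hA w
    rw [← hK'] at this
    have h2 : 2 * K' * (ε3 / (2 * K')) = ε3 := by field_simp
    linarith
  -- a popular line
  obtain ⟨l, hl⟩ := exists_popular (K := Fin M → α ⊕ Unit)
    (Ω := (Fin L → α ⊕ Fin M) × (κ → Option α)) (δ := d / 2) (by linarith)
    (fun p => avg (fun y : Fin M → α => ind (glue e (fun j => some (app p.1 y j)) p.2 ∈ A)))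
    (fun p => avg_le_const fun y => ind_le_one _)
    (fun l p => Proper l ∧ ∀ x, glue e (fun j => some (app p.1 (app l x) j)) p.2 ∈ A)
    (by
      rw [avg_prod]
      apply const_le_avg
      intro f
      rw [avg_comm]
      apply const_le_avg
      intro y
      have := hsec2 (fun j => some (app f y j))
      simp only
      linarith)
    (fun p hp => hMl {y | glue e (fun j => some (app p.1 y j)) p.2 ∈ A} hp)
  rw [← hK, ← hθ] at hl
  have hlp : Proper l := by
    obtain ⟨t, ht⟩ := exists_ge_avg hl
    by_contra hn
    rw [ind_false (fun h => hn h.1)] at ht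
    linarith
  have hLcard : Nat.card (Fin L) = L := by simp
  have hmixl := hN1 l hlp (Fin L) (by rw [hLcard]; exact (hL1 l).trans (le_max_left _ _))
  have htaill := hN3 l hlp (Fin L) (by rw [hLcard]; exact (hL3 l).trans (le_max_right _ _))
  let D : (κ → Option α) → α → Set (Fin L → Option α) := fun t a =>
    {w | glue e (fun j => some ((w j).getD a)) t ∈ A}
  have hDins : ∀ t a, Ins a (D t a) := by
    intro t a x y hxy
    simp only [D, Set.mem_ofPred_eq, hxy]
  let F : (κ → Option α) → (Fin L → Option α) → ℝ := fun t w => ind (glue e w t ∈ A) - (d + γ)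
  let H : (κ → Option α) → (Fin L → Option α) → ℝ := fun t w => F t w * ind (¬ ∀ a, w ∈ D t a)
  have hF1 : ∀ t w, F t w ≤ 1 := by
    intro t w
    have := ind_le_one (glue e w t ∈ A)
    simp only [F]
    linarith
  have hH2 : ∀ t w, H t w ≤ 2 := by
    intro t w
    have h1 := hF1 t w
    have h2 := ind_nonneg (¬ ∀ a, w ∈ D t a)
    have h3 := ind_le_one (¬ ∀ a, w ∈ D t a)
    simp only [H]
    nlinarith
  -- points of A in all D have no `none`
  have hline : ∀ t w, (∀ a, w ∈ D t a) → glue e w t ∈ A → Nat.card {j // w j = none} < 1 := by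
    intro t w hw hA
    by_contra hcard
    have hpos : 0 < Nat.card {j // w j = none} := by omega
    obtain ⟨⟨j0, hj0⟩⟩ := (Nat.card_pos_iff.1 hpos).1
    let W : Fin L → Option α ⊕ Unit := fun j => if w j = none then Sum.inr () else Sum.inl (w j)
    have hW : Proper W := fun _ => ⟨j0, if_pos hj0⟩
    obtain ⟨x, hx⟩ := lf (glue e W (cw t)) (hW.glue_left e _)
    apply hx
    rw [app_glue, app_cw]
    cases hx0 : x () with
    | none =>
      have : app W x = w := by
        funext j
        by_cases hj : w j = none
        · simp only [app, W, if_pos hj, Sum.elim_inr]; rw [hj]; exact hx0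
        · simp only [app, W, if_neg hj, Sum.elim_inl, id]
      rw [this]; exact hA
    | some a =>
      have : app W x = fun j => some ((w j).getD a) := by
        funext j
        by_cases hj : w j = none
        · simp only [app, W, if_pos hj, Sum.elim_inr]; rw [hj]; exact hx0
        · simp only [app, W, if_neg hj, Sum.elim_inl, id]
          obtain ⟨b, hb⟩ := Option.ne_none_iff_exists'.1 hj
          rw [hb]; rfl
      rw [this]; exact hw a
  have hpt : ∀ (t : κ → Option α) (f : Fin L → α ⊕ Fin M),
      F t (fun j => π l (f j)) + (d + γ) * ind (Proper l ∧ ∀ x,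
        glue e (fun j => some (app f (app l x) j)) t ∈ A)
        - ind (Nat.card {j // π l (f j) = none} < 1) ≤ H t (fun j => π l (f j)) := by
    intro t f
    have hconn : (∀ a, (fun j => π l (f j)) ∈ D t a) ↔
        ∀ x, glue e (fun j => some (app f (app l x) j)) t ∈ A := by
      have : ∀ x : Unit → α, (fun j => some (app f (app l x) j)) =
          fun j => some ((π l (f j)).getD (x ())) := by
        intro x
        funext j
        simp only [app, π]
        cases f j with
        | inl b => rfl
        | inr b =>
          simp only [Sum.elim_inr, app]
          cases l b <;> rfl
      simp only [this]
      exact ⟨fun h x => h (x ()), fun h a => h (fun _ => a)⟩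
    by_cases hall : ∀ a, (fun j => π l (f j)) ∈ D t a
    · simp only [H]
      rw [ind_false (not_not.mpr hall), ind_true ⟨hlp, hconn.1 hall⟩, mul_zero, mul_one]
      have := ind_mono (hline t _ hall)
      simp only [F]
      linarith
    · simp only [H]
      rw [ind_true hall, ind_false (fun h => hall (hconn.2 h.2)), mul_zero, mul_one]
      have := ind_nonneg (Nat.card {j // π l (f j) = none} < 1)
      linarith
  have hbig : c ≤ avg (fun t => avg (fun f : Fin L → α ⊕ Fin M => H t (fun j => π l (f j)))) := by
    have h1 := avg_mono (fun t => avg_mono (hpt t))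
    refine le_trans ?_ h1
    simp only [avg_sub, avg_add, avg_mul, avg_const]
    rw [avg_prod, avg_comm] at hl
    have h2 : d - ε3 - (d + γ) ≤
        avg (fun t => avg (fun f : Fin L → α ⊕ Fin M => F t (fun j => π l (f j)))) := by
      rw [avg_comm]
      apply const_le_avg
      intro f
      simp only [F]
      rw [avg_sub, avg_const]
      have := hsec2 (fun j => π l (f j))
      linarith
    have h3 := mul_le_mul_of_nonneg_left hl (by positivity : (0:ℝ) ≤ d + γ)
    have h4 : 0 ≤ γ * θ := by positivity
    simp only at h3
    rw [hc]
    linarith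
  obtain ⟨t, ht⟩ := exists_ge_avg hbig
  obtain ⟨ζ, _, V, hζ, hV, hVa⟩ := hmixl (H t) (hH2 t) ht
  have hNP : NP m (F t) := by
    intro W hW
    simp only [F]
    rw [avg_sub, avg_const]
    by_contra! hlt
    obtain ⟨U, hU, hUA⟩ := hm (Fin m) (by simp) {x | glue e (app W x) t ∈ A} (by
      simp only [Set.mem_ofPred_eq]; linarith)
    obtain ⟨x, hx⟩ := lf (glue e (wcomp W U) (cw t)) ((hW.comp hU).glue_left e _)
    apply hx
    rw [app_glue, app_cw, app_comp]
    exact hUA x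
  have hle : avg (fun x : ζ → Option α => H t (app V x)) ≤ c / 4 := by
    simp only [H, cell_sum, Finset.mul_sum, avg_sum]
    calc ∑ J ∈ (Finset.univ : Finset (Set α)).erase Set.univ,
          avg (fun x : ζ → Option α => F t (app V x) * ind (∀ a, (app V x ∈ D t a ↔ a ∈ J)))
        ≤ ∑ J ∈ (Finset.univ : Finset (Set α)).erase Set.univ, c / (4 * nC) := by
          apply Finset.sum_le_sum
          intro J _
          have := hL' ζ hζ (fun a => {x | app V x ∈ D t a ↔ a ∈ J}) (by
            intro a x y hxy
            have := (hDins t a).app V x y hxy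
            simp only [Set.mem_ofPred_eq] at this ⊢
            rw [this]) (fun x => F t (app V x)) (fun x => hF1 _ _) (hNP.app hV)
          simpa using this
      _ ≤ ∑ J : Set α, c / (4 * nC) := by
          apply Finset.sum_le_sum_of_subset_of_nonneg (Finset.erase_subset _ _)
          intro _ _ _
          positivity
      _ = c / 4 := by
          rw [Finset.sum_const, nsmul_eq_mul, Finset.card_univ, ← hnC]
          field_simp
  linarith

theorem dhj_option [Nonempty α] (h : DHJ α) : DHJ (Option α) := by
  set G : Set ℝ := {δ | 0 < δ ∧ Good (Option α) δ} with hG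
  have h2 : (2 : ℝ) ∈ G := by
    refine ⟨by norm_num, 0, fun ι _ _ A hA => ?_⟩
    have : avg (fun x => ind (x ∈ A)) ≤ 1 := avg_le_const fun x => ind_le_one _
    linarith
  have hbdd : BddBelow G := ⟨0, fun x hx => hx.1.le⟩
  have hgood : ∀ γ : ℝ, 0 < γ → Good (Option α) (sInf G + γ) := by
    intro γ hγ
    obtain ⟨g, hg, hlt⟩ := exists_lt_of_csInf_lt ⟨2, h2⟩ (by linarith : sInf G < sInf G + γ)
    exact hg.2.mono hlt.le
  have h0 : 0 ≤ sInf G := Real.sInf_nonneg fun x hx => hx.1.le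
  rcases h0.eq_or_lt with h0 | h0
  · intro δ hδ
    have := hgood δ hδ
    rw [← h0, zero_add] at this
    exact this
  · exfalso
    obtain ⟨ε, hε, hgε⟩ := core h h0 hgood
    have : max (sInf G - ε) (sInf G / 2) ∈ G :=
      ⟨lt_of_lt_of_le (by linarith) (le_max_right _ _), hgε.mono (le_max_left _ _)⟩
    have h3 := csInf_le hbdd this
    have h4 : max (sInf G - ε) (sInf G / 2) < sInf G := max_lt (by linarith) (by linarith)
    linarith

theorem DHJ.equiv {β : Type} [Finite β] (e : α ≃ β) (h : DHJ α) : DHJ β := by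
  intro δ hδ
  obtain ⟨N, hN⟩ := h δ hδ
  refine ⟨N, fun ι _ hι A hA => ?_⟩
  rw [← avg_equiv (Equiv.arrowCongr (Equiv.refl ι) e)] at hA
  obtain ⟨W, hW, hWA⟩ := hN ι hι {x | (Equiv.arrowCongr (Equiv.refl ι) e) x ∈ A} hA
  refine ⟨fun j => Sum.map e id (W j), ?_, fun x => ?_⟩
  · intro a
    obtain ⟨j, hj⟩ := hW a
    exact ⟨j, by simp [hj]⟩
  · have := hWA (fun a => e.symm (x a))
    have heq : app (fun j => Sum.map e id (W j)) x =
        (Equiv.arrowCongr (Equiv.refl ι) e) (app W fun a => e.symm (x a)) := by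
      funext j
      simp only [app, Equiv.arrowCongr_apply, Function.comp, Equiv.refl_symm, Equiv.refl_apply]
      cases W j <;> simp
    rw [heq]
    exact this

theorem dhj_fin (k : ℕ) : DHJ (Fin (k + 1)) := by
  induction k with
  | zero =>
    intro δ hδ
    refine ⟨1, fun ι _ hι A hA => ?_⟩
    obtain ⟨x, hx⟩ := exists_ge_avg hA
    have hxA : x ∈ A := by
      by_contra hn
      rw [ind_false hn] at hx
      linarith
    obtain ⟨j⟩ := (Nat.card_pos_iff.1 (by omega : 0 < Nat.card ι)).1
    refine ⟨fun _ => Sum.inr (), fun _ => ⟨j, rfl⟩, fun y => ?_⟩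
    have : app (fun _ : ι => (Sum.inr () : Fin (0 + 1) ⊕ Unit)) y = x := by
      funext i
      exact Subsingleton.elim (α := Fin 1) _ _
    rw [this]; exact hxA
  | succ k ih => exact (dhj_option ih).equiv (finSuccEquiv (k + 1)).symm

end step

section final

theorem ind_eq_indicator {X : Type*} (S : Set X) :
    (fun y => ind (y ∈ S)) = S.indicator (fun _ => (1 : ℝ)) := by
  funext y
  by_cases h : y ∈ S
  · rw [ind_true h, Set.indicator_of_mem h]
  · rw [ind_false h, Set.indicator_of_notMem h]

theorem integral_ind {X : Type*} [MeasurableSpace X] (μ : Measure X) {S : Set X}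
    (hS : MeasurableSet S) : ∫ y, ind (y ∈ S) ∂μ = μ.real S := by
  rw [ind_eq_indicator]
  exact integral_indicator_one hS

theorem integrable_ind {X : Type*} [MeasurableSpace X] (μ : Measure X) [IsProbabilityMeasure μ]
    {S : Set X} (hS : MeasurableSet S) : Integrable (fun y => ind (y ∈ S)) μ := by
  rw [ind_eq_indicator]
  exact (integrable_const 1).indicator hS

def base {k N : ℕ} (W : Fin N → Fin (k + 1) ⊕ Unit) : ℕ :=
  ∑ j, Sum.elim (fun a : Fin (k + 1) => (a : ℕ)) (fun _ => 0) (W j)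

def stp {k N : ℕ} (W : Fin N → Fin (k + 1) ⊕ Unit) : ℕ :=
  ∑ j, Sum.elim (fun _ : Fin (k + 1) => 0) (fun _ => 1) (W j)

theorem sum_app {k N : ℕ} (W : Fin N → Fin (k + 1) ⊕ Unit) (i : Fin (k + 1)) :
    ∑ j, ((app W (fun _ => i) j : Fin (k + 1)) : ℕ) = base W + i * stp W := by
  unfold base stp
  rw [Finset.mul_sum, ← Finset.sum_add_distrib]
  apply Finset.sum_congr rfl
  intro j _
  simp only [app]
  cases W j <;> simp

theorem stp_le {k N : ℕ} (W : Fin N → Fin (k + 1) ⊕ Unit) : stp W ≤ N := by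
  unfold stp
  calc _ ≤ ∑ j : Fin N, 1 := Finset.sum_le_sum fun j _ => by cases W j <;> simp
    _ = N := by simp

theorem stp_pos {k N : ℕ} {W : Fin N → Fin (k + 1) ⊕ Unit} (hW : Proper W) : 1 ≤ stp W := by
  unfold stp
  obtain ⟨j, hj⟩ := hW ()
  have := Finset.single_le_sum (f := fun j => Sum.elim (fun _ : Fin (k + 1) => 0) (fun _ => 1) (W j))
    (fun _ _ => Nat.zero_le _) (Finset.mem_univ j)
  simpa [hj] using this

theorem dilate_bound {X : Type*} [MeasurableSpace X] (μ : Measure X) [IsProbabilityMeasure μ]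
    (T : X ≃ᵐ X) (hT : MeasurePreserving (⇑T) μ μ)
    (A : Set X) (hA : MeasurableSet A) (k N : ℕ) {δ : ℝ} (hδ : δ = μ.real A)
    (hN : ∀ B : Set (Fin N → Fin (k + 1)), δ / 2 ≤ avg (fun x => ind (x ∈ B)) →
      ∃ W : Fin N → Fin (k + 1) ⊕ Unit, Proper W ∧ ∀ x, app W x ∈ B)
    (s : Finset (Fin N → Fin (k + 1) ⊕ Unit)) (hs : ∀ W, W ∈ s ↔ Proper W) (d : ℕ) :
    δ / 2 ≤ ∑ W ∈ s, μ.real (⋂ j : Fin (k + 1), (⇑T)^[(j : ℕ) * (d * stp W)] ⁻¹' A) := by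
  have hmeas : ∀ n : ℕ, Measurable ((⇑T)^[n]) := fun n => T.measurable.iterate n
  have hmp : ∀ n : ℕ, MeasurePreserving ((⇑T)^[n]) μ μ := fun n => hT.iterate n
  have hmI : ∀ n : ℕ, MeasurableSet (⋂ j : Fin (k + 1), (⇑T)^[(j : ℕ) * n] ⁻¹' A) := fun n =>
    MeasurableSet.iInter fun j => hmeas _ hA
  -- pointwise inequality
  have hpt : ∀ y : X, avg (fun x : Fin N → Fin (k + 1) =>
      ind (y ∈ (⇑T)^[d * ∑ j, (x j : ℕ)] ⁻¹' A)) - δ / 2 ≤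
      ∑ W ∈ s, ind (y ∈ (⇑T)^[d * base W] ⁻¹'
        (⋂ j : Fin (k + 1), (⇑T)^[(j : ℕ) * (d * stp W)] ⁻¹' A)) := by
    intro y
    have hnn : ∀ W ∈ s, 0 ≤ ind (y ∈ (⇑T)^[d * base W] ⁻¹'
        (⋂ j : Fin (k + 1), (⇑T)^[(j : ℕ) * (d * stp W)] ⁻¹' A)) := fun W _ => ind_nonneg _
    by_cases hy : δ / 2 ≤ avg (fun x : Fin N → Fin (k + 1) =>
      ind (y ∈ (⇑T)^[d * ∑ j, (x j : ℕ)] ⁻¹' A))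
    · obtain ⟨W, hW, hWy⟩ := hN {x | y ∈ (⇑T)^[d * ∑ j, (x j : ℕ)] ⁻¹' A} hy
      have h1 := Finset.single_le_sum hnn ((hs W).2 hW)
      rw [ind_true] at h1
      · have h2 : avg (fun x : Fin N → Fin (k + 1) =>
          ind (y ∈ (⇑T)^[d * ∑ j, (x j : ℕ)] ⁻¹' A)) ≤ 1 := avg_le_const fun x => ind_le_one _
        have h3 : 0 ≤ δ := by rw [hδ]; exact measureReal_nonneg
        linarith
      · rw [Set.mem_preimage, Set.mem_iInter]
        intro i
        have h4 : (⇑T)^[d * ∑ j, ((app W (fun _ => i) j : Fin (k + 1)) : ℕ)] y ∈ A := hWy (fun _ => i)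
        rw [sum_app] at h4
        rw [Set.mem_preimage, ← Function.iterate_add_apply]
        convert h4 using 2
        ring
    · have := Finset.sum_nonneg hnn
      linarith
  have hInteg1 : ∀ x : Fin N → Fin (k + 1),
      Integrable (fun y => ind (y ∈ (⇑T)^[d * ∑ j, (x j : ℕ)] ⁻¹' A)) μ := fun x =>
    integrable_ind μ (hmeas _ hA)
  have hInteg2 : ∀ W ∈ s, Integrable (fun y => ind (y ∈ (⇑T)^[d * base W] ⁻¹'
        (⋂ j : Fin (k + 1), (⇑T)^[(j : ℕ) * (d * stp W)] ⁻¹' A))) μ := fun W _ =>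
    integrable_ind μ (hmeas _ (hmI _))
  simp only [avg_eq] at hpt
  have hInteg3 : Integrable (fun y => (∑ x : Fin N → Fin (k + 1),
      ind (y ∈ (⇑T)^[d * ∑ j, (x j : ℕ)] ⁻¹' A)) / (Fintype.card (Fin N → Fin (k + 1)) : ℝ)) μ :=
    (integrable_finsetSum _ fun x _ => hInteg1 x).div_const _
  have h := integral_mono (μ := μ) (hInteg3.sub (integrable_const (δ / 2)))
    (integrable_finsetSum _ hInteg2) hpt
  simp only [Pi.sub_apply] at h
  rw [integral_sub hInteg3 (integrable_const _), integral_div,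
    integral_finsetSum _ (fun x _ => hInteg1 x), integral_finsetSum _ hInteg2] at h
  have e1 : ∀ x : Fin N → Fin (k + 1),
      ∫ y, ind (y ∈ (⇑T)^[d * ∑ j, (x j : ℕ)] ⁻¹' A) ∂μ = δ := by
    intro x
    rw [integral_ind μ (hmeas _ hA), hδ, (hmp _).measureReal_preimage hA.nullMeasurableSet]
  have e2 : ∀ W : Fin N → Fin (k + 1) ⊕ Unit, ∫ y, ind (y ∈ (⇑T)^[d * base W] ⁻¹'
        (⋂ j : Fin (k + 1), (⇑T)^[(j : ℕ) * (d * stp W)] ⁻¹' A)) ∂μ =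
      μ.real (⋂ j : Fin (k + 1), (⇑T)^[(j : ℕ) * (d * stp W)] ⁻¹' A) := by
    intro W
    rw [integral_ind μ (hmeas _ (hmI _)), (hmp _).measureReal_preimage (hmI _).nullMeasurableSet]
  simp only [e1, e2] at h
  have h5 : (∑ _x : Fin N → Fin (k + 1), δ) / (Fintype.card (Fin N → Fin (k + 1)) : ℝ) = δ := by
    rw [← avg_eq, avg_const]
  rw [h5] at h
  simp only [integral_const, probReal_univ, smul_eq_mul, one_mul] at h
  linarith

end final

end DHJ

/-- **Furstenberg's multiple recurrence theorem**: for an invertible probability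
measure-preserving system `(X, μ, T)`, a set `A` of positive measure and `k ≥ 1`,
`liminf_{N→∞} (1/N) Σ_{n=1}^N μ(A ∩ T^{-n}A ∩ … ∩ T^{-kn}A) > 0`. -/
theorem furstenberg_multiple_recurrence
    {X : Type*} [MeasurableSpace X] (μ : Measure X) [IsProbabilityMeasure μ]
    (T : X ≃ᵐ X) (hT : MeasurePreserving (⇑T) μ μ)
    (A : Set X) (hA : MeasurableSet A) (hApos : 0 < μ A) (k : ℕ) (hk : 1 ≤ k) :
    0 < liminf (fun N : ℕ =>
      (1 / (N : ℝ)) * ∑ n ∈ Finset.Icc 1 N,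
        (μ (⋂ j : Fin (k + 1), (⇑T)^[(j : ℕ) * n] ⁻¹' A)).toReal) atTop := by
  classical
  set f : ℕ → ℝ := fun n => (μ (⋂ j : Fin (k + 1), (⇑T)^[(j : ℕ) * n] ⁻¹' A)).toReal with hf
  have hf0 : ∀ n, 0 ≤ f n := fun n => ENNReal.toReal_nonneg
  have hf1 : ∀ n, f n ≤ 1 := fun n => measureReal_le_one
  have hδ : 0 < μ.real A := ENNReal.toReal_pos hApos.ne' (measure_ne_top _ _)
  set δ := μ.real A with hδdef
  obtain ⟨N0, hN0⟩ := dhj_fin k (δ / 2) (by linarith)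
  set M := N0 + 1 with hM
  have hN := hN0 (Fin M) (by simp [hM])
  set s : Finset (Fin M → Fin (k + 1) ⊕ Unit) := Finset.univ.filter Proper with hs
  have hdil : ∀ d, δ / 2 ≤ ∑ W ∈ s, f (d * stp W) := fun d =>
    dilate_bound μ T hT A hA k M hδdef hN s (by simp [hs]) d
  set C : ℝ := (s.card : ℝ) + 1 with hC
  have hCp : 0 < C := by positivity
  have hMp : (0 : ℝ) < M := by simp only [hM]; positivity
  set c : ℝ := δ / (4 * M * C) with hc
  have hcp : 0 < c := by positivity
  have hlow : ∀ n : ℕ, M ≤ n → c ≤ (1 / (n : ℝ)) * ∑ i ∈ Finset.Icc 1 n, f i := by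
    intro n hn
    set q := n / M with hq
    have hMpos : 0 < M := by omega
    have hq1 : 1 ≤ q := (Nat.one_le_div_iff hMpos).2 hn
    have hqM : q * M ≤ n := Nat.div_mul_le_self n M
    have hn2 : n ≤ 2 * M * q := by
      have h1 := Nat.lt_div_mul_add (a := n) hMpos
      rw [← hq] at h1
      nlinarith
    have h1 : (q : ℝ) * (δ / 2) ≤ ∑ d ∈ Finset.Icc 1 q, ∑ W ∈ s, f (d * stp W) := by
      calc (q : ℝ) * (δ / 2) = ∑ d ∈ Finset.Icc 1 q, δ / 2 := by simp
        _ ≤ _ := Finset.sum_le_sum fun d _ => hdil d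
    rw [Finset.sum_comm] at h1
    have h2 : ∀ W ∈ s, ∑ d ∈ Finset.Icc 1 q, f (d * stp W) ≤ ∑ i ∈ Finset.Icc 1 n, f i := by
      intro W hW
      have hp : 1 ≤ stp W := stp_pos (by simpa [hs] using hW)
      have hle := stp_le W
      rw [← Finset.sum_image (s := Finset.Icc 1 q) (g := fun d => d * stp W) (f := f)]
      · apply Finset.sum_le_sum_of_subset_of_nonneg
        · intro i hi
          simp only [Finset.mem_image, Finset.mem_Icc] at hi ⊢
          obtain ⟨d, ⟨hd1, hd2⟩, rfl⟩ := hi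
          exact ⟨Nat.mul_pos hd1 hp, (Nat.mul_le_mul hd2 hle).trans hqM⟩
        · intro i _ _; exact hf0 i
      · intro a _ b _ hab
        exact Nat.eq_of_mul_eq_mul_right hp hab
    have h3 := Finset.sum_le_sum h2
    rw [Finset.sum_const, nsmul_eq_mul] at h3
    set S := ∑ i ∈ Finset.Icc 1 n, f i with hS
    have hS0 : 0 ≤ S := Finset.sum_nonneg fun i _ => hf0 i
    have hnpos : (0 : ℝ) < n := by exact_mod_cast lt_of_lt_of_le hMpos hn
    have h4 : (q : ℝ) * (δ / 2) ≤ C * S := by rw [hC]; linarith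
    have h5 : (n : ℝ) ≤ 2 * M * q := by exact_mod_cast hn2
    rw [one_div, inv_mul_eq_div, le_div_iff₀ hnpos, hc, div_mul_eq_mul_div,
      div_le_iff₀ (by positivity)]
    have h6 : δ * n ≤ δ * (2 * M * q) := by gcongr
    have h7 : 4 * M * ((q : ℝ) * (δ / 2)) ≤ 4 * M * (C * S) := by gcongr
    linarith
  have hup : ∀ n : ℕ, (1 / (n : ℝ)) * ∑ i ∈ Finset.Icc 1 n, f i ≤ 1 := by
    intro n
    have h1 : ∑ i ∈ Finset.Icc 1 n, f i ≤ n := by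
      calc _ ≤ ∑ i ∈ Finset.Icc 1 n, (1 : ℝ) := Finset.sum_le_sum fun i _ => hf1 i
        _ = n := by simp
    rw [one_div, inv_mul_eq_div]
    exact div_le_one_of_le₀ h1 (by positivity)
  refine lt_of_lt_of_le hcp (le_liminf_of_le ?_ ?_)
  · exact (isBoundedUnder_of ⟨1, hup⟩).isCoboundedUnder_ge
  · filter_upwards [eventually_ge_atTop M] with n hn using hlow n hn
end

section
/- Let (X, ℬ, μ, T) be a probability measure-preserving system that is weakly mixing, in the sense that the product system (X × X, ℬ⊗ℬ, μ×μ, T×T) is ergodic. Then for every real-valued f ∈ L^∞(μ), (1/N) Σ_{n=1}^{N} ∫ f(x)·f(Tⁿx)·f(T^{2n}x) dμ(x) converges as N → ∞ to (∫ f dμ)³. -/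
open Filter MeasureTheory Topology

lemma aux_sum_dist (ρ : ℕ → ℝ) (hρ : ∀ n, 0 ≤ ρ n) (r : ℕ → ℕ → ℝ)
    (h1 : ∀ h m, r (h + m) h ≤ ρ m) (h2 : ∀ h m, r h (h + m) ≤ ρ m) (H : ℕ) :
    ∑ h ∈ Finset.range H, ∑ k ∈ Finset.range H, r h k
      ≤ 2 * H * ∑ m ∈ Finset.range H, ρ m := by
  induction H with
  | zero => simp
  | succ H ih =>
    have e : ∑ h ∈ Finset.range (H+1), ∑ k ∈ Finset.range (H+1), r h k
        = ∑ h ∈ Finset.range H, ∑ k ∈ Finset.range H, r h k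
          + ∑ h ∈ Finset.range H, r h H + ∑ k ∈ Finset.range (H+1), r H k := by
      rw [Finset.sum_range_succ]
      simp_rw [fun h => Finset.sum_range_succ (fun k => r h k) H]
      rw [Finset.sum_add_distrib]
    have a2 : ∑ h ∈ Finset.range (H+1), r H h ≤ ∑ m ∈ Finset.range (H+1), ρ m := by
      rw [← Finset.sum_range_reflect ρ]
      apply Finset.sum_le_sum
      intro h hh
      have hh' : h ≤ H := by simpa [Nat.lt_succ_iff] using hh
      have := h1 h (H - h)
      rw [Nat.add_sub_cancel' hh'] at this
      simpa using this
    have a3 : ∑ h ∈ Finset.range H, r h H ≤ ∑ m ∈ Finset.range (H+1), ρ m := by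
      rw [← Finset.sum_range_reflect ρ, Finset.sum_range_succ]
      refine le_add_of_le_of_nonneg (Finset.sum_le_sum ?_) (hρ _)
      intro h hh
      have hh' : h < H := by simpa using hh
      have := h2 h (H - h)
      rw [Nat.add_sub_cancel' hh'.le] at this
      simpa using this
    have a4 : (2 * H : ℝ) * ∑ m ∈ Finset.range H, ρ m
        ≤ 2 * H * ∑ m ∈ Finset.range (H + 1), ρ m := by
      refine mul_le_mul_of_nonneg_left ?_ (by positivity)
      rw [Finset.sum_range_succ]
      linarith [hρ H]
    rw [e]
    push_cast
    linarith

lemma aux_abs_avg (ρ : ℕ → ℝ)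
    (h : Tendsto (fun N : ℕ => (N : ℝ)⁻¹ * ∑ n ∈ Finset.range N, ρ n ^ 2) atTop (𝓝 0)) :
    Tendsto (fun N : ℕ => (N : ℝ)⁻¹ * ∑ n ∈ Finset.range N, |ρ n|) atTop (𝓝 0) := by
  have h' := (Real.continuous_sqrt.tendsto 0).comp h
  rw [Real.sqrt_zero] at h'
  refine squeeze_zero (fun N => by positivity) (fun N => ?_) h'
  apply Real.le_sqrt_of_sq_le
  rcases Nat.eq_zero_or_pos N with rfl | hN
  · simp
  have := sq_sum_le_card_mul_sum_sq (s := Finset.range N) (f := fun n => |ρ n|)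
  simp only [sq_abs, Finset.card_range] at this
  rw [mul_pow]
  calc _ ≤ (N:ℝ)⁻¹ ^ 2 * (N * ∑ i ∈ Finset.range N, ρ i ^ 2) := by gcongr
    _ = _ := by field_simp

lemma aux_shift {E : Type*} [NormedAddCommGroup E] [NormedSpace ℝ E] (x : ℕ → E) (C : ℝ)
    (hx : ∀ n, ‖x n‖ ≤ C) (h : ℕ) :
    Tendsto (fun N : ℕ => (N : ℝ)⁻¹ • ∑ n ∈ Finset.range N, (x n - x (n + h))) atTop (𝓝 0) := by
  have key : ∀ N, ‖∑ n ∈ Finset.range N, (x n - x (n + h))‖ ≤ 2 * h * C := by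
    intro N
    have e : ∑ n ∈ Finset.range N, (x n - x (n + h))
        = ∑ n ∈ Finset.range h, x n - ∑ n ∈ Finset.range h, x (N + n) := by
      rw [Finset.sum_sub_distrib, sub_eq_sub_iff_add_eq_add, ← Finset.sum_range_add, add_comm N h,
        Finset.sum_range_add]
      simp_rw [add_comm h]
    rw [e]
    have b : ∀ y : ℕ → E, (∀ n, ‖y n‖ ≤ C) → ‖∑ n ∈ Finset.range h, y n‖ ≤ h * C := by
      intro y hy
      refine (norm_sum_le_of_le _ (fun i _ => hy i)).trans ?_
      simp
    refine (norm_sub_le _ _).trans ?_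
    have := b x hx
    have := b (fun n => x (N + n)) (fun n => hx _)
    linarith
  refine squeeze_zero_norm (a := fun N : ℕ => (N : ℝ)⁻¹ * (2 * h * C)) (fun N => ?_) ?_
  · rw [norm_smul]
    simp only [norm_inv, RCLike.norm_natCast]
    gcongr
    exact key N
  · simpa using (tendsto_inv_atTop_nhds_zero_nat (𝕜 := ℝ)).mul_const (2 * h * C)

lemma aux_norm_avg {E : Type*} [NormedAddCommGroup E] [InnerProductSpace ℝ E] (y : ℕ → E) (N : ℕ) :
    ‖(N : ℝ)⁻¹ • ∑ n ∈ Finset.range N, y n‖ ^ 2 ≤ (N : ℝ)⁻¹ * ∑ n ∈ Finset.range N, ‖y n‖ ^ 2 := by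
  rcases Nat.eq_zero_or_pos N with rfl | hN
  · simp
  have := sq_sum_le_card_mul_sum_sq (s := Finset.range N) (f := fun n => ‖y n‖)
  simp only [Finset.card_range] at this
  rw [norm_smul, mul_pow]
  simp only [norm_inv, RCLike.norm_natCast]
  calc _ ≤ (N:ℝ)⁻¹ ^ 2 * (∑ i ∈ Finset.range N, ‖y i‖) ^ 2 := by gcongr; exact norm_sum_le _ _
    _ ≤ (N:ℝ)⁻¹ ^ 2 * (N * ∑ i ∈ Finset.range N, ‖y i‖ ^ 2) := by gcongr
    _ = _ := by field_simp

lemma aux_vdc {E : Type*} [NormedAddCommGroup E] [InnerProductSpace ℝ E] (x : ℕ → E) (C : ℝ)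
    (hx : ∀ n, ‖x n‖ ≤ C) (c : ℕ → ℕ → ℝ)
    (hc : ∀ h k, Tendsto (fun N : ℕ => (N : ℝ)⁻¹ *
      ∑ n ∈ Finset.range N, inner ℝ (x (n + h)) (x (n + k))) atTop (𝓝 (c h k)))
    (hc0 : Tendsto (fun H : ℕ => (H : ℝ)⁻¹ ^ 2 *
      ∑ h ∈ Finset.range H, ∑ k ∈ Finset.range H, c h k) atTop (𝓝 0)) :
    Tendsto (fun N : ℕ => (N : ℝ)⁻¹ • ∑ n ∈ Finset.range N, x n) atTop (𝓝 0) := by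
  rw [Metric.tendsto_nhds]
  intro ε hε
  obtain ⟨H, hH, hH1⟩ := ((hc0.eventually_lt_const (show (0:ℝ) < (ε/2)^2 by positivity)).and
    (eventually_ge_atTop 1)).exists
  set y : ℕ → E := fun n => (H : ℝ)⁻¹ • ∑ h ∈ Finset.range H, x (n + h) with hy
  have hd : Tendsto (fun N : ℕ => (N : ℝ)⁻¹ • ∑ n ∈ Finset.range N, (x n - y n)) atTop (𝓝 0) := by
    have : Tendsto (fun N : ℕ => (H : ℝ)⁻¹ • ∑ h ∈ Finset.range H,
      (N : ℝ)⁻¹ • ∑ n ∈ Finset.range N, (x n - x (n + h))) atTop (𝓝 0) := by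
      simpa using (tendsto_finsetSum (Finset.range H)
        (fun h _ => aux_shift x C hx h)).const_smul (H : ℝ)⁻¹
    refine this.congr (fun N => ?_)
    rw [← Finset.smul_sum, smul_comm, Finset.sum_comm, Finset.smul_sum]
    congr 1
    refine Finset.sum_congr rfl fun n _ => ?_
    rw [Finset.sum_sub_distrib, smul_sub]
    congr 1
    have : (H : ℝ) ≠ 0 := by positivity
    simp [← Nat.cast_smul_eq_nsmul ℝ, smul_smul, this]
  have hy2 : Tendsto (fun N : ℕ => (N : ℝ)⁻¹ * ∑ n ∈ Finset.range N, ‖y n‖ ^ 2) atTop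
      (𝓝 ((H : ℝ)⁻¹ ^ 2 * ∑ h ∈ Finset.range H, ∑ k ∈ Finset.range H, c h k)) := by
    have : Tendsto (fun N : ℕ => (H : ℝ)⁻¹ ^ 2 * ∑ h ∈ Finset.range H, ∑ k ∈ Finset.range H,
      ((N : ℝ)⁻¹ * ∑ n ∈ Finset.range N, inner ℝ (x (n + h)) (x (n + k)))) atTop
      (𝓝 ((H : ℝ)⁻¹ ^ 2 * ∑ h ∈ Finset.range H, ∑ k ∈ Finset.range H, c h k)) :=
      (tendsto_finsetSum _ fun h _ => tendsto_finsetSum _ fun k _ => hc h k).const_mul _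
    refine this.congr (fun N => ?_)
    have e : ∀ n, ‖y n‖ ^ 2 = (H : ℝ)⁻¹ ^ 2 * ∑ h ∈ Finset.range H, ∑ k ∈ Finset.range H,
        inner ℝ (x (n + h)) (x (n + k)) := by
      intro n
      rw [hy, ← real_inner_self_eq_norm_sq]
      simp only [real_inner_smul_left, real_inner_smul_right]
      rw [← mul_assoc, ← sq, sum_inner]
      simp only [inner_sum]
    simp_rw [e, ← Finset.mul_sum]
    rw [mul_left_comm]
    congr 2
    simp_rw [Finset.sum_comm (s := Finset.range H) (t := Finset.range N)]
  have hyN := hy2.eventually_lt_const hH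
  rw [Metric.tendsto_nhds] at hd
  filter_upwards [hyN, hd (ε/2) (by positivity)] with N h1 h2
  rw [dist_zero_right] at h2 ⊢
  have h3 := (aux_norm_avg y N).trans_lt h1
  have h4 : ‖(N : ℝ)⁻¹ • ∑ n ∈ Finset.range N, y n‖ < ε/2 :=
    lt_of_pow_lt_pow_left₀ 2 (by positivity) h3
  have h5 := norm_add_le ((N : ℝ)⁻¹ • ∑ n ∈ Finset.range N, (x n - y n))
    ((N : ℝ)⁻¹ • ∑ n ∈ Finset.range N, y n)
  rw [← smul_add, ← Finset.sum_add_distrib] at h5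
  simp only [sub_add_cancel] at h5
  linarith


lemma aux_inner {X : Type*} [MeasurableSpace X] {μ : Measure X} {u v : X → ℝ}
    (hu : MemLp u 2 μ) (hv : MemLp v 2 μ) :
    inner ℝ (hu.toLp u) (hv.toLp v) = ∫ x, u x * v x ∂μ := by
  rw [L2.inner_def]
  apply integral_congr_ae
  filter_upwards [hu.coeFn_toLp, hv.coeFn_toLp] with x h1 h2
  rw [h1, h2]
  simp [mul_comm]

lemma aux_ergodic {X : Type*} [MeasurableSpace X] {μ : Measure X} [IsProbabilityMeasure μ]
    {S : X → X} (hS : Ergodic S μ) {u v : X → ℝ} (hu : MemLp u 2 μ) (hv : MemLp v 2 μ) :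
    Tendsto (fun N : ℕ => (N : ℝ)⁻¹ * ∑ n ∈ Finset.range N, ∫ x, u x * v (S^[n] x) ∂μ) atTop
      (𝓝 ((∫ x, u x ∂μ) * ∫ x, v x ∂μ)) := by
  have hmp := hS.toMeasurePreserving
  set K : Lp ℝ 2 μ →L[ℝ] Lp ℝ 2 μ :=
    (Lp.compMeasurePreservingₗᵢ ℝ S hmp).toContinuousLinearMap with hK
  have hK1 : ‖K‖ ≤ 1 := LinearIsometry.norm_toContinuousLinearMap_le _
  have hKt : ∀ (w : X → ℝ) (hw : MemLp w 2 μ),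
      K (hw.toLp w) = (hw.comp_measurePreserving hmp).toLp (w ∘ S) := fun w hw =>
    Lp.toLp_compMeasurePreserving hw hmp
  have hKn : ∀ n, K^[n] (hv.toLp v) =
      (hv.comp_measurePreserving (hmp.iterate n)).toLp (v ∘ S^[n]) := by
    intro n
    induction n with
    | zero => simp
    | succ n ih =>
      rw [Function.iterate_succ_apply', ih, hKt]
      congr 1
      
  have hme := K.tendsto_birkhoffAverage_orthogonalProjection hK1 (hv.toLp v)
  set P := (K.eqLocus (1 : Lp ℝ 2 μ →L[ℝ] Lp ℝ 2 μ)).orthogonalProjectionOnto (hv.toLp v) with hP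
  have h1 : MemLp (fun _ : X => (1 : ℝ)) 2 μ := memLp_const 1
  have hfix : K (P : Lp ℝ 2 μ) = P := P.2
  obtain ⟨c, hc⟩ : ∃ c, (P : Lp ℝ 2 μ) =ᵐ[μ] Function.const X c := by
    apply hS.ae_eq_const_of_ae_eq_comp_ae (Lp.aestronglyMeasurable _)
    have := Lp.coeFn_compMeasurePreserving (P : Lp ℝ 2 μ) hmp
    have h2 : Lp.compMeasurePreserving S hmp (P : Lp ℝ 2 μ) = P := hfix
    rw [h2] at this
    exact this.symm
  have hc' : (P : Lp ℝ 2 μ) = (memLp_const c).toLp (fun _ : X => c) := by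
    apply Lp.ext
    exact hc.trans (MemLp.coeFn_toLp _).symm
  have lim : ∀ (w : X → ℝ) (hw : MemLp w 2 μ),
      Tendsto (fun N : ℕ => (N : ℝ)⁻¹ * ∑ n ∈ Finset.range N, ∫ x, w x * v (S^[n] x) ∂μ) atTop
      (𝓝 ((∫ x, w x ∂μ) * c)) := by
    intro w hw
    have h3 := (tendsto_const_nhds (x := hw.toLp w)).inner (𝕜 := ℝ) hme
    rw [hc', aux_inner, integral_mul_const] at h3
    refine h3.congr fun N => ?_
    rw [birkhoffAverage, birkhoffSum, real_inner_smul_right, inner_sum]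
    congr 1
    refine Finset.sum_congr rfl fun n _ => ?_
    rw [id, hKn, aux_inner]
    rfl
  have hcv : c = ∫ x, v x ∂μ := by
    have h4 := lim _ h1
    simp only [one_mul, integral_const, probReal_univ, smul_eq_mul, mul_one] at h4
    refine tendsto_nhds_unique h4 ?_
    refine Tendsto.congr' ?_ tendsto_const_nhds
    filter_upwards [eventually_ge_atTop 1] with N hN
    have h5 : ∀ n, ∫ x, v (S^[n] x) ∂μ = ∫ x, v x ∂μ := by
      intro n
      have hm := hmp.iterate n
      conv_rhs => rw [← hm.map_eq]
      rw [integral_map hm.measurable.aemeasurable]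
      rw [hm.map_eq]; exact hv.1
    simp only [h5, Finset.sum_const, Finset.card_range, nsmul_eq_mul]
    have : (N : ℝ) ≠ 0 := by positivity
    field_simp
  rw [← hcv]
  exact lim u hu

lemma aux_memLp {X : Type*} [MeasurableSpace X] {μ : Measure X} [IsProbabilityMeasure μ]
    {u : X → ℝ} (hm : Measurable u) {C : ℝ} (hb : ∀ x, |u x| ≤ C) : MemLp u 2 μ :=
  MemLp.of_bound hm.aestronglyMeasurable C (ae_of_all _ hb)

lemma aux_abs_mul {a b C D : ℝ} (ha : |a| ≤ C) (hb : |b| ≤ D) : |a * b| ≤ C * D := by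
  rw [abs_mul]
  exact mul_le_mul ha hb (abs_nonneg _) ((abs_nonneg _).trans ha)

lemma aux_integral_comp {X : Type*} [MeasurableSpace X] {μ : Measure X}
    {S : X → X} (hS : MeasurePreserving S μ μ) {u : X → ℝ} (hu : Measurable u) :
    ∫ x, u (S x) ∂μ = ∫ x, u x ∂μ := by
  conv_rhs => rw [← hS.map_eq]
  rw [integral_map hS.measurable.aemeasurable hu.aestronglyMeasurable]

lemma aux_pmap {X : Type*} (S : X → X) (n : ℕ) (z : X × X) :
    (Prod.map S S)^[n] z = (S^[n] z.1, S^[n] z.2) := by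
  rw [Prod.map_iterate]; rfl

lemma aux_erg_base {X : Type*} [MeasurableSpace X] {μ : Measure X} [IsProbabilityMeasure μ]
    {S : X → X} (hwm : Ergodic (Prod.map S S) (μ.prod μ))
    {u v : X → ℝ} {C D : ℝ} (hu : Measurable u) (hub : ∀ x, |u x| ≤ C)
    (hv : Measurable v) (hvb : ∀ x, |v x| ≤ D) :
    Tendsto (fun N : ℕ => (N : ℝ)⁻¹ * ∑ n ∈ Finset.range N, ∫ x, u x * v (S^[n] x) ∂μ) atTop
      (𝓝 ((∫ x, u x ∂μ) * ∫ x, v x ∂μ)) := by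
  have := aux_ergodic hwm (u := fun z => u z.1) (v := fun z => v z.1)
    (aux_memLp (hu.comp measurable_fst) (fun _ => hub _))
    (aux_memLp (hv.comp measurable_fst) (fun _ => hvb _))
  simp only [aux_pmap] at this
  have e : ∀ w : X → ℝ, ∫ z, w z.1 ∂(μ.prod μ) = ∫ x, w x ∂μ := by
    intro w; rw [integral_fun_fst]; simp
  rw [e, e] at this
  refine this.congr fun N => ?_
  congr 1
  exact Finset.sum_congr rfl fun n _ => e (fun x => u x * v (S^[n] x))

lemma aux_wm {X : Type*} [MeasurableSpace X] {μ : Measure X} [IsProbabilityMeasure μ]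
    {S : X → X} (hwm : Ergodic (Prod.map S S) (μ.prod μ))
    {u v : X → ℝ} {C D : ℝ} (hu : Measurable u) (hub : ∀ x, |u x| ≤ C)
    (hv : Measurable v) (hvb : ∀ x, |v x| ≤ D) (hv0 : ∫ x, v x ∂μ = 0) :
    Tendsto (fun N : ℕ => (N : ℝ)⁻¹ * ∑ n ∈ Finset.range N, (∫ x, u x * v (S^[n] x) ∂μ) ^ 2) atTop
      (𝓝 0) := by
  have := aux_ergodic hwm (u := fun z => u z.1 * u z.2) (v := fun z => v z.1 * v z.2)
    (aux_memLp ((hu.comp measurable_fst).mul (hu.comp measurable_snd))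
      (fun _ => aux_abs_mul (hub _) (hub _)))
    (aux_memLp ((hv.comp measurable_fst).mul (hv.comp measurable_snd))
      (fun _ => aux_abs_mul (hvb _) (hvb _)))
  simp only [aux_pmap] at this
  rw [integral_prod_mul v v, hv0, mul_zero, mul_zero] at this
  refine this.congr fun N => ?_
  congr 1
  refine Finset.sum_congr rfl fun n _ => ?_
  rw [sq, ← integral_prod_mul]
  refine integral_congr_ae (ae_of_all _ fun z => ?_)
  ring

lemma aux_triple_zero {X : Type*} [MeasurableSpace X] {μ : Measure X} [IsProbabilityMeasure μ]
    {S : X → X} (hS : MeasurePreserving S μ μ)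
    (hwm : Ergodic (Prod.map S S) (μ.prod μ))
    {f g : X → ℝ} {C : ℝ} (hf : Measurable f) (hfb : ∀ x, |f x| ≤ C)
    (hg : Measurable g) {D : ℝ} (hgb : ∀ x, |g x| ≤ D) (hg0 : ∫ x, g x ∂μ = 0) :
    Tendsto (fun N : ℕ => (N : ℝ)⁻¹ * ∑ n ∈ Finset.range N,
      ∫ x, f x * (g (S^[n] x) * f (S^[2 * n] x)) ∂μ) atTop (𝓝 0) := by
  have hSm := hS.measurable
  have hx : ∀ n, MemLp (fun x => g (S^[n] x) * f (S^[2 * n] x)) 2 μ := fun n =>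
    aux_memLp ((hg.comp (hSm.iterate n)).mul (hf.comp (hSm.iterate (2 * n))))
      (fun _ => aux_abs_mul (hgb _) (hfb _))
  have hmf : MemLp f 2 μ := aux_memLp hf hfb
  let G : ℕ → ℕ → ℝ := fun h k => ∫ x, g (S^[h] x) * g (S^[k] x) ∂μ
  let F : ℕ → ℕ → ℝ := fun h k => ∫ x, f (S^[2 * h] x) * f (S^[2 * k] x) ∂μ
  have hFb : ∀ h k, |F h k| ≤ C * C := by
    intro h k
    have := norm_integral_le_of_norm_le_const (μ := μ)
      (f := fun x => f (S^[2 * h] x) * f (S^[2 * k] x)) (C := C * C)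
      (ae_of_all _ fun x => aux_abs_mul (hfb _) (hfb _))
    simpa using this
  have hGs : ∀ h m, G h (h + m) = ∫ x, g x * g (S^[m] x) ∂μ := by
    intro h m
    rw [← aux_integral_comp (hS.iterate h) (u := fun x => g x * g (S^[m] x))
      (hg.mul (hg.comp (hSm.iterate m)))]
    refine integral_congr_ae (ae_of_all _ fun x => ?_)
    simp [← Function.iterate_add_apply, add_comm h m]
  have hGc : ∀ h k, G h k = G k h := fun h k => by simp only [G, mul_comm]
  have key := aux_vdc (E := Lp ℝ 2 μ) (fun n => (hx n).toLp _) (D * C) ?_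
    (fun h k => G h k * F h k) ?_ ?_
  · have h3 := (tendsto_const_nhds (x := hmf.toLp f)).inner (𝕜 := ℝ) key
    rw [inner_zero_right] at h3
    refine h3.congr fun N => ?_
    rw [real_inner_smul_right, inner_sum]
    congr 1
    refine Finset.sum_congr rfl fun n _ => ?_
    rw [aux_inner]
  · intro n
    have h0 : 0 ≤ D * C := by
      obtain ⟨x⟩ := μ.nonempty_of_neZero
      exact (abs_nonneg _).trans (aux_abs_mul (hgb x) (hfb x))
    refine (Lp.norm_le_of_ae_bound h0 (C := D * C) ?_).trans ?_
    · filter_upwards [(hx n).coeFn_toLp] with x hx'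
      rw [hx']
      exact aux_abs_mul (hgb _) (hfb _)
    · simp [measureUnivNNReal]
  · intro h k
    have hb := aux_erg_base hwm (u := fun x => g (S^[h] x) * g (S^[k] x))
      (v := fun x => f (S^[2 * h] x) * f (S^[2 * k] x))
      ((hg.comp (hSm.iterate h)).mul (hg.comp (hSm.iterate k)))
      (fun _ => aux_abs_mul (hgb _) (hgb _))
      ((hf.comp (hSm.iterate (2 * h))).mul (hf.comp (hSm.iterate (2 * k))))
      (fun _ => aux_abs_mul (hfb _) (hfb _))
    refine hb.congr fun N => ?_
    congr 1
    refine Finset.sum_congr rfl fun n _ => ?_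
    rw [aux_inner]
    rw [← aux_integral_comp (hS.iterate n)]
    · refine integral_congr_ae (ae_of_all _ fun x => ?_)
      simp only [← Function.iterate_add_apply]
      rw [show 2 * h + (n + n) = 2 * (n + h) by ring, show 2 * k + (n + n) = 2 * (n + k) by ring,
        add_comm h n, add_comm k n]
      ring
    · exact ((hg.comp (hSm.iterate h)).mul (hg.comp (hSm.iterate k))).mul
        (((hf.comp (hSm.iterate (2 * h))).mul (hf.comp (hSm.iterate (2 * k)))).comp
          (hSm.iterate n))
  · have hρ := aux_abs_avg _ (aux_wm hwm hg hgb hg hgb hg0)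
    set ρ : ℕ → ℝ := fun m => |∫ x, g x * g (S^[m] x) ∂μ| with hρd
    have hρ' := hρ.const_mul (2 * (C * C))
    rw [mul_zero] at hρ'
    have hC : 0 ≤ C * C := mul_self_nonneg C
    refine squeeze_zero_norm (fun H => ?_) hρ'
    rcases Nat.eq_zero_or_pos H with rfl | hH
    · simp
    have hs := aux_sum_dist (fun m => C * C * ρ m) (fun m => by positivity)
      (fun h k => |G h k * F h k|)
      (fun h m => by
        rw [hGc, hGs, mul_comm]
        exact (aux_abs_mul (hFb _ _) le_rfl))
      (fun h m => by
        rw [hGs, mul_comm]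
        exact (aux_abs_mul (hFb _ _) le_rfl)) H
    rw [← Finset.mul_sum] at hs
    rw [norm_mul, norm_pow, norm_inv, RCLike.norm_natCast]
    calc _ ≤ (H : ℝ)⁻¹ ^ 2 * ∑ h ∈ Finset.range H, ∑ k ∈ Finset.range H, |G h k * F h k| := by
          gcongr
          refine norm_sum_le_of_le _ fun h _ => ?_
          exact norm_sum_le _ _
      _ ≤ (H : ℝ)⁻¹ ^ 2 * (2 * H * (C * C * ∑ m ∈ Finset.range H, ρ m)) := by gcongr
      _ = _ := by field_simp

lemma aux_even {X : Type*} [MeasurableSpace X] {μ : Measure X} [IsProbabilityMeasure μ]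
    {S : X → X} (hwm : Ergodic (Prod.map S S) (μ.prod μ))
    {u v : X → ℝ} {C D : ℝ} (hu : Measurable u) (hub : ∀ x, |u x| ≤ C)
    (hv : Measurable v) (hvb : ∀ x, |v x| ≤ D) (hv0 : ∫ x, v x ∂μ = 0) :
    Tendsto (fun N : ℕ => (N : ℝ)⁻¹ * ∑ n ∈ Finset.range N, ∫ x, u x * v (S^[2 * n] x) ∂μ) atTop
      (𝓝 0) := by
  have h1 := aux_abs_avg _ (aux_wm hwm hu hub hv hvb hv0)
  have h2 : Tendsto (fun N : ℕ => 2 * N) atTop atTop :=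
    tendsto_id.const_mul_atTop' (by norm_num)
  have h3 := (h1.comp h2).const_mul 2
  rw [mul_zero] at h3
  refine squeeze_zero_norm (fun N => ?_) h3
  set b : ℕ → ℝ := fun m => ∫ x, u x * v (S^[m] x) ∂μ
  have h4 : ∑ n ∈ Finset.range N, |b (2 * n)| ≤ ∑ m ∈ Finset.range (2 * N), |b m| := by
    induction N with
    | zero => simp
    | succ N ih =>
      rw [Finset.sum_range_succ, show 2 * (N + 1) = 2 * N + 1 + 1 by ring,
        Finset.sum_range_succ, Finset.sum_range_succ]
      linarith [abs_nonneg (b (2 * N + 1))]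
  rw [norm_mul, norm_inv, RCLike.norm_natCast]
  calc _ ≤ (N : ℝ)⁻¹ * ∑ m ∈ Finset.range (2 * N), |b m| := by
        gcongr
        exact (norm_sum_le _ _).trans h4
    _ = _ := by
        simp only [Function.comp]
        push_cast
        rw [mul_inv]
        ring

lemma aux_triple {X : Type*} [MeasurableSpace X] {μ : Measure X} [IsProbabilityMeasure μ]
    {S : X → X} (hS : MeasurePreserving S μ μ)
    (hwm : Ergodic (Prod.map S S) (μ.prod μ))
    {f : X → ℝ} {C : ℝ} (hf : Measurable f) (hfb : ∀ x, |f x| ≤ C) :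
    Tendsto (fun N : ℕ => (N : ℝ)⁻¹ * ∑ n ∈ Finset.range N,
      ∫ x, f x * f (S^[n] x) * f (S^[2 * n] x) ∂μ) atTop (𝓝 ((∫ x, f x ∂μ) ^ 3)) := by
  have hSm := hS.measurable
  set a := ∫ x, f x ∂μ with ha
  have hfi : Integrable f μ := (aux_memLp hf hfb).integrable (by norm_num)
  have hg : Measurable (fun x => f x - a) := hf.sub_const a
  have hgb : ∀ x, |f x - a| ≤ C + |a| := fun x => (abs_sub _ _).trans (by linarith [hfb x])
  have hg0 : ∫ x, (f x - a) ∂μ = 0 := by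
    rw [integral_sub hfi (integrable_const a)]; simp [ha]
  have t1 := aux_triple_zero hS hwm hf hfb hg hgb hg0
  have t2 := (aux_even hwm hf hfb hg hgb hg0).const_mul a
  have t3 := (t1.add t2).add_const (a ^ 3)
  rw [mul_zero, add_zero, zero_add] at t3
  refine t3.congr' ?_
  filter_upwards [eventually_ge_atTop 1] with N hN
  have e : ∀ n, ∫ x, f x * f (S^[n] x) * f (S^[2 * n] x) ∂μ =
      ∫ x, f x * ((f (S^[n] x) - a) * f (S^[2 * n] x)) ∂μ
        + a * ∫ x, f x * (f (S^[2 * n] x) - a) ∂μ + a ^ 3 := by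
    intro n
    have i1 : Integrable (fun x => f x * ((f (S^[n] x) - a) * f (S^[2 * n] x))) μ :=
      (aux_memLp (hf.mul ((hg.comp (hSm.iterate n)).mul (hf.comp (hSm.iterate (2 * n)))))
        (fun _ => aux_abs_mul (hfb _) (aux_abs_mul (hgb _) (hfb _)))).integrable (by norm_num)
    have i2 : Integrable (fun x => f x * (f (S^[2 * n] x) - a)) μ :=
      (aux_memLp (hf.mul (hg.comp (hSm.iterate (2 * n))))
        (fun _ => aux_abs_mul (hfb _) (hgb _))).integrable (by norm_num)
    have e3 : a ^ 3 = ∫ x, a ^ 2 * f x ∂μ := by rw [integral_const_mul, ← ha]; ring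
    rw [e3, ← integral_const_mul, ← integral_add i1 (i2.const_mul a),
      ← integral_add (f := fun x => f x * ((f (S^[n] x) - a) * f (S^[2 * n] x))
        + a * (f x * (f (S^[2 * n] x) - a))) (i1.add (i2.const_mul a)) (hfi.const_mul _)]
    refine integral_congr_ae (ae_of_all _ fun x => ?_)
    ring
  simp only [e, Finset.sum_add_distrib, ← Finset.mul_sum, Finset.sum_const, Finset.card_range,
    nsmul_eq_mul]
  have : (N : ℝ) ≠ 0 := by positivity
  field_simp

/-- For a weakly mixing invertible probability measure-preserving system `(X, μ, T)` —
weak mixing meaning that the diagonal product system `(X × X, μ × μ, T × T)` is ergodic —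
and a real-valued `f ∈ L^∞(μ)`, the triple correlation averages
`(1/N) Σ_{n=1}^N ∫ f(x) f(Tⁿx) f(T^{2n}x) dμ` converge to `(∫ f dμ)³`. -/
theorem weakly_mixing_triple_correlation_average
    {X : Type*} [MeasurableSpace X] (μ : Measure X) [IsProbabilityMeasure μ]
    (T : X ≃ᵐ X) (hT : MeasurePreserving (⇑T) μ μ)
    (hwm : Ergodic (Prod.map (⇑T) (⇑T)) (μ.prod μ))
    (f : X → ℝ) (hf : Measurable f) (hbd : ∃ C : ℝ, ∀ᵐ x ∂μ, |f x| ≤ C) :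
    Tendsto (fun N : ℕ =>
        (1 / (N : ℝ)) * ∑ n ∈ Finset.Icc 1 N,
          ∫ x, f x * f ((⇑T)^[n] x) * f ((⇑T)^[2 * n] x) ∂μ)
      atTop (𝓝 ((∫ x, f x ∂μ) ^ 3)) := by
  obtain ⟨C, hC⟩ := hbd
  set S : X → X := ⇑T
  set g : X → ℝ := fun x => max (-|C|) (min |C| (f x)) with hgd
  have hg : Measurable g := measurable_const.max (measurable_const.min hf)
  have hgb : ∀ x, |g x| ≤ |C| := fun x => by
    rw [abs_le]
    exact ⟨le_max_left _ _, max_le (by linarith [abs_nonneg C]) (min_le_left _ _)⟩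
  have hfg : ∀ᵐ x ∂μ, f x = g x := by
    filter_upwards [hC] with x hx
    have h := abs_le.1 (hx.trans (le_abs_self C))
    rw [hgd]
    simp only
    rw [min_eq_right h.2, max_eq_right h.1]
  have hfgn : ∀ n, ∀ᵐ x ∂μ, f (S^[n] x) = g (S^[n] x) := fun n =>
    (hT.iterate n).quasiMeasurePreserving.ae hfg
  have e0 : ∫ x, f x ∂μ = ∫ x, g x ∂μ := integral_congr_ae hfg
  have en : ∀ n, ∫ x, f x * f (S^[n] x) * f (S^[2 * n] x) ∂μ
      = ∫ x, g x * g (S^[n] x) * g (S^[2 * n] x) ∂μ := by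
    intro n
    apply integral_congr_ae
    filter_upwards [hfg, hfgn n, hfgn (2 * n)] with x h1 h2 h3
    rw [h1, h2, h3]
  simp only [en, e0]
  set b : ℕ → ℝ := fun n => ∫ x, g x * g (S^[n] x) * g (S^[2 * n] x) ∂μ with hb
  have hbb : ∀ n, ‖b n‖ ≤ |C| * |C| * |C| := by
    intro n
    have := norm_integral_le_of_norm_le_const (μ := μ)
      (f := fun x => g x * g (S^[n] x) * g (S^[2 * n] x)) (C := |C| * |C| * |C|)
      (ae_of_all _ fun x => aux_abs_mul (aux_abs_mul (hgb _) (hgb _)) (hgb _))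
    simpa using this
  have t := (aux_triple hT hwm hg hgb).sub (aux_shift b _ hbb 1)
  rw [sub_zero] at t
  refine t.congr fun N => ?_
  rw [smul_eq_mul, ← mul_sub, ← Finset.sum_sub_distrib, one_div]
  congr 1
  rw [Finset.range_eq_Ico, Finset.sum_congr rfl (fun n _ => sub_sub_cancel (b n) (b (n + 1))),
    Finset.sum_Ico_add' b 0 N 1]
  congr 1
end
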